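/- Let X be an irreducible, critical multitype Galton-Watson tree with offspring sizes uniformly bounded by N₀, conditioned to have exactly n vertices, and fix k ≥ 1. Then, as n → ∞ along integers n with P{|T| = n} > 0, the k-generation empirical offspring measure M_X^k satisfies a large deviation principle in ℳ(𝒳(k)) with speed n and the convex good rate function J_k, where J_k(μ) = H(μ ∥ μ∘π_{k,k−1}^{-1} ⊗₁ 𝒬) if μ is shift-invariant on 𝒳(k) and J_k(μ) = ∞ otherwise. -/

import Mathlib

open scoped ENNReal NNReal BigOperators
open Filter

/-- Finite rooted planar trees with vertex types in `𝒳`. -/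
inductive PTree (𝒳 : Type*) where
  | node : 𝒳 → List (PTree 𝒳) → PTree 𝒳

namespace PTree

variable {𝒳 : Type*}

/-- The type of the root. -/
def root : PTree 𝒳 → 𝒳
  | node a _ => a

/-- The list of subtrees rooted at the children of the root (left to right). -/
def children : PTree 𝒳 → List (PTree 𝒳)
  | node _ ts => ts

/-- The types of the children of the root, from left to right. -/
def childLabels (t : PTree 𝒳) : List 𝒳 := t.children.map root

/-- The list of all subtrees `X^v`, `v` a vertex of the tree. -/
def subtrees : PTree 𝒳 → List (PTree 𝒳)
  | node a ts => node a ts :: (ts.attach.map (fun s => subtrees s.1)).flatten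
decreasing_by
  have := List.sizeOf_lt_of_mem s.2
  simp only [PTree.node.sizeOf_spec]
  omega

/-- Number of vertices. -/
def size (t : PTree 𝒳) : ℕ := t.subtrees.length

/-- The vertices at depth exactly `k`, as subtrees, from left to right. -/
def atDepth : ℕ → PTree 𝒳 → List (PTree 𝒳)
  | 0, t => [t]
  | (k+1), node _ ts => (ts.attach.map (fun s => atDepth k s.1)).flatten

/-- Truncation of a tree at height `k` (keeping the generations `0,…,k`). -/
def trunc : ℕ → PTree 𝒳 → PTree 𝒳
  | 0, node a _ => node a []
  | (k+1), node a ts => node a (ts.attach.map (fun s => trunc k s.1))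

/-- The height of a tree (largest `k` such that generation `k` is nonempty). -/
def height : PTree 𝒳 → ℕ
  | node _ [] => 0
  | node _ (t :: ts) => ((t :: ts).attach.map (fun s => height s.1)).foldr max 0 + 1
decreasing_by
  have := List.sizeOf_lt_of_mem s.2
  simp only [PTree.node.sizeOf_spec] at *
  omega

/-- The largest offspring number in the tree. -/
def maxDeg : PTree 𝒳 → ℕ
  | node _ ts => max ts.length (((ts.attach.map (fun s => maxDeg s.1)).foldr max 0))
decreasing_by
  have := List.sizeOf_lt_of_mem s.2
  simp only [PTree.node.sizeOf_spec] at *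
  omega

end PTree
noncomputable instance {𝒳 : Type*} : DecidableEq (PTree 𝒳) := Classical.decEq _

/-- Extended-real logarithm of an extended nonnegative real. -/
noncomputable def elog (x : ℝ≥0∞) : EReal :=
  if x = 0 then ⊥ else if x = ∞ then ⊤ else ((Real.log x.toReal : ℝ) : EReal)

open Classical in
/-- Relative entropy `H(ν ‖ ρ)` of two (probability) vectors on a countable set,
with value `∞` if `ν` is not absolutely continuous with respect to `ρ`.  (For
probability vectors each summand below is nonnegative and the sum equals
`∑ ν a log (ν a / ρ a)`.) -/
noncomputable def relEnt {α : Type*} (ν ρ : α → ℝ) : ℝ≥0∞ :=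
  if ∀ a, ρ a = 0 → ν a = 0 then
    ∑' a, ENNReal.ofReal (ν a * Real.log (ν a / ρ a) + ρ a - ν a)
  else ∞

/-- The Cramér rate function `I_p(x) = sup_λ {λx - log ∑ p(n) e^{λn}}`. -/
noncomputable def cramerRate (p : ℕ → ℝ) (x : ℝ) : EReal :=
  ⨆ lam : ℝ, ((lam * x - Real.log (∑' n : ℕ, p n * Real.exp (lam * n)) : ℝ) : EReal)

/-- Total mass `P{|T| = n}` assigned by the weight `w` to trees with `n` vertices. -/
noncomputable def treeMass {𝒳 : Type*} (w : PTree 𝒳 → ℝ) (n : ℕ) : ℝ≥0∞ :=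
  ∑' t : PTree 𝒳, if t.size = n then ENNReal.ofReal (w t) else 0

open Classical in
/-- Conditional probability of the event `E` given `{|T| = n}`, for the (sub)probability
weight `w` on finite planar trees.  -/
noncomputable def condP {𝒳 : Type*} (w : PTree 𝒳 → ℝ) (n : ℕ) (E : Set (PTree 𝒳)) : ℝ≥0∞ :=
  (∑' t : PTree 𝒳, if t.size = n ∧ t ∈ E then ENNReal.ofReal (w t) else 0) / treeMass w n

/-- The set of sizes having positive probability. -/
noncomputable def sizeSupport {𝒳 : Type*} (w : PTree 𝒳 → ℝ) : Set ℕ := {n | 0 < treeMass w n}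
section Multitype

variable {𝒳 : Type*} [Fintype 𝒳] [DecidableEq 𝒳]

/-- The weight of a typed tree under the multitype Galton-Watson law with initial
distribution `μ0` and offspring kernel `𝒬` (an offspring `c ∈ 𝒳*` is recorded as the
list of types of the children from left to right):
`μ0(root) ∏_v 𝒬{C(v) | type v}`. -/
noncomputable def mgwWeight (μ0 : 𝒳 → ℝ) (𝒬 : 𝒳 → List 𝒳 → ℝ) (t : PTree 𝒳) : ℝ :=
  μ0 t.root * (t.subtrees.map (fun s => 𝒬 s.root s.childLabels)).prod

/-- The multiplicity `m(a,c)` of the symbol `a` in `c ∈ 𝒳*`. -/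
def mult (a : 𝒳) (c : List 𝒳) : ℕ := c.count a

/-- The empirical offspring measure `M_X` of a typed tree. -/
noncomputable def empOff (t : PTree 𝒳) : 𝒳 × List 𝒳 → ℝ := fun x =>
  ((t.subtrees.filter (fun s => s.root = x.1 ∧ s.childLabels = x.2)).length : ℝ) / t.size

/-- The `𝒳`-marginal `ν₁` of a measure on `𝒳 × 𝒳*`. -/
noncomputable def marg1 (ν : 𝒳 × List 𝒳 → ℝ) (a : 𝒳) : ℝ := ∑' c : List 𝒳, ν (a, c)

/-- Shift-invariance: `ν₁(a) = ∑_{(b,c)} m(a,c) ν(b,c)` for all `a`. -/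
def ShiftInv (ν : 𝒳 × List 𝒳 → ℝ) : Prop :=
  ∀ a : 𝒳, marg1 ν a = ∑' x : 𝒳 × List 𝒳, (mult a x.2 : ℝ) * ν x

/-- Membership in `ℳ(𝒳 × 𝒳*)`: a probability measure with finite mean offspring
number. -/
structure IsOffMeasure (ν : 𝒳 × List 𝒳 → ℝ) : Prop where
  nonneg : ∀ x, 0 ≤ ν x
  hasSum : HasSum ν 1
  moment : Summable (fun x : 𝒳 × List 𝒳 => (x.2.length : ℝ) * ν x)

/-- The space `ℳ(𝒳 × 𝒳*)`. -/
def MSpace (𝒳 : Type*) [Fintype 𝒳] [DecidableEq 𝒳] :=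
  {ν : 𝒳 × List 𝒳 → ℝ // IsOffMeasure ν}

/-- The test functions defining the topology of `ℳ(𝒳 × 𝒳*)`: all bounded functions
together with the functions `(b,c) ↦ m(a,c) 𝟙_{b₀}(b)`, `a, b₀ ∈ 𝒳`. -/
def offTests (𝒳 : Type*) [Fintype 𝒳] [DecidableEq 𝒳] : Set ((𝒳 × List 𝒳) → ℝ) :=
  {f | ∃ M : ℝ, ∀ x, |f x| ≤ M} ∪
    {f | ∃ a b₀ : 𝒳, f = fun x => (mult a x.2 : ℝ) * (if x.1 = b₀ then 1 else 0)}

/-- The topology of `ℳ(𝒳 × 𝒳*)`: the smallest topology making `ν ↦ ∫ f dν`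
continuous for every test function `f`. -/
noncomputable instance : TopologicalSpace (MSpace 𝒳) :=
  TopologicalSpace.induced
    (fun ν : MSpace 𝒳 => fun f : offTests 𝒳 => ∑' x, ν.1 x * f.1 x) Pi.topologicalSpace

open Classical in
/-- The rate function `J(ν) = H(ν ‖ ν₁ ⊗ 𝒬)` for shift-invariant `ν`, `∞` otherwise. -/
noncomputable def offRate (𝒬 : 𝒳 → List 𝒳 → ℝ) (ν : 𝒳 × List 𝒳 → ℝ) : ℝ≥0∞ :=
  if ShiftInv ν then relEnt ν (fun x => marg1 ν x.1 * 𝒬 x.1 x.2) else ∞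

/-- The expected offspring matrix `A(a,b) = ∑_c 𝒬{c | b} m(a,c)` (with values in
`[0,∞]`). -/
noncomputable def meanMat (𝒬 : 𝒳 → List 𝒳 → ℝ) : Matrix 𝒳 𝒳 ℝ≥0∞ :=
  Matrix.of fun a b => ∑' c : List 𝒳, ENNReal.ofReal (𝒬 b c) * (mult a c : ℝ≥0∞)

/-- `A* = ∑_{k ≥ 1} A^k`. -/
noncomputable def matStar (A : Matrix 𝒳 𝒳 ℝ≥0∞) : Matrix 𝒳 𝒳 ℝ≥0∞ :=
  Matrix.of fun a b => ∑' k : ℕ, (A ^ (k + 1)) a b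

/-- Weak irreducibility of a nonnegative matrix with respect to a partition of `𝒳`
into recurrent states `Xr` and transient states `Xt`. -/
structure WeaklyIrred (A : Matrix 𝒳 𝒳 ℝ≥0∞) (Xr Xt : Finset 𝒳) : Prop where
  compl : ∀ a, a ∈ Xr ↔ a ∉ Xt
  npty : Xr.Nonempty
  rec_pos : ∀ a b, b ∈ Xr → 0 < matStar A a b
  trans_zero : ∀ a b, b ∈ Xt → a = b ∨ a ∈ Xr → matStar A a b = 0

/-- The real expected offspring matrix. -/
noncomputable def meanMatR (𝒬 : 𝒳 → List 𝒳 → ℝ) : Matrix 𝒳 𝒳 ℝ :=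
  Matrix.of fun a b => ∑' c : List 𝒳, 𝒬 b c * (mult a c : ℝ)

/-- Criticality: the Perron-Frobenius eigenvalue of the expected offspring matrix is
`1`; equivalently (for weakly irreducible matrices) there is a strictly positive right
eigenvector with eigenvalue `1`. -/
def CriticalKernel (𝒬 : 𝒳 → List 𝒳 → ℝ) : Prop :=
  ∃ u : 𝒳 → ℝ, (∀ a, 0 < u a) ∧ ∀ a, ∑ b, meanMatR 𝒬 a b * u b = u a

/-- The uniform bound on the number of transient offspring. -/
def BoundedTransient (𝒬 : 𝒳 → List 𝒳 → ℝ) (Xt : Finset 𝒳) : Prop :=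
  ∃ B : ℕ, ∀ b c, 𝒬 b c ≠ 0 → c.countP (fun a => decide (a ∈ Xt)) ≤ B

end Multitype
section KGeneration

variable {𝒳 : Type*} [Fintype 𝒳] [DecidableEq 𝒳]

/-- Irreducibility of the expected offspring matrix. -/
def IrredKernel (𝒬 : 𝒳 → List 𝒳 → ℝ) : Prop :=
  ∀ a b, 0 < matStar (meanMat 𝒬) a b

/-- All offspring sizes generated by `𝒬` are bounded by `N₀`. -/
def BoundedOffspring (𝒬 : 𝒳 → List 𝒳 → ℝ) (N₀ : ℕ) : Prop :=
  ∀ a c, 𝒬 a c ≠ 0 → c.length ≤ N₀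

/-- `𝒳(k)`: the (finite) set of typed rooted planar trees of height at most `k` with
all offspring numbers at most `N₀`. -/
def XK (𝒳 : Type*) (N₀ k : ℕ) := {t : PTree 𝒳 // t.height ≤ k ∧ t.maxDeg ≤ N₀}

/-- The `k`-generation empirical offspring measure `M_X^k(b) = |T|⁻¹ #{v : π_k(X^v) = b}`,
as a function on all trees. -/
noncomputable def empK (k : ℕ) (t : PTree 𝒳) : PTree 𝒳 → ℝ := fun b =>
  ((t.subtrees.filter (fun s => PTree.trunc k s = b)).length : ℝ) / t.size

/-- `m_k(a,b)`: the number of children `v` of the root of `b` with `b^v = a`. -/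
noncomputable def mchild (a b : PTree 𝒳) : ℕ := b.children.count a

open Classical in
/-- The pushforward of a measure (given by its mass function) under the truncation
`π_{·,l}` at height `l`. -/
noncomputable def pushTrunc (l : ℕ) (μ : PTree 𝒳 → ℝ) : PTree 𝒳 → ℝ := fun a =>
  ∑' b : PTree 𝒳, if PTree.trunc l b = a then μ b else 0

/-- Shift-invariance on `𝒳(k)`:
`μ∘π_{k,k-1}⁻¹(a) = ∑_b m_k(a,b) μ(b)` for all `a ∈ 𝒳(k-1)`. -/
def ShiftInvK (k : ℕ) (μ : PTree 𝒳 → ℝ) : Prop :=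
  ∀ a : PTree 𝒳, pushTrunc (k - 1) μ a = ∑' b : PTree 𝒳, (mchild a b : ℝ) * μ b

/-- `μ' ⊗₁ 𝒬` evaluated at `x ∈ 𝒳(k)`: sample a tree of height `≤ k-1` from `μ'` and
provide children for each vertex of generation `k-1` independently according to `𝒬`. -/
noncomputable def attachLast (𝒬 : 𝒳 → List 𝒳 → ℝ) (k : ℕ) (μ' : PTree 𝒳 → ℝ) :
    PTree 𝒳 → ℝ := fun x =>
  μ' (PTree.trunc (k - 1) x) *
    ((PTree.atDepth (k - 1) x).map (fun v => 𝒬 v.root v.childLabels)).prod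

open Classical in
/-- Extension by zero of a function on `𝒳(k)` to all trees. -/
noncomputable def extXK {N₀ k : ℕ} (μ : XK 𝒳 N₀ k → ℝ) : PTree 𝒳 → ℝ :=
  fun x => if h : x.height ≤ k ∧ x.maxDeg ≤ N₀ then μ ⟨x, h⟩ else 0

open Classical in
/-- The rate function `J_k(μ) = H(μ ‖ μ∘π_{k,k-1}⁻¹ ⊗₁ 𝒬)` for shift-invariant `μ`
on `𝒳(k)`, and `∞` otherwise. -/
noncomputable def rateK (𝒬 : 𝒳 → List 𝒳 → ℝ) (N₀ k : ℕ) (μ : XK 𝒳 N₀ k → ℝ) : ℝ≥0∞ :=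
  if ShiftInvK k (extXK μ) then
    relEnt μ (fun b : XK 𝒳 N₀ k => attachLast 𝒬 k (pushTrunc (k - 1) (extXK μ)) b.1)
  else ∞

/-- The space `ℳ(𝒳(k))` of probability measures on `𝒳(k)`. -/
def MK (𝒳 : Type*) (N₀ k : ℕ) := {μ : XK 𝒳 N₀ k → ℝ // (∀ b, 0 ≤ μ b) ∧ HasSum μ 1}

/-- The topology on `ℳ(𝒳(k))` generated by the bounded functionals. -/
noncomputable instance {N₀ k : ℕ} : TopologicalSpace (MK 𝒳 N₀ k) :=
  TopologicalSpace.induced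
    (fun μ : MK 𝒳 N₀ k => fun f : {f : XK 𝒳 N₀ k → ℝ // ∃ M : ℝ, ∀ b, |f b| ≤ M} =>
      ∑' b, μ.1 b * f.1 b) Pi.topologicalSpace

end KGeneration

namespace PTree

variable {𝒳 : Type*}

theorem induction {P : PTree 𝒳 → Prop} (h : ∀ a ts, (∀ s ∈ ts, P s) → P (node a ts)) :
    ∀ t, P t
  | node a ts => h a ts fun s _hs => induction h s
termination_by t => sizeOf t
decreasing_by
  have := List.sizeOf_lt_of_mem _hs
  simp only [PTree.node.sizeOf_spec]
  omega

@[simp] theorem root_node (a : 𝒳) (ts) : (node a ts).root = a := rfl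
@[simp] theorem children_node (a : 𝒳) (ts) : (node a ts).children = ts := rfl
@[simp] theorem childLabels_node (a : 𝒳) (ts) : (node a ts).childLabels = ts.map root := rfl

theorem node_root_children (t : PTree 𝒳) : node t.root t.children = t := by cases t; rfl

theorem subtrees_node (a : 𝒳) (ts) :
    (node a ts).subtrees = node a ts :: (ts.map subtrees).flatten := by
  rw [subtrees, List.attach_map_val]

theorem self_mem_subtrees (t : PTree 𝒳) : t ∈ t.subtrees := by
  cases t; rw [subtrees_node]; exact List.mem_cons_self

theorem mem_subtrees_node {a : 𝒳} {ts} {s : PTree 𝒳} :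
    s ∈ (node a ts).subtrees ↔ s = node a ts ∨ ∃ t ∈ ts, s ∈ t.subtrees := by
  rw [subtrees_node]; simp

theorem size_node (a : 𝒳) (ts) : (node a ts).size = 1 + (ts.map size).sum := by
  rw [size, subtrees_node, List.length_cons, List.length_flatten, List.map_map, add_comm]; rfl

theorem size_pos (t : PTree 𝒳) : 0 < t.size := by
  cases t; rw [size_node]; omega

@[simp] theorem atDepth_zero (t : PTree 𝒳) : atDepth 0 t = [t] := by cases t; rfl

@[simp] theorem atDepth_succ (i : ℕ) (a : 𝒳) (ts) :
    atDepth (i + 1) (node a ts) = (ts.map (atDepth i)).flatten := by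
  rw [atDepth, List.attach_map_val]

@[simp] theorem trunc_zero (a : 𝒳) (ts) : trunc 0 (node a ts) = node a [] := rfl

@[simp] theorem trunc_succ (i : ℕ) (a : 𝒳) (ts) :
    trunc (i + 1) (node a ts) = node a (ts.map (trunc i)) := by
  rw [trunc, List.attach_map_val]

@[simp] theorem root_trunc (i : ℕ) (t : PTree 𝒳) : (trunc i t).root = t.root := by
  cases t; cases i <;> simp

theorem children_trunc_succ (i : ℕ) (t : PTree 𝒳) :
    (trunc (i + 1) t).children = t.children.map (trunc i) := by
  cases t; simp

theorem childLabels_trunc_succ (i : ℕ) (t : PTree 𝒳) :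
    (trunc (i + 1) t).childLabels = t.childLabels := by
  cases t; simp

theorem trunc_trunc {i k : ℕ} (h : i ≤ k) (t : PTree 𝒳) : trunc i (trunc k t) = trunc i t := by
  induction i generalizing k t with
  | zero => cases t; cases k <;> simp
  | succ i ih =>
    obtain ⟨k, rfl⟩ : ∃ m, k = m + 1 := ⟨k - 1, by omega⟩
    cases t
    simp only [trunc_succ, List.map_map, node.injEq, true_and]
    exact List.map_congr_left fun s _ => ih (by omega) s

theorem trunc_idem (k : ℕ) (t : PTree 𝒳) : trunc k (trunc k t) = trunc k t :=
  trunc_trunc le_rfl t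

theorem map_eq_self_iff {α : Type*} {f : α → α} {l : List α} :
    l.map f = l ↔ ∀ x ∈ l, f x = x := by
  conv_lhs => rhs; rw [← List.map_id l]
  rw [List.map_inj_left]; rfl

theorem trunc_succ_node_eq_self {i : ℕ} {a : 𝒳} {ts : List (PTree 𝒳)} :
    trunc (i + 1) (node a ts) = node a ts ↔ ∀ s ∈ ts, trunc i s = s := by
  simp [map_eq_self_iff]

theorem foldr_max_le {α : Type*} (f : α → ℕ) (l : List α) (n : ℕ) :
    (l.map f).foldr max 0 ≤ n ↔ ∀ x ∈ l, f x ≤ n := by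
  induction l with
  | nil => simp
  | cons x l ih => simp [ih]

theorem height_node_le_succ {i : ℕ} {a : 𝒳} {ts : List (PTree 𝒳)} :
    (node a ts).height ≤ i + 1 ↔ ∀ s ∈ ts, s.height ≤ i := by
  cases ts with
  | nil => simp [height]
  | cons t ts => rw [height, List.attach_map_val, Nat.add_le_add_iff_right, foldr_max_le]

theorem height_le_iff {i : ℕ} {t : PTree 𝒳} : t.height ≤ i ↔ trunc i t = t := by
  induction i generalizing t with
  | zero =>
    cases t with | node a ts =>
    cases ts <;> simp [height]
  | succ i ih =>
    cases t with | node a ts =>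
    rw [height_node_le_succ, trunc_succ_node_eq_self]
    exact forall₂_congr fun _ _ => ih

theorem maxDeg_node_le {n : ℕ} {a : 𝒳} {ts : List (PTree 𝒳)} :
    (node a ts).maxDeg ≤ n ↔ ts.length ≤ n ∧ ∀ s ∈ ts, s.maxDeg ≤ n := by
  rw [maxDeg, List.attach_map_val, max_le_iff, foldr_max_le]

theorem maxDeg_le_of_subtrees {n : ℕ} {t : PTree 𝒳}
    (h : ∀ s ∈ t.subtrees, s.children.length ≤ n) : t.maxDeg ≤ n := by
  induction t using induction with | h a ts ih =>
  rw [maxDeg_node_le]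
  exact ⟨h _ (self_mem_subtrees _),
    fun s hs => ih s hs fun w hw => h w (mem_subtrees_node.2 (Or.inr ⟨s, hs, hw⟩))⟩

theorem maxDeg_trunc_le {n : ℕ} (i : ℕ) {t : PTree 𝒳} (h : t.maxDeg ≤ n) :
    (trunc i t).maxDeg ≤ n := by
  induction i generalizing t with
  | zero => cases t; simp [maxDeg]
  | succ i ih =>
    cases t with | node a ts =>
    rw [trunc_succ, maxDeg_node_le]
    rw [maxDeg_node_le] at h
    refine ⟨by simpa using h.1, fun s hs => ?_⟩
    obtain ⟨s', hs', rfl⟩ := List.mem_map.1 hs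
    exact ih (h.2 s' hs')

theorem maxDeg_le_of_atDepth {n : ℕ} {i : ℕ} {t : PTree 𝒳} (ht : trunc (i + 1) t = t)
    (h : (trunc i t).maxDeg ≤ n) (hd : ∀ w ∈ atDepth i t, w.children.length ≤ n) :
    t.maxDeg ≤ n := by
  induction i generalizing t with
  | zero =>
    cases t with | node a ts =>
    rw [trunc_succ_node_eq_self] at ht
    rw [maxDeg_node_le]
    refine ⟨by simpa using hd, fun s hs => ?_⟩
    rw [← ht s hs]; cases s; simp [maxDeg]
  | succ i ih =>
    cases t with | node a ts =>
    rw [trunc_succ_node_eq_self] at ht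
    rw [trunc_succ, maxDeg_node_le] at h
    rw [maxDeg_node_le]
    refine ⟨by simpa using h.1, fun s hs => ih (ht s hs) (h.2 _ (List.mem_map_of_mem hs)) ?_⟩
    intro w hw
    refine hd w ?_
    simp only [atDepth_succ, List.mem_flatten, List.mem_map]
    exact ⟨_, ⟨s, hs, rfl⟩, hw⟩

/-- The product of `F` over the vertices of generation `i`. -/
noncomputable def levelProd {M : Type*} [CommMonoid M] (F : PTree 𝒳 → M) (i : ℕ)
    (t : PTree 𝒳) : M := ((atDepth i t).map F).prod

section levelProd

variable {M : Type*} [CommMonoid M] (F : PTree 𝒳 → M)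

@[simp] theorem levelProd_zero (t : PTree 𝒳) : levelProd F 0 t = F t := by simp [levelProd]

@[simp] theorem levelProd_succ (i : ℕ) (a : 𝒳) (ts) :
    levelProd F (i + 1) (node a ts) = (ts.map (levelProd F i)).prod := by
  simp [levelProd, List.map_flatten, List.prod_flatten, List.map_map, Function.comp_def]
  rfl

theorem levelProd_trunc {i k : ℕ} (h : i < k) (hF : ∀ m t, F (trunc (m + 1) t) = F t)
    (t : PTree 𝒳) : levelProd F i (trunc k t) = levelProd F i t := by
  induction i generalizing k t with
  | zero =>
    obtain ⟨k, rfl⟩ : ∃ m, k = m + 1 := ⟨k - 1, by omega⟩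
    simp [hF]
  | succ i ih =>
    obtain ⟨k, rfl⟩ : ∃ m, k = m + 1 := ⟨k - 1, by omega⟩
    cases t with | node a ts =>
    simp only [trunc_succ, levelProd_succ, List.map_map]
    congr 1
    exact List.map_congr_left fun s _ => ih (by omega) s

@[to_additive]
theorem prod_subtrees_children (t : PTree 𝒳) :
    (t.subtrees.map F).prod = F t * (t.subtrees.map fun s => (s.children.map F).prod).prod := by
  induction t using induction with | h x ts ih =>
  rw [subtrees_node]
  simp only [List.map_cons, List.prod_cons, children_node, List.map_flatten, List.prod_flatten,
    List.map_map]
  congr 1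
  rw [← List.prod_map_mul]
  exact congrArg _ (List.map_congr_left fun s hs => ih s hs)

end levelProd

theorem atDepth_trunc_eq_nil {i k : ℕ} (h : i ≤ k) {t : PTree 𝒳} :
    atDepth i (trunc k t) = [] ↔ atDepth i t = [] := by
  induction i generalizing k t with
  | zero => simp
  | succ i ih =>
    obtain ⟨k, rfl⟩ : ∃ m, k = m + 1 := ⟨k - 1, by omega⟩
    cases t with | node a ts =>
    simp only [trunc_succ, atDepth_succ, List.map_map, List.flatten_eq_nil_iff, List.mem_map,
      Function.comp_apply, forall_exists_index, and_imp, forall_apply_eq_imp_iff₂]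
    exact forall₂_congr fun _ _ => ih (by omega)

theorem trunc_eq_self_of_atDepth {i : ℕ} {t : PTree 𝒳} (h : atDepth i t = []) :
    trunc i t = t := by
  induction i generalizing t with
  | zero => simp at h
  | succ i ih =>
    cases t with | node a ts =>
    simp only [atDepth_succ, List.flatten_eq_nil_iff, List.mem_map,
      forall_exists_index, and_imp, forall_apply_eq_imp_iff₂] at h
    rw [trunc_succ_node_eq_self]
    exact fun s hs => ih (h s hs)

theorem finite_bounded [Finite 𝒳] (N k : ℕ) :
    {t : PTree 𝒳 | t.height ≤ k ∧ t.maxDeg ≤ N}.Finite := by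
  induction k with
  | zero =>
    refine (Set.finite_range (fun a : 𝒳 => node a [])).subset ?_
    rintro t ⟨ht, -⟩
    rw [height_le_iff] at ht
    cases t with | node a ts => exact ⟨a, by simpa using ht⟩
  | succ k ih =>
    have := ih.to_subtype
    have hl := List.finite_length_le {t : PTree 𝒳 | t.height ≤ k ∧ t.maxDeg ≤ N} N
    refine ((Set.toFinite (Set.univ : Set 𝒳)).image2
      (fun a (l : List {t : PTree 𝒳 | t.height ≤ k ∧ t.maxDeg ≤ N}) =>
        node a (l.map Subtype.val)) hl).subset ?_
    rintro ⟨a, ts⟩ ⟨h1, h2⟩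
    rw [height_node_le_succ] at h1
    rw [maxDeg_node_le] at h2
    refine ⟨a, trivial, ts.pmap Subtype.mk fun s hs => ⟨h1 s hs, h2.2 s hs⟩,
      by simpa using h2.1, ?_⟩
    simp [List.map_pmap]

/-- The set `𝒳(k)` as a finite set of trees. -/
noncomputable def bounded (𝒳 : Type*) [Finite 𝒳] (N k : ℕ) : Finset (PTree 𝒳) :=
  (finite_bounded N k).toFinset

theorem mem_bounded [Finite 𝒳] {N k : ℕ} {t : PTree 𝒳} :
    t ∈ bounded 𝒳 N k ↔ trunc k t = t ∧ t.maxDeg ≤ N := by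
  simp [bounded, height_le_iff]

theorem trunc_mem_bounded [Finite 𝒳] {N : ℕ} (k : ℕ) {t : PTree 𝒳} (h : t.maxDeg ≤ N) :
    trunc k t ∈ bounded 𝒳 N k :=
  mem_bounded.2 ⟨trunc_idem k t, maxDeg_trunc_le k h⟩

theorem child_mem_bounded [Finite 𝒳] {N k : ℕ} {t s : PTree 𝒳}
    (ht : t ∈ bounded 𝒳 N (k + 1)) (hs : s ∈ t.children) : s ∈ bounded 𝒳 N k := by
  cases t with | node a ts =>
  rw [mem_bounded, trunc_succ_node_eq_self, maxDeg_node_le] at ht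
  exact mem_bounded.2 ⟨ht.1 s hs, ht.2.2 s hs⟩

end PTree

theorem list_prod_le_one {l : List ℝ≥0∞} (h : ∀ x ∈ l, x ≤ 1) : l.prod ≤ 1 := by
  induction l with
  | nil => simp
  | cons a l ih =>
    rw [List.prod_cons]
    exact mul_le_one' (h a List.mem_cons_self) (ih fun x hx => h x (List.mem_cons_of_mem a hx))

section FiberSum

variable {α β γ : Type*}

/-- The decomposition of a list into the empty list and the nonempty ones. -/
def listEquivSum (α : Type*) : Unit ⊕ (α × List α) ≃ List α where
  toFun := Sum.elim (fun _ => []) fun p => p.1 :: p.2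
  invFun
    | [] => Sum.inl ()
    | a :: l => Sum.inr (a, l)
  left_inv := by rintro (_ | ⟨a, l⟩) <;> rfl
  right_inv := by rintro (_ | ⟨a, l⟩) <;> rfl

theorem ENNReal.tsum_list (F : List α → ℝ≥0∞) :
    ∑' l, F l = F [] + ∑' a, ∑' l, F (a :: l) := by
  rw [← (listEquivSum α).tsum_eq F, Summable.tsum_sum ENNReal.summable ENNReal.summable,
    ENNReal.tsum_prod']
  simp [listEquivSum]

/-- The total mass of `g` on the fibre of `f` over `y`. -/
noncomputable def fiberSum [DecidableEq β] (f : α → β) (g : α → ℝ≥0∞) (y : β) : ℝ≥0∞ :=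
  ∑' t, if f t = y then g t else 0

variable [DecidableEq β] [DecidableEq γ]

theorem fiberSum_mono {f : α → β} {g g' : α → ℝ≥0∞} {y : β} (h : ∀ t, f t = y → g t ≤ g' t) :
    fiberSum f g y ≤ fiberSum f g' y :=
  ENNReal.tsum_le_tsum fun t => by split_ifs with ht <;> simp [h t, ht]

theorem fiberSum_congr {f : α → β} {g g' : α → ℝ≥0∞} {y : β} (h : ∀ t, f t = y → g t = g' t) :
    fiberSum f g y = fiberSum f g' y :=
  tsum_congr fun t => by split_ifs with ht <;> simp [h t, ht]

theorem le_fiberSum (f : α → β) (g : α → ℝ≥0∞) (t : α) : g t ≤ fiberSum f g (f t) := by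
  refine le_trans ?_ (ENNReal.le_tsum t)
  simp

theorem tsum_fiberSum_mul (f : α → β) (g : α → ℝ≥0∞) (h : β → ℝ≥0∞) :
    ∑' y, fiberSum f g y * h y = ∑' t, g t * h (f t) := by
  simp_rw [fiberSum, ← ENNReal.tsum_mul_right]
  rw [ENNReal.tsum_comm]
  refine tsum_congr fun t => ?_
  rw [tsum_eq_single (f t) fun y hy => by simp [hy.symm]]
  simp

theorem tsum_fiberSum (f : α → β) (g : α → ℝ≥0∞) : ∑' y, fiberSum f g y = ∑' t, g t := by
  simpa using tsum_fiberSum_mul f g 1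

theorem fiberSum_fiberSum {f : α → β} {h : β → γ} {f' : α → γ} (hf : ∀ t, h (f t) = f' t)
    (g : α → ℝ≥0∞) (y : γ) : fiberSum h (fiberSum f g) y = fiberSum f' g y := by
  have := tsum_fiberSum_mul f g fun b => if h b = y then 1 else 0
  simpa [fiberSum, hf] using this

theorem fiberSum_map_list (f : α → β) (g : α → ℝ≥0∞) (l : List β) :
    fiberSum (List.map f) (fun ts => (ts.map g).prod) l = (l.map (fiberSum f g)).prod := by
  induction l with
  | nil =>
    rw [fiberSum, tsum_eq_single [] fun l hl => by simp [hl]]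
    simp
  | cons b l ih =>
    rw [List.map_cons, List.prod_cons, ← ih, fiberSum, ENNReal.tsum_list, fiberSum,
      ← ENNReal.tsum_mul_right]
    simp only [List.map_nil, List.nil_eq, reduceCtorEq, if_false, zero_add, List.map_cons,
      List.cons.injEq, List.prod_cons]
    refine tsum_congr fun a => ?_
    rw [fiberSum, ← ENNReal.tsum_mul_left]
    refine tsum_congr fun ts => ?_
    by_cases h1 : f a = b <;> by_cases h2 : ts.map f = l <;> simp [h1, h2]

theorem fiberSum_map_list_count [DecidableEq α] {f : α → β} {g : α → ℝ≥0∞}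
    (h1 : ∀ y, fiberSum f g y = 1) (a : α) (l : List β) :
    fiberSum (List.map f) (fun ts => (ts.count a : ℝ≥0∞) * (ts.map g).prod) l =
      (l.count (f a) : ℝ≥0∞) * g a := by
  induction l with
  | nil =>
    rw [fiberSum, tsum_eq_single [] fun l hl => by simp [hl]]
    simp
  | cons b l ih =>
    have hprod : fiberSum (List.map f) (fun ts => (ts.map g).prod) l = 1 := by
      rw [fiberSum_map_list, (funext h1 : fiberSum f g = fun _ => 1)]; simp
    rw [fiberSum, ENNReal.tsum_list]
    simp only [List.map_nil, List.nil_eq, reduceCtorEq, if_false, zero_add, List.map_cons,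
      List.cons.injEq, List.prod_cons]
    have key : ∀ t, (∑' ts : List α, if f t = b ∧ ts.map f = l then
        ((t :: ts).count a : ℝ≥0∞) * (g t * (ts.map g).prod) else 0) =
        (if f t = b then g t else 0) * ((l.count (f a) : ℝ≥0∞) * g a) +
        if t = a then (if f t = b then g t else 0) else 0 := by
      intro t
      have : (∑' ts : List α, if f t = b ∧ ts.map f = l then
          ((t :: ts).count a : ℝ≥0∞) * (g t * (ts.map g).prod) else 0) =
          (if f t = b then g t else 0) *
            (fiberSum (List.map f) (fun ts => (ts.count a : ℝ≥0∞) * (ts.map g).prod) l +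
            (if t = a then 1 else 0) * fiberSum (List.map f) (fun ts => (ts.map g).prod) l) := by
        rw [fiberSum, fiberSum, ← ENNReal.tsum_mul_left, ← ENNReal.tsum_add,
          ← ENNReal.tsum_mul_left]
        refine tsum_congr fun ts => ?_
        by_cases h1 : f t = b <;> by_cases h2 : ts.map f = l <;> by_cases h3 : t = a <;>
          simp [h1, h2, h3] <;> (try split_ifs) <;> ring
      rw [this, ih, hprod]
      split_ifs <;> ring
    simp_rw [key]
    rw [ENNReal.tsum_add, ENNReal.tsum_mul_right, tsum_ite_eq]
    have := h1 b
    rw [fiberSum] at this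
    rw [this, List.count_cons]
    by_cases h : f a = b
    · simp [h]; ring
    · simp [h, Ne.symm h]

end FiberSum

namespace PTree

variable {𝒳 : Type*}

/-- A tree is its root type together with the list of its principal subtrees. -/
def nodeEquiv (𝒳 : Type*) : 𝒳 × List (PTree 𝒳) ≃ PTree 𝒳 where
  toFun p := node p.1 p.2
  invFun t := (t.root, t.children)
  left_inv _ := rfl
  right_inv := node_root_children

theorem tsum_node (F : PTree 𝒳 → ℝ≥0∞) : ∑' t, F t = ∑' a, ∑' ts, F (node a ts) := by
  rw [← (nodeEquiv 𝒳).tsum_eq F, ENNReal.tsum_prod']; rfl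

theorem fiberSum_trunc_succ (j : ℕ) (q : PTree 𝒳 → ℝ≥0∞) (g : PTree 𝒳 → ℝ≥0∞) (b : PTree 𝒳) :
    fiberSum (trunc (j + 1)) (fun t => q (trunc (j + 1) t) * (t.children.map g).prod) b =
      q b * (b.children.map (fiberSum (trunc j) g)).prod := by
  cases b with | node x l =>
  rw [children_node, ← fiberSum_map_list, fiberSum, tsum_node, fiberSum,
    ← ENNReal.tsum_mul_left, tsum_eq_single x]
  · refine tsum_congr fun ts => ?_
    by_cases h : ts.map (trunc j) = l <;> simp [h]
  · intro y hy; simp [hy]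

/-- The product of `q (π_{j+1}(X^v))` over all vertices `v`. -/
noncomputable def treeWeight (j : ℕ) (q : PTree 𝒳 → ℝ≥0∞) (t : PTree 𝒳) : ℝ≥0∞ :=
  (t.subtrees.map fun s => q (trunc (j + 1) s)).prod

theorem treeWeight_eq (j : ℕ) (q : PTree 𝒳 → ℝ≥0∞) (t : PTree 𝒳) :
    treeWeight j q t = q (trunc (j + 1) t) * (t.children.map (treeWeight j q)).prod := by
  cases t with | node a ts =>
  rw [treeWeight, subtrees_node, List.map_cons, List.prod_cons, List.map_flatten,
    List.prod_flatten, List.map_map, List.map_map]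
  rfl

/-- The total weight of the trees `t` with `π_j(t) = a`. -/
noncomputable def typeMass (j : ℕ) (q : PTree 𝒳 → ℝ≥0∞) (a : PTree 𝒳) : ℝ≥0∞ :=
  fiberSum (trunc j) (treeWeight j q) a

theorem fiberSum_trunc_mul_prod (j : ℕ) (q g : PTree 𝒳 → ℝ≥0∞) (a : PTree 𝒳) :
    fiberSum (trunc j) (fun t => q (trunc (j + 1) t) * (t.children.map g).prod) a =
      fiberSum (trunc j) (fun b => q b * (b.children.map (fiberSum (trunc j) g)).prod) a := by
  rw [← fiberSum_fiberSum (f := trunc (j + 1)) (h := trunc j)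
    fun t => trunc_trunc (Nat.le_succ j) t]
  exact fiberSum_congr fun b _ => fiberSum_trunc_succ j q g b

theorem typeMass_eq (j : ℕ) (q : PTree 𝒳 → ℝ≥0∞) (a : PTree 𝒳) :
    typeMass j q a =
      fiberSum (trunc j) (fun b => q b * (b.children.map (typeMass j q)).prod) a := by
  rw [typeMass, fiberSum_congr fun t _ => treeWeight_eq j q t, fiberSum_trunc_mul_prod]
  rfl

theorem typeMass_le_one {j : ℕ} {q : PTree 𝒳 → ℝ≥0∞} (hq : ∀ a, fiberSum (trunc j) q a ≤ 1)
    (a : PTree 𝒳) : typeMass j q a ≤ 1 := by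
  have key : ∀ n a, fiberSum (trunc j) (fun t => if t.size ≤ n then treeWeight j q t else 0) a
      ≤ 1 := by
    intro n
    induction n with
    | zero => intro a; simp [fiberSum, (size_pos _).ne']
    | succ n ih =>
      intro a
      calc _ ≤ fiberSum (trunc j) (fun t => q (trunc (j + 1) t) * (t.children.map
              fun t => if t.size ≤ n then treeWeight j q t else 0).prod) a := by
            refine fiberSum_mono fun t _ => ?_
            split_ifs with h
            · rw [treeWeight_eq]
              refine le_of_eq ?_
              congr 2
              refine List.map_congr_left fun s hs => (if_pos ?_).symm
              cases t with | node x ts =>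
              rw [size_node] at h
              have := List.single_le_sum (l := ts.map size) (fun _ _ => Nat.zero_le _) _
                (List.mem_map_of_mem hs)
              omega
            · exact zero_le
        _ = _ := fiberSum_trunc_mul_prod j q _ a
        _ ≤ fiberSum (trunc j) q a := fiberSum_mono fun b _ => by
            refine mul_le_of_le_one_right' ?_
            refine list_prod_le_one ?_
            intro x hx
            obtain ⟨c, -, rfl⟩ := List.mem_map.1 hx
            exact ih c
        _ ≤ 1 := hq a
  rw [typeMass, fiberSum, ENNReal.tsum_eq_iSup_sum]
  refine iSup_le fun s => ?_
  refine le_trans ?_ (key (s.sup size) a)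
  refine le_trans (Finset.sum_le_sum fun t ht => ?_) (ENNReal.sum_le_tsum s)
  simp [Finset.le_sup (f := size) ht]

/-- The total weight of the trees `t` with `π_j(t) = a` and `n` vertices. -/
noncomputable def sizedMass (j : ℕ) (q : PTree 𝒳 → ℝ≥0∞) (a : PTree 𝒳) (n : ℕ) : ℝ≥0∞ :=
  fiberSum (fun t => (trunc j t, t.size)) (treeWeight j q) (a, n)

theorem le_sizedMass (j : ℕ) (q : PTree 𝒳 → ℝ≥0∞) (t : PTree 𝒳) :
    treeWeight j q t ≤ sizedMass j q (trunc j t) t.size :=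
  le_fiberSum (fun t => (trunc j t, t.size)) (treeWeight j q) t

theorem sizedMass_step (j : ℕ) (q : PTree 𝒳 → ℝ≥0∞) (x : 𝒳) (L : List (PTree 𝒳 × ℕ)) :
    q (node x (L.map Prod.fst)) * (L.map fun p => sizedMass j q p.1 p.2).prod ≤
      sizedMass j q (trunc j (node x (L.map Prod.fst))) (1 + (L.map Prod.snd).sum) := by
  have h1 : (L.map fun p => sizedMass j q p.1 p.2).prod =
      (L.map (fiberSum (fun t => (trunc j t, t.size)) (treeWeight j q))).prod := rfl
  have hinj : Function.Injective (node x) := fun a b h => by injection h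
  rw [h1, ← fiberSum_map_list, fiberSum, ← ENNReal.tsum_mul_left]
  refine le_trans (ENNReal.tsum_le_tsum fun ts => ?_)
    (ENNReal.tsum_comp_le_tsum_of_injective hinj _)
  split_ifs with h2 h3 h3
  · subst h2
    rw [treeWeight_eq]
    simp [Function.comp_def]
  · refine absurd ?_ h3
    subst h2
    simp only [size_node, ← trunc_trunc (Nat.le_succ j) (node x ts)]
    simp [Function.comp_def]
  · simp
  · simp

end PTree

theorem eq_of_sum_mul_eq {ι : Type*} [Fintype ι] {u f g : ι → ℝ≥0∞} (hu : ∀ i, u i ≠ 0)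
    (hu' : ∀ i, u i ≠ ∞) (hg : ∀ i, g i ≠ ∞) (hfg : ∀ i, f i ≤ g i)
    (h : ∑ i, g i * u i ≤ ∑ i, f i * u i) (i : ι) : f i = g i := by
  classical
  by_contra hne
  have hlt : f i * u i < g i * u i :=
    ENNReal.mul_lt_mul_left (hu i) (hu' i) (lt_of_le_of_ne (hfg i) hne)
  refine absurd h (not_le.2 ?_)
  rw [← Finset.add_sum_erase _ _ (Finset.mem_univ i),
    ← Finset.add_sum_erase _ _ (Finset.mem_univ i)]
  refine ENNReal.add_lt_add_of_lt_of_le ?_ hlt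
    (Finset.sum_le_sum fun b _ => mul_le_mul_left (hfg b) _)
  exact ENNReal.sum_ne_top.2 fun b _ =>
    ENNReal.mul_ne_top (ne_top_of_le_ne_top (hg b) (hfg b)) (hu' b)

theorem tsum_ofReal_kernel {𝒳 : Type*} {𝒬 : 𝒳 → List 𝒳 → ℝ} (h0 : ∀ a c, 0 ≤ 𝒬 a c)
    (h1 : ∀ a, HasSum (𝒬 a) 1) (a : 𝒳) : ∑' c, ENNReal.ofReal (𝒬 a c) = 1 := by
  rw [← ENNReal.ofReal_tsum_of_nonneg (h0 a) (h1 a).summable, (h1 a).tsum_eq, ENNReal.ofReal_one]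

theorem tsum_kernel_mul_le {𝒳 : Type*} {𝒬 : 𝒳 → List 𝒳 → ℝ} {N₀ : ℕ} (h0 : ∀ a c, 0 ≤ 𝒬 a c)
    (h1 : ∀ a, HasSum (𝒬 a) 1) (hb : BoundedOffspring 𝒬 N₀) (a : 𝒳) {f : List 𝒳 → ℕ}
    (hf : ∀ c, f c ≤ c.length) :
    ∑' c, ENNReal.ofReal (𝒬 a c) * (f c : ℝ≥0∞) ≤ N₀ := by
  calc _ ≤ ∑' c, ENNReal.ofReal (𝒬 a c) * N₀ := by
        refine ENNReal.tsum_le_tsum fun c => ?_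
        by_cases h : 𝒬 a c = 0
        · simp [h]
        · gcongr
          exact (hf c).trans (hb a c h)
    _ = N₀ := by rw [ENNReal.tsum_mul_right, tsum_ofReal_kernel h0 h1, one_mul]

section Kernel

variable {𝒳 : Type*} [Fintype 𝒳] [DecidableEq 𝒳]

/-- `y` occurs among the possible children of `x`. -/
def PossibleChild (𝒬 : 𝒳 → List 𝒳 → ℝ) (x y : 𝒳) : Prop := ∃ c, 0 < 𝒬 x c ∧ y ∈ c

/-- A critical irreducible kernel with bounded offspring which admits finite trees. -/
structure RegularKernel (𝒬 : 𝒳 → List 𝒳 → ℝ) (N₀ : ℕ) (u : 𝒳 → ℝ≥0∞) : Prop where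
  nonneg : ∀ a c, 0 ≤ 𝒬 a c
  hasSum : ∀ a, HasSum (𝒬 a) 1
  bounded : BoundedOffspring 𝒬 N₀
  connected : ∀ x y, Relation.TransGen (PossibleChild 𝒬) x y
  u_ne_zero : ∀ a, u a ≠ 0
  sum_u : ∑ a, u a = 1
  eigen : ∀ a, ∑ b, meanMat 𝒬 a b * u b = u a
  leaf : ∃ z, 0 < 𝒬 z []

theorem transGen_of_pow {𝒬 : 𝒳 → List 𝒳 → ℝ} (k : ℕ) (a b : 𝒳)
    (h : (meanMat 𝒬 ^ (k + 1)) a b ≠ 0) : Relation.TransGen (PossibleChild 𝒬) b a := by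
  have one : ∀ a b, meanMat 𝒬 a b ≠ 0 → PossibleChild 𝒬 b a := by
    intro a b h
    simp only [meanMat, Matrix.of_apply, ne_eq, ENNReal.tsum_eq_zero, not_forall, mul_eq_zero,
      ENNReal.ofReal_eq_zero, Nat.cast_eq_zero, not_or, not_le, mult] at h
    obtain ⟨c, hc, hm⟩ := h
    exact ⟨c, hc, List.count_pos_iff.1 (Nat.pos_of_ne_zero hm)⟩
  induction k generalizing b with
  | zero => exact .single (one a b (by simpa using h))
  | succ k ih =>
    rw [pow_succ, Matrix.mul_apply] at h
    obtain ⟨c, -, hc⟩ := Finset.exists_ne_zero_of_sum_ne_zero h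
    exact .head (one c b (right_ne_zero_of_mul hc)) (ih c (left_ne_zero_of_mul hc))

theorem exists_eigenvector [Nonempty 𝒳] {𝒬 : 𝒳 → List 𝒳 → ℝ} {N₀ : ℕ}
    (h0 : ∀ a c, 0 ≤ 𝒬 a c) (h1 : ∀ a, HasSum (𝒬 a) 1) (hb : BoundedOffspring 𝒬 N₀)
    (hcrit : CriticalKernel 𝒬) :
    ∃ u : 𝒳 → ℝ≥0∞, (∀ a, u a ≠ 0) ∧ ∑ a, u a = 1 ∧ ∀ a, ∑ b, meanMat 𝒬 a b * u b = u a := by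
  obtain ⟨u, hu, he⟩ := hcrit
  have hS : 0 < ∑ a, u a := Finset.sum_pos (fun a _ => hu a) Finset.univ_nonempty
  have hA : ∀ a b, meanMat 𝒬 a b = ENNReal.ofReal (meanMatR 𝒬 a b) := by
    intro a b
    have hne : meanMat 𝒬 a b ≠ ∞ := ne_top_of_le_ne_top (ENNReal.natCast_ne_top N₀)
      (tsum_kernel_mul_le h0 h1 hb b fun c => List.count_le_length)
    rw [← ENNReal.ofReal_toReal hne]
    congr 1
    simp only [meanMat, meanMatR, Matrix.of_apply]
    rw [ENNReal.tsum_toReal_eq]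
    · simp [ENNReal.toReal_ofReal (h0 b _)]
    · intro c; exact ENNReal.mul_ne_top ENNReal.ofReal_ne_top (ENNReal.natCast_ne_top _)
  have hAR : ∀ a b, 0 ≤ meanMatR 𝒬 a b := fun a b =>
    tsum_nonneg fun c => mul_nonneg (h0 b c) (Nat.cast_nonneg _)
  refine ⟨fun a => ENNReal.ofReal (u a / ∑ b, u b), fun a => ?_, ?_, fun a => ?_⟩
  · simpa using div_pos (hu a) hS
  · rw [← ENNReal.ofReal_sum_of_nonneg fun a _ => (div_pos (hu a) hS).le, ← Finset.sum_div,
      div_self hS.ne', ENNReal.ofReal_one]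
  · simp_rw [hA, ← ENNReal.ofReal_mul (hAR a _)]
    rw [← ENNReal.ofReal_sum_of_nonneg fun b _ => mul_nonneg (hAR a b) (div_pos (hu b) hS).le]
    congr 1
    rw [← he a, Finset.sum_div]
    exact Finset.sum_congr rfl fun b _ => by ring

variable {𝒬 : 𝒳 → List 𝒳 → ℝ} {N₀ : ℕ} {u : 𝒳 → ℝ≥0∞}

namespace RegularKernel

theorem u_ne_top (h : RegularKernel 𝒬 N₀ u) (a : 𝒳) : u a ≠ ∞ := by
  refine ne_top_of_le_ne_top ENNReal.one_ne_top ?_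
  rw [← h.sum_u]
  exact Finset.single_le_sum (fun _ _ => zero_le) (Finset.mem_univ a)

theorem eigen_pairing (h : RegularKernel 𝒬 N₀ u) (f : 𝒳 → ℝ≥0∞) :
    ∑ b, (∑' c, ENNReal.ofReal (𝒬 b c) * ∑ a, (c.count a : ℝ≥0∞) * f a) * u b =
      ∑ a, f a * u a := by
  calc _ = ∑ b, ∑ a, f a * (meanMat 𝒬 a b * u b) := by
        refine Finset.sum_congr rfl fun b _ => ?_
        simp_rw [Finset.mul_sum]
        rw [Summable.tsum_finsetSum fun _ _ => ENNReal.summable, Finset.sum_mul]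
        refine Finset.sum_congr rfl fun a _ => ?_
        simp only [meanMat, Matrix.of_apply, mult]
        rw [← mul_assoc, ← ENNReal.tsum_mul_left]
        congr 1
        exact tsum_congr fun c => by ring
    _ = _ := by
        rw [Finset.sum_comm]
        simp_rw [← Finset.mul_sum, h.eigen]

theorem sum_count (c : List 𝒳) : ∑ a, (c.count a : ℝ≥0∞) = c.length := by
  rw [← Nat.cast_sum]
  congr 1
  have := Multiset.sum_count_eq_card (s := Finset.univ) (m := (c : Multiset 𝒳)) fun a _ =>
    Finset.mem_univ a
  simpa using this

theorem mean_ne_top (h : RegularKernel 𝒬 N₀ u) (b : 𝒳) {f : 𝒳 → ℝ≥0∞} (hf : ∀ a, f a ≤ 1) :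
    ∑' c, ENNReal.ofReal (𝒬 b c) * ∑ a, (c.count a : ℝ≥0∞) * f a ≠ ∞ := by
  refine ne_top_of_le_ne_top (ENNReal.natCast_ne_top N₀) (le_trans ?_
    (tsum_kernel_mul_le h.nonneg h.hasSum h.bounded b (f := List.length) fun c => le_rfl))
  refine ENNReal.tsum_le_tsum fun c => ?_
  rw [← sum_count]
  gcongr with a
  exact mul_le_of_le_one_right' (hf a)

theorem exists_branching (h : RegularKernel 𝒬 N₀ u) : ∃ x c, 0 < 𝒬 x c ∧ 2 ≤ c.length := by
  by_contra! hlen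
  obtain ⟨z, hz⟩ := h.leaf
  have hle : ∀ b, ∑' c, ENNReal.ofReal (𝒬 b c) * ∑ a, (c.count a : ℝ≥0∞) * 1 ≤ 1 := by
    intro b
    simp only [mul_one, sum_count]
    rw [← tsum_ofReal_kernel h.nonneg h.hasSum b]
    refine ENNReal.tsum_le_tsum fun c => ?_
    rcases (h.nonneg b c).eq_or_lt with h0 | h0
    · simp [← h0]
    · refine mul_le_of_le_one_right' ?_
      exact_mod_cast Nat.le_of_lt_succ (hlen b c h0)
  have heq := eq_of_sum_mul_eq h.u_ne_zero h.u_ne_top (fun _ => ENNReal.one_ne_top) hle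
    (by rw [h.eigen_pairing fun _ => 1]) z
  have hsum := tsum_ofReal_kernel h.nonneg h.hasSum z
  rw [ENNReal.tsum_list] at hsum heq
  have hR : (1 : ℝ≥0∞) ≤ ∑' a, ∑' l, ENNReal.ofReal (𝒬 z (a :: l)) := by
    rw [← heq]
    simp only [mul_one, sum_count, List.length_nil, Nat.cast_zero, mul_zero, zero_add]
    refine ENNReal.tsum_le_tsum fun a => ENNReal.tsum_le_tsum fun l => ?_
    rcases (h.nonneg z (a :: l)).eq_or_lt with h0 | h0
    · simp [← h0]
    · refine mul_le_of_le_one_right' ?_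
      exact_mod_cast Nat.le_of_lt_succ (hlen z _ h0)
  have hpos : (0 : ℝ≥0∞) < ENNReal.ofReal (𝒬 z []) := ENNReal.ofReal_pos.2 hz
  have : (1 : ℝ≥0∞) < 1 := calc
    (1 : ℝ≥0∞) = 0 + 1 := by simp
    _ < _ := ENNReal.add_lt_add_of_lt_of_le ENNReal.one_ne_top hpos hR
    _ = 1 := hsum
  exact lt_irrefl _ this

end RegularKernel

end Kernel

section Admissible

open PTree

variable {𝒳 : Type*} {𝒬 : 𝒳 → List 𝒳 → ℝ} {N₀ : ℕ}

/-- The probability of the offspring of the root of `t`. -/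
def offspringProb (𝒬 : 𝒳 → List 𝒳 → ℝ) (t : PTree 𝒳) : ℝ := 𝒬 t.root t.childLabels

@[simp] theorem offspringProb_node (x : 𝒳) (ts) :
    offspringProb 𝒬 (node x ts) = 𝒬 x (ts.map root) := rfl

@[simp] theorem offspringProb_trunc_succ (m : ℕ) (t : PTree 𝒳) :
    offspringProb 𝒬 (trunc (m + 1) t) = offspringProb 𝒬 t := by
  rw [offspringProb, childLabels_trunc_succ, root_trunc]; rfl

/-- All offspring in `t` have positive probability. -/
def Admissible (𝒬 : 𝒳 → List 𝒳 → ℝ) (t : PTree 𝒳) : Prop :=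
  ∀ s ∈ t.subtrees, 0 < offspringProb 𝒬 s

/-- All offspring of vertices of depth less than `k` have positive probability. -/
def AdmissibleUpTo (𝒬 : 𝒳 → List 𝒳 → ℝ) (k : ℕ) (t : PTree 𝒳) : Prop :=
  ∀ i < k, 0 < levelProd (offspringProb 𝒬) i t

theorem admissible_node {x : 𝒳} {ts : List (PTree 𝒳)} :
    Admissible 𝒬 (node x ts) ↔ 0 < 𝒬 x (ts.map root) ∧ ∀ s ∈ ts, Admissible 𝒬 s := by
  refine ⟨fun h => ⟨h _ (self_mem_subtrees _), fun s hs w hw =>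
    h w (mem_subtrees_node.2 (Or.inr ⟨s, hs, hw⟩))⟩, fun h w hw => ?_⟩
  rcases mem_subtrees_node.1 hw with rfl | ⟨s, hs, hw⟩
  · exact h.1
  · exact h.2 s hs w hw

theorem Admissible.levelProd_pos {t : PTree 𝒳} (h : Admissible 𝒬 t) (i : ℕ) :
    0 < levelProd (offspringProb 𝒬) i t := by
  induction i generalizing t with
  | zero => simpa using h t (self_mem_subtrees t)
  | succ i ih =>
    cases t with | node x ts =>
    rw [levelProd_succ]
    refine List.prod_pos fun y hy => ?_
    obtain ⟨s, hs, rfl⟩ := List.mem_map.1 hy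
    exact ih ((admissible_node.1 h).2 s hs)

theorem Admissible.upTo {t : PTree 𝒳} (h : Admissible 𝒬 t) (k : ℕ) : AdmissibleUpTo 𝒬 k t :=
  fun i _ => h.levelProd_pos i

theorem admissibleUpTo_trunc {i k : ℕ} (hik : i ≤ k) {t : PTree 𝒳} :
    AdmissibleUpTo 𝒬 i (trunc k t) ↔ AdmissibleUpTo 𝒬 i t :=
  forall₂_congr fun m hm => by
    rw [levelProd_trunc _ (hm.trans_le hik) fun m t => offspringProb_trunc_succ m t]

theorem Admissible.maxDeg_le (hb : BoundedOffspring 𝒬 N₀) {t : PTree 𝒳}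
    (h : Admissible 𝒬 t) : t.maxDeg ≤ N₀ :=
  maxDeg_le_of_subtrees fun s hs => by
    simpa [childLabels] using hb _ _ (h s hs).ne'

theorem Admissible.of_mem_subtrees {t s : PTree 𝒳} (h : Admissible 𝒬 t)
    (hs : s ∈ t.subtrees) : Admissible 𝒬 s := by
  induction t using induction with | h a ts ih =>
  rcases mem_subtrees_node.1 hs with rfl | ⟨t, ht, hs⟩
  · exact h
  · exact ih t ht ((admissible_node.1 h).2 t ht) hs

theorem list_prod_pos_iff {l : List ℝ} (h : ∀ x ∈ l, 0 ≤ x) : 0 < l.prod ↔ ∀ x ∈ l, 0 < x := by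
  refine ⟨fun hp x hx => lt_of_le_of_ne (h x hx) fun h0 => ?_, List.prod_pos⟩
  exact hp.ne' (List.prod_eq_zero (h0 ▸ hx))

theorem levelProd_nonneg (h0 : ∀ a c, 0 ≤ 𝒬 a c) (i : ℕ) (t : PTree 𝒳) :
    0 ≤ levelProd (offspringProb 𝒬) i t :=
  List.prod_nonneg fun y hy => by
    obtain ⟨s, -, rfl⟩ := List.mem_map.1 hy
    exact h0 _ _

theorem admissibleUpTo_succ_node (h0 : ∀ a c, 0 ≤ 𝒬 a c) {k : ℕ} {x : 𝒳}
    {ts : List (PTree 𝒳)} : AdmissibleUpTo 𝒬 (k + 1) (node x ts) ↔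
      0 < 𝒬 x (ts.map root) ∧ ∀ s ∈ ts, AdmissibleUpTo 𝒬 k s := by
  have key : ∀ i, 0 < levelProd (offspringProb 𝒬) (i + 1) (node x ts) ↔
      ∀ s ∈ ts, 0 < levelProd (offspringProb 𝒬) i s := by
    intro i
    rw [levelProd_succ, list_prod_pos_iff]
    · simp
    · simpa using fun s _ => levelProd_nonneg h0 i s
  constructor
  · intro h
    exact ⟨by simpa using h 0 (Nat.succ_pos k),
      fun s hs i hi => (key i).1 (h (i + 1) (by omega)) s hs⟩
  · rintro ⟨h1, h2⟩ (_ | i) hi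
    · simpa using h1
    · exact (key i).2 fun s hs => h2 s hs i (by omega)

end Admissible

section Kernel

open PTree

variable {𝒳 : Type*} [Fintype 𝒳] [DecidableEq 𝒳] {𝒬 : 𝒳 → List 𝒳 → ℝ} {N₀ : ℕ} {u : 𝒳 → ℝ≥0∞}

namespace RegularKernel

/-- Every type is the root type of some finite admissible tree. -/
theorem exists_admissible (h : RegularKernel 𝒬 N₀ u) (x : 𝒳) :
    ∃ t, Admissible 𝒬 t ∧ t.root = x := by
  classical
  let D : 𝒳 → Prop := fun x => ∃ t, Admissible 𝒬 t ∧ t.root = x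
  have closed : ∀ x c, 0 < 𝒬 x c → (∀ y ∈ c, D y) → D x := by
    intro x c hc hy
    have : Nonempty (PTree 𝒳) := ⟨node x []⟩
    choose! F hF using hy
    refine ⟨node x (c.map F), ?_, rfl⟩
    rw [admissible_node]
    have : (c.map F).map root = c := by
      rw [List.map_map]
      exact map_eq_self_iff.2 fun y hy => (hF y hy).2
    rw [this]
    exact ⟨hc, fun s hs => by
      obtain ⟨y, hy, rfl⟩ := List.mem_map.1 hs
      exact (hF y hy).1⟩
  let f : 𝒳 → ℝ≥0∞ := fun a => if D a then 0 else 1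
  have hf1 : ∀ a, f a ≤ 1 := fun a => by simp only [f]; split_ifs <;> simp
  have hle : ∀ b, f b ≤ ∑' c, ENNReal.ofReal (𝒬 b c) * ∑ a, (c.count a : ℝ≥0∞) * f a := by
    intro b
    by_cases hb : D b
    · simp [f, hb]
    · refine (hf1 b).trans ?_
      rw [← tsum_ofReal_kernel h.nonneg h.hasSum b]
      refine ENNReal.tsum_le_tsum fun c => ?_
      rcases (h.nonneg b c).eq_or_lt with h0 | h0
      · simp [← h0]
      · refine le_mul_of_one_le_right' ?_
        have : ∃ y ∈ c, ¬ D y := by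
          by_contra! hcon
          exact hb (closed b c h0 hcon)
        obtain ⟨y, hy, hDy⟩ := this
        refine le_trans ?_ (Finset.single_le_sum (fun _ _ => zero_le) (Finset.mem_univ y))
        simp only [f, hDy, if_false, mul_one]
        exact_mod_cast List.count_pos_iff.2 hy
  have heq := eq_of_sum_mul_eq h.u_ne_zero h.u_ne_top (fun b => h.mean_ne_top b hf1) hle
    (h.eigen_pairing f).le
  have step : ∀ x y, D x → PossibleChild 𝒬 x y → D y := by
    rintro x y hx ⟨c, hc, hy⟩
    have := heq x
    simp only [f, hx, if_true] at this
    have := (ENNReal.tsum_eq_zero.1 this.symm) c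
    rw [mul_eq_zero, ENNReal.ofReal_eq_zero, or_iff_right (not_le.2 hc)] at this
    have := (Finset.sum_eq_zero_iff.1 this) y (Finset.mem_univ y)
    by_contra hD
    simp [hD, List.count_eq_zero, hy] at this
  obtain ⟨z, hz⟩ := h.leaf
  have hDz : D z := closed z [] hz (by simp)
  have := h.connected z x
  induction this with
  | single hs => exact step _ _ hDz hs
  | tail _ hs ih => exact step _ _ ih hs

theorem exists_admissible_node (h : RegularKernel 𝒬 N₀ u) {x y : 𝒳}
    (hxy : PossibleChild 𝒬 x y) {s : PTree 𝒳} (hs : Admissible 𝒬 s) (hr : s.root = y) :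
    ∃ ts, s ∈ ts ∧ Admissible 𝒬 (node x ts) := by
  choose d hd hdr using h.exists_admissible
  obtain ⟨c, hc, hy⟩ := hxy
  obtain ⟨c₁, c₂, rfl⟩ := List.append_of_mem hy
  refine ⟨c₁.map d ++ s :: c₂.map d, by simp, admissible_node.2 ⟨?_, ?_⟩⟩
  · have hcomp : root ∘ d = id := funext hdr
    simpa [hcomp, hr] using hc
  · simp only [List.mem_append, List.mem_map, List.mem_cons]
    rintro w (⟨z, -, rfl⟩ | rfl | ⟨z, -, rfl⟩)
    exacts [hd z, hs, hd z]

/-- Every admissible tree is a subtree of an admissible tree with prescribed root type. -/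
theorem exists_admissible_root (h : RegularKernel 𝒬 N₀ u) (x : 𝒳) {s : PTree 𝒳}
    (hs : Admissible 𝒬 s) : ∃ t, Admissible 𝒬 t ∧ t.root = x ∧ s ∈ t.subtrees := by
  have := h.connected x s.root
  induction this using Relation.TransGen.head_induction_on with
  | single hx =>
    obtain ⟨ts, h1, h2⟩ := h.exists_admissible_node hx hs rfl
    exact ⟨_, h2, rfl, mem_subtrees_node.2 (Or.inr ⟨s, h1, self_mem_subtrees s⟩)⟩
  | head hx _ ih =>
    obtain ⟨t, ht, hr, hst⟩ := ih
    obtain ⟨ts, h1, h2⟩ := h.exists_admissible_node hx ht hr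
    exact ⟨_, h2, rfl, mem_subtrees_node.2 (Or.inr ⟨t, h1, hst⟩)⟩

/-- Every admissible tree is a subtree of an admissible tree with prescribed truncation, provided
the truncation reaches its maximal height. -/
theorem exists_admissible_trunc (h : RegularKernel 𝒬 N₀ u) {j : ℕ} {t₀ s : PTree 𝒳}
    (ht₀ : Admissible 𝒬 t₀) (hd : atDepth j t₀ ≠ []) (hs : Admissible 𝒬 s) :
    ∃ t, Admissible 𝒬 t ∧ trunc j t = trunc j t₀ ∧ s ∈ t.subtrees := by
  induction j generalizing t₀ with
  | zero =>
    obtain ⟨t, ht, hr, hst⟩ := h.exists_admissible_root t₀.root hs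
    refine ⟨t, ht, ?_, hst⟩
    cases t; cases t₀
    simpa using hr
  | succ j ih =>
    cases t₀ with | node x ts =>
    simp only [atDepth_succ, ne_eq, List.flatten_eq_nil_iff, List.mem_map,
      forall_exists_index, and_imp, forall_apply_eq_imp_iff₂, not_forall] at hd
    obtain ⟨w, hw, hdw⟩ := hd
    rw [admissible_node] at ht₀
    obtain ⟨t, ht, htr, hst⟩ := ih (ht₀.2 w hw) hdw
    obtain ⟨l₁, l₂, rfl⟩ := List.append_of_mem hw
    have hroot : t.root = w.root := by rw [← root_trunc j t, htr, root_trunc]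
    refine ⟨node x (l₁ ++ t :: l₂), admissible_node.2 ⟨?_, ?_⟩, by simp [htr],
      mem_subtrees_node.2 (Or.inr ⟨t, by simp, hst⟩)⟩
    · simpa [hroot] using ht₀.1
    · intro v hv
      simp only [List.mem_append, List.mem_cons] at hv
      rcases hv with hv | rfl | hv
      exacts [ht₀.2 v (by simp [hv]), ht, ht₀.2 v (by simp [hv])]

theorem exists_admissible_of_upTo (h : RegularKernel 𝒬 N₀ u) {k : ℕ} {b : PTree 𝒳}
    (hb : AdmissibleUpTo 𝒬 k b) : ∃ t, Admissible 𝒬 t ∧ trunc k t = trunc k b := by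
  induction k generalizing b with
  | zero =>
    obtain ⟨t, ht, hr⟩ := h.exists_admissible b.root
    refine ⟨t, ht, ?_⟩
    cases t; cases b
    simpa using hr
  | succ k ih =>
    cases b with | node x ts =>
    rw [admissibleUpTo_succ_node h.nonneg] at hb
    have : Nonempty (PTree 𝒳) := ⟨node x []⟩
    choose! F hF using fun s (hs : AdmissibleUpTo 𝒬 k s) => ih hs
    have hroot : (ts.map F).map root = ts.map root := by
      rw [List.map_map]
      refine List.map_congr_left fun s hs => ?_
      rw [Function.comp_apply, ← root_trunc k (F s), (hF s (hb.2 s hs)).2, root_trunc]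
    refine ⟨node x (ts.map F), admissible_node.2 ⟨hroot ▸ hb.1, ?_⟩, ?_⟩
    · intro s hs
      obtain ⟨v, hv, rfl⟩ := List.mem_map.1 hs
      exact (hF v (hb.2 v hv)).1
    · simp only [trunc_succ, List.map_map, node.injEq, true_and]
      exact List.map_congr_left fun s hs => (hF s (hb.2 s hs)).2

end RegularKernel

end Kernel

namespace PTree

section Shift

variable {𝒳 : Type*} [Finite 𝒳] {N j : ℕ} {μ : PTree 𝒳 → ℝ}

/-- The pushforward under `π_j` of a function on trees of height at most `j + 1`. -/
noncomputable def push (N j : ℕ) (μ : PTree 𝒳 → ℝ) (a : PTree 𝒳) : ℝ :=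
  ∑ b ∈ bounded 𝒳 N (j + 1), if trunc j b = a then μ b else 0

theorem sum_push_mul (μ g : PTree 𝒳 → ℝ) :
    ∑ a ∈ bounded 𝒳 N j, push N j μ a * g a =
      ∑ b ∈ bounded 𝒳 N (j + 1), μ b * g (trunc j b) := by
  simp_rw [push, Finset.sum_mul]
  rw [Finset.sum_comm]
  refine Finset.sum_congr rfl fun b hb => ?_
  rw [Finset.sum_eq_single_of_mem (trunc j b) (trunc_mem_bounded j (mem_bounded.1 hb).2)
    fun a _ ha => by simp [ha.symm]]
  simp

theorem sum_push (μ : PTree 𝒳 → ℝ) :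
    ∑ a ∈ bounded 𝒳 N j, push N j μ a = ∑ b ∈ bounded 𝒳 N (j + 1), μ b := by
  simpa using sum_push_mul (N := N) (j := j) μ 1

theorem sum_children_map {b : PTree 𝒳} (hb : b ∈ bounded 𝒳 N (j + 1)) (g : PTree 𝒳 → ℝ) :
    (b.children.map g).sum = ∑ a ∈ bounded 𝒳 N j, (b.children.count a : ℝ) * g a := by
  rw [Finset.sum_list_map_count]
  simp only [nsmul_eq_mul]
  refine Finset.sum_subset (fun a ha => child_mem_bounded hb (List.mem_toFinset.1 ha)) ?_
  intro a _ ha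
  rw [List.mem_toFinset] at ha
  simp [List.count_eq_zero.2 ha]

/-- A shift-invariant probability vector on the trees of height at most `j + 1`. -/
structure ShiftMeasure (N j : ℕ) (μ : PTree 𝒳 → ℝ) : Prop where
  nonneg : ∀ b, 0 ≤ μ b
  supp : ∀ b, b ∉ bounded 𝒳 N (j + 1) → μ b = 0
  total : ∑ b ∈ bounded 𝒳 N (j + 1), μ b = 1
  shift : ∀ a, push N j μ a = ∑ b ∈ bounded 𝒳 N (j + 1), (b.children.count a : ℝ) * μ b

theorem push_nonneg (h : ∀ b, 0 ≤ μ b) (a : PTree 𝒳) : 0 ≤ push N j μ a :=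
  Finset.sum_nonneg fun b _ => by split_ifs; exacts [h b, le_rfl]

theorem le_push (h : ∀ b, 0 ≤ μ b) {b : PTree 𝒳} (hb : b ∈ bounded 𝒳 N (j + 1)) :
    μ b ≤ push N j μ (trunc j b) := by
  refine le_trans ?_ (Finset.single_le_sum (fun b _ => ?_) hb)
  · simp
  · split_ifs; exacts [h b, le_rfl]

theorem exists_of_push_ne_zero {a : PTree 𝒳} (h : push N j μ a ≠ 0) :
    ∃ b ∈ bounded 𝒳 N (j + 1), trunc j b = a ∧ μ b ≠ 0 := by
  obtain ⟨b, hb, hne⟩ := Finset.exists_ne_zero_of_sum_ne_zero h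
  refine ⟨b, hb, ?_⟩
  by_cases hab : trunc j b = a
  · exact ⟨hab, by simpa [hab] using hne⟩
  · simp [hab] at hne

namespace ShiftMeasure

theorem mem (h : ShiftMeasure N j μ) {b : PTree 𝒳} (hb : μ b ≠ 0) :
    b ∈ bounded 𝒳 N (j + 1) := by
  by_contra hcon
  exact hb (h.supp b hcon)

theorem pairing (h : ShiftMeasure N j μ) (g : PTree 𝒳 → ℝ) :
    ∑ b ∈ bounded 𝒳 N (j + 1), μ b * (b.children.map g).sum =
      ∑ b ∈ bounded 𝒳 N (j + 1), μ b * g (trunc j b) := by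
  rw [← sum_push_mul, Finset.sum_congr rfl fun b hb => by rw [sum_children_map hb g]]
  simp_rw [h.shift, Finset.sum_mul, Finset.mul_sum]
  rw [Finset.sum_comm]
  exact Finset.sum_congr rfl fun a _ => Finset.sum_congr rfl fun b _ => by ring

theorem push_pos_of_child (h : ShiftMeasure N j μ) {b a : PTree 𝒳} (hb : μ b ≠ 0)
    (ha : a ∈ b.children) : 0 < push N j μ a := by
  rw [h.shift]
  refine lt_of_lt_of_le ?_ (Finset.single_le_sum (fun b _ =>
    mul_nonneg (Nat.cast_nonneg _) (h.nonneg b)) (h.mem hb))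
  exact mul_pos (by exact_mod_cast List.count_pos_iff.2 ha) (lt_of_le_of_ne (h.nonneg b) hb.symm)

theorem exists_of_child (h : ShiftMeasure N j μ) {b a : PTree 𝒳} (hb : μ b ≠ 0)
    (ha : a ∈ b.children) : ∃ b', trunc j b' = a ∧ μ b' ≠ 0 :=
  let ⟨b', _, h1, h2⟩ := exists_of_push_ne_zero (h.push_pos_of_child hb ha).ne'
  ⟨b', h1, h2⟩

theorem push_pos (h : ShiftMeasure N j μ) {b : PTree 𝒳} (hb : μ b ≠ 0) :
    0 < push N j μ (trunc j b) :=
  lt_of_lt_of_le (lt_of_le_of_ne (h.nonneg b) hb.symm) (le_push h.nonneg (h.mem hb))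

end ShiftMeasure

/-- The conditional probability of `b` given `π_j(b)`. -/
noncomputable def cond (N j : ℕ) (μ : PTree 𝒳 → ℝ) (b : PTree 𝒳) : ℝ :=
  μ b / push N j μ (trunc j b)

theorem cond_nonneg (h : ∀ b, 0 ≤ μ b) (b : PTree 𝒳) : 0 ≤ cond N j μ b :=
  div_nonneg (h b) (push_nonneg h _)

theorem ShiftMeasure.cond_mul_push (h : ShiftMeasure N j μ) (b : PTree 𝒳) :
    cond N j μ b * push N j μ (trunc j b) = μ b := by
  by_cases hb : μ b = 0
  · simp [cond, hb]
  · exact div_mul_cancel₀ _ (h.push_pos hb).ne'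

theorem ShiftMeasure.cond_ne_zero (h : ShiftMeasure N j μ) {b : PTree 𝒳} :
    cond N j μ b ≠ 0 ↔ μ b ≠ 0 := by
  rw [not_iff_not]
  refine ⟨fun h0 => ?_, fun h0 => by simp [cond, h0]⟩
  rw [← h.cond_mul_push, h0, zero_mul]

theorem fiberSum_trunc_ofReal {ν : PTree 𝒳 → ℝ} (h0 : ∀ b, 0 ≤ ν b)
    (h : ∀ b, b ∉ bounded 𝒳 N (j + 1) → ν b = 0) (a : PTree 𝒳) :
    fiberSum (trunc j) (fun b => ENNReal.ofReal (ν b)) a = ENNReal.ofReal (push N j ν a) := by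
  rw [fiberSum, push, ENNReal.ofReal_sum_of_nonneg
    fun b _ => by split_ifs; exacts [h0 b, le_rfl], tsum_eq_sum (s := bounded 𝒳 N (j + 1))]
  · exact Finset.sum_congr rfl fun b _ => by split_ifs <;> simp
  · intro b hb; simp [h b hb]

theorem push_cond_le_one (a : PTree 𝒳) : push N j (cond N j μ) a ≤ 1 := by
  have h : ∀ b, (if trunc j b = a then cond N j μ b else 0) =
      (if trunc j b = a then μ b else 0) / push N j μ a := by
    intro b
    by_cases h : trunc j b = a <;> simp [cond, h]
  rw [push, Finset.sum_congr rfl fun b _ => h b, ← Finset.sum_div]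
  exact div_self_le_one _

theorem fiberSum_cond_le_one (h0 : ∀ b, 0 ≤ μ b)
    (h : ∀ b, b ∉ bounded 𝒳 N (j + 1) → μ b = 0) (a : PTree 𝒳) :
    fiberSum (trunc j) (fun b => ENNReal.ofReal (cond N j μ b)) a ≤ 1 := by
  rw [fiberSum_trunc_ofReal (cond_nonneg h0) fun b hb => by simp [cond, h b hb]]
  exact ENNReal.ofReal_le_one.2 (push_cond_le_one a)

end Shift

section Jensen

variable {𝒳 : Type*} [Finite 𝒳] {N j : ℕ} {μ : PTree 𝒳 → ℝ}

theorem ENNReal.list_prod_eq_ofReal {α : Type*} (l : List α) (H : α → ℝ≥0∞)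
    (h : ∀ a ∈ l, H a ≠ ∞) :
    (l.map H).prod = ENNReal.ofReal (l.map fun a => (H a).toReal).prod := by
  induction l with
  | nil => simp
  | cons a l ih =>
    simp only [List.map_cons, List.prod_cons]
    rw [ENNReal.ofReal_mul ENNReal.toReal_nonneg,
      ENNReal.ofReal_toReal (h a List.mem_cons_self),
      ih fun b hb => h b (List.mem_cons_of_mem a hb)]

theorem log_list_prod {α : Type*} (l : List α) (f : α → ℝ) (h : ∀ a ∈ l, f a ≠ 0) :
    Real.log (l.map f).prod = (l.map fun a => Real.log (f a)).sum := by
  rw [Real.log_list_prod fun x hx => ?_, List.map_map]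
  · rfl
  · obtain ⟨a, ha, rfl⟩ := List.mem_map.1 hx
    exact h a ha

/-- A positive solution of the recursion for the generating functions of the conditional law of a
shift-invariant measure, at a point larger than one, is infinite somewhere. -/
theorem ShiftMeasure.exists_eq_top (h : ShiftMeasure N j μ) {s : ℝ≥0∞} (hs : 1 < s)
    (hs' : s ≠ ∞) {H : PTree 𝒳 → ℝ≥0∞}
    (hH : ∀ a, H a = fiberSum (trunc j)
      (fun b => s * ENNReal.ofReal (cond N j μ b) * (b.children.map H).prod) a)
    (h0 : ∀ b, μ b ≠ 0 → H (trunc j b) ≠ 0) :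
    ∃ b, μ b ≠ 0 ∧ H (trunc j b) = ∞ := by
  by_contra! htop
  set f : PTree 𝒳 → ℝ := fun a => (H a).toReal with hf
  have hs1 : 1 < s.toReal := by
    rw [← ENNReal.toReal_one]
    exact (ENNReal.toReal_lt_toReal ENNReal.one_ne_top hs').2 hs
  have hpos : ∀ b, μ b ≠ 0 → 0 < f (trunc j b) := fun b hb =>
    ENNReal.toReal_pos (h0 b hb) (htop b hb)
  have hchild : ∀ b, μ b ≠ 0 → ∀ a ∈ b.children, 0 < f a ∧ H a ≠ ∞ := by
    intro b hb a ha
    obtain ⟨b', rfl, hb'⟩ := h.exists_of_child hb ha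
    exact ⟨hpos b' hb', htop b' hb'⟩
  set X : PTree 𝒳 → ℝ := fun b => s.toReal * (b.children.map f).prod with hX
  have hXnn : ∀ b, 0 ≤ X b := fun b => mul_nonneg ENNReal.toReal_nonneg <|
    List.prod_nonneg fun y hy => by
      obtain ⟨a, -, rfl⟩ := List.mem_map.1 hy
      exact ENNReal.toReal_nonneg
  have hfa : ∀ a, f a = push N j (fun b => cond N j μ b * X b) a := by
    intro a
    have hnn : ∀ b, 0 ≤ cond N j μ b * X b := fun b => mul_nonneg (cond_nonneg h.nonneg b) (hXnn b)
    rw [← ENNReal.toReal_ofReal (push_nonneg hnn a), ← fiberSum_trunc_ofReal hnn fun b hb => by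
      simp [cond, h.supp b hb]]
    simp only [hf]
    rw [hH a]
    congr 1
    refine fiberSum_congr fun b _ => ?_
    by_cases hb : μ b = 0
    · simp [cond, hb]
    · rw [ENNReal.list_prod_eq_ofReal _ _ fun a ha => (hchild b hb a ha).2,
        ENNReal.ofReal_mul (cond_nonneg h.nonneg b), ENNReal.ofReal_mul ENNReal.toReal_nonneg,
        ENNReal.ofReal_toReal hs']
      ring
  have hone : ∑ b ∈ bounded 𝒳 N (j + 1), μ b * (X b / f (trunc j b)) = 1 := by
    calc _ = ∑ b ∈ bounded 𝒳 N (j + 1), cond N j μ b * X b *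
          (push N j μ (trunc j b) / f (trunc j b)) := by
          refine Finset.sum_congr rfl fun b _ => ?_
          rw [← h.cond_mul_push b]; ring
      _ = ∑ a ∈ bounded 𝒳 N j, f a * (push N j μ a / f a) := by
          refine (sum_push_mul (fun b => cond N j μ b * X b) fun a =>
            push N j μ a / f a).symm.trans ?_
          exact Finset.sum_congr rfl fun a _ => by rw [← hfa]
      _ = ∑ a ∈ bounded 𝒳 N j, push N j μ a := by
          refine Finset.sum_congr rfl fun a _ => ?_
          by_cases ha : push N j μ a = 0
          · simp [ha]
          · obtain ⟨b, -, rfl, hb⟩ := exists_of_push_ne_zero ha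
            exact mul_div_cancel₀ _ (hpos b hb).ne'
      _ = 1 := by rw [sum_push, h.total]
  have hlog : ∑ b ∈ bounded 𝒳 N (j + 1), μ b * Real.log (X b / f (trunc j b)) =
      Real.log s.toReal := by
    calc _ = ∑ b ∈ bounded 𝒳 N (j + 1), (μ b * Real.log s.toReal +
          μ b * (b.children.map fun a => Real.log (f a)).sum - μ b * Real.log (f (trunc j b))) := by
          refine Finset.sum_congr rfl fun b _ => ?_
          by_cases hb : μ b = 0
          · simp [hb]
          · have hprod : (b.children.map f).prod ≠ 0 := List.prod_ne_zero fun h0 => by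
              obtain ⟨a, ha, ha0⟩ := List.mem_map.1 h0
              exact (hchild b hb a ha).1.ne' ha0
            rw [Real.log_div (mul_ne_zero (by linarith) hprod) (hpos b hb).ne',
              Real.log_mul (by linarith) hprod, log_list_prod _ _ fun a ha =>
                (hchild b hb a ha).1.ne']
            ring
      _ = _ := by
          rw [Finset.sum_sub_distrib, Finset.sum_add_distrib, ← Finset.sum_mul, h.total,
            h.pairing fun a => Real.log (f a)]
          ring
  have hle : Real.log s.toReal ≤ 0 := by
    rw [← hlog, ← sub_self (1 : ℝ)]
    nth_rw 1 [← hone]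
    rw [← h.total, ← Finset.sum_sub_distrib]
    refine Finset.sum_le_sum fun b _ => ?_
    by_cases hb : μ b = 0
    · simp [hb]
    · have hXpos : 0 < X b := mul_pos (by linarith) (List.prod_pos fun y hy => by
        obtain ⟨a, ha, rfl⟩ := List.mem_map.1 hy
        exact (hchild b hb a ha).1)
      have := Real.log_le_sub_one_of_pos (div_pos hXpos (hpos b hb))
      calc _ ≤ μ b * (X b / f (trunc j b) - 1) := mul_le_mul_of_nonneg_left this (h.nonneg b)
        _ = _ := by ring
  exact absurd (Real.log_pos hs1) (not_lt.2 hle)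

end Jensen

end PTree

/-- A superadditivity-type estimate propagates along residue classes. -/
theorem exists_mul_pow_le {f : ℕ → ℝ≥0∞} {r : ℝ≥0∞} (hr : r ≤ 1) {L : ℕ} (hL : 0 < L)
    (h : ∀ n, r ^ L * f n ≤ f (n + L)) : ∃ κ ≠ 0, ∀ n, f n ≠ 0 → κ * r ^ n ≤ f n := by
  have key : ∀ i, ∃ κ ≠ (0 : ℝ≥0∞), ∀ m, f (i + m * L) ≠ 0 →
      κ * r ^ (i + m * L) ≤ f (i + m * L) := by
    intro i
    by_cases hex : ∃ m, f (i + m * L) ≠ 0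
    · classical
      refine ⟨f (i + Nat.find hex * L), Nat.find_spec hex, fun m hm => ?_⟩
      obtain ⟨d, rfl⟩ := Nat.exists_eq_add_of_le (Nat.find_min' hex hm)
      clear hm
      induction d with
      | zero => exact mul_le_of_le_one_right' (pow_le_one₀ zero_le hr)
      | succ d ih =>
        have hi : i + (Nat.find hex + (d + 1)) * L = i + (Nat.find hex + d) * L + L := by ring
        rw [hi]
        refine le_trans (le_of_eq ?_) ((mul_le_mul_right ih (r ^ L)).trans (h _))
        ring
    · push Not at hex
      exact ⟨1, one_ne_zero, fun m hm => absurd (hex m) hm⟩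
  choose κ hκ0 hκ using key
  have hne : (Finset.range L).Nonempty := ⟨0, by simpa using hL⟩
  refine ⟨(Finset.range L).inf' hne κ, ?_, fun n hn => ?_⟩
  · obtain ⟨i, -, hi⟩ := Finset.exists_mem_eq_inf' hne κ
    rw [hi]; exact hκ0 i
  · have hdecomp : n % L + n / L * L = n := by
      rw [mul_comm]; exact Nat.mod_add_div n L
    have := hκ (n % L) (n / L)
    rw [hdecomp] at this
    refine le_trans (mul_le_mul_left (Finset.inf'_le κ ?_) _) (this hn)
    simpa using Nat.mod_lt n hL

namespace PTree

section Growth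

variable {𝒳 : Type*} {𝒬 : 𝒳 → List 𝒳 → ℝ} {j : ℕ} {q : PTree 𝒳 → ℝ≥0∞}

theorem treeWeight_ne_zero (hq : ∀ t, Admissible 𝒬 t → q (trunc (j + 1) t) ≠ 0) {t : PTree 𝒳}
    (ht : Admissible 𝒬 t) : treeWeight j q t ≠ 0 :=
  List.prod_ne_zero fun h0 => by
    obtain ⟨s, hs, hs0⟩ := List.mem_map.1 h0
    exact hq s (ht.of_mem_subtrees hs) hs0

theorem sizedMass_ne_zero (hq : ∀ t, Admissible 𝒬 t → q (trunc (j + 1) t) ≠ 0) {t : PTree 𝒳}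
    (ht : Admissible 𝒬 t) : sizedMass j q (trunc j t) t.size ≠ 0 :=
  fun h0 => treeWeight_ne_zero hq ht (le_zero_iff.1 (h0 ▸ le_sizedMass j q t))

/-- Up to a bounded change of size, the masses of type `a` dominate those of type `a'`. -/
def Reach (j : ℕ) (q : PTree 𝒳 → ℝ≥0∞) (a a' : PTree 𝒳) : Prop :=
  ∃ w ≠ 0, ∃ c, ∀ n, w * sizedMass j q a' n ≤ sizedMass j q a (n + c)

theorem Reach.refl (a : PTree 𝒳) : Reach j q a a := ⟨1, one_ne_zero, 0, fun n => by simp⟩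

theorem Reach.trans {a b c : PTree 𝒳} (h₁ : Reach j q a b) (h₂ : Reach j q b c) :
    Reach j q a c := by
  obtain ⟨w, hw, d, h⟩ := h₁
  obtain ⟨w', hw', d', h'⟩ := h₂
  refine ⟨w * w', mul_ne_zero hw hw', d' + d, fun n => ?_⟩
  rw [mul_assoc, ← add_assoc]
  exact (mul_le_mul_right (h' n) w).trans (h _)

theorem prod_sizedMass_ne_zero (hq : ∀ t, Admissible 𝒬 t → q (trunc (j + 1) t) ≠ 0)
    {l : List (PTree 𝒳)} (hl : ∀ t ∈ l, Admissible 𝒬 t) :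
    (l.map fun t => sizedMass j q (trunc j t) t.size).prod ≠ 0 :=
  List.prod_ne_zero fun h0 => by
    obtain ⟨s, hs, hs0⟩ := List.mem_map.1 h0
    exact sizedMass_ne_zero hq (hl s hs) hs0

theorem reach_child (hq : ∀ t, Admissible 𝒬 t → q (trunc (j + 1) t) ≠ 0) {x : 𝒳}
    {l₁ l₂ : List (PTree 𝒳)} {s : PTree 𝒳} (h : Admissible 𝒬 (node x (l₁ ++ s :: l₂))) :
    Reach j q (trunc j (node x (l₁ ++ s :: l₂))) (trunc j s) := by
  have hc := (admissible_node.1 h).2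
  let e : PTree 𝒳 → PTree 𝒳 × ℕ := fun t => (trunc j t, t.size)
  refine ⟨q (trunc (j + 1) (node x (l₁ ++ s :: l₂))) *
    (l₁.map fun t => sizedMass j q (trunc j t) t.size).prod *
    (l₂.map fun t => sizedMass j q (trunc j t) t.size).prod,
    mul_ne_zero (mul_ne_zero (hq _ h) ?_) ?_, 1 + (l₁.map size).sum + (l₂.map size).sum,
    fun n => ?_⟩
  · exact prod_sizedMass_ne_zero hq fun t ht => hc t (by simp [ht])
  · exact prod_sizedMass_ne_zero hq fun t ht => hc t (by simp [ht])
  have := sizedMass_step j q x (l₁.map e ++ (trunc j s, n) :: l₂.map e)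
  have htr : node x ((l₁.map e ++ (trunc j s, n) :: l₂.map e).map Prod.fst) =
      trunc (j + 1) (node x (l₁ ++ s :: l₂)) := by
    simp [e, Function.comp_def]
  rw [htr, trunc_trunc (Nat.le_succ j)] at this
  refine le_trans (le_of_eq ?_) (this.trans (le_of_eq (congrArg _ ?_)))
  · simp only [List.map_append, List.map_cons, List.map_map, List.prod_append, List.prod_cons, e,
      Function.comp_def]
    ring
  · simp only [List.map_append, List.map_cons, List.map_map, List.sum_append, List.sum_cons, e,
      Function.comp_def]
    ring

theorem two_children (hq : ∀ t, Admissible 𝒬 t → q (trunc (j + 1) t) ≠ 0) {x : 𝒳}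
    {l : List (PTree 𝒳)} {s s' : PTree 𝒳} (h : Admissible 𝒬 (node x (s :: s' :: l))) :
    ∃ w ≠ 0, ∃ c, ∀ n n', w * (sizedMass j q (trunc j s) n * sizedMass j q (trunc j s') n') ≤
      sizedMass j q (trunc j (node x (s :: s' :: l))) (n + n' + c) := by
  have hc := (admissible_node.1 h).2
  let e : PTree 𝒳 → PTree 𝒳 × ℕ := fun t => (trunc j t, t.size)
  refine ⟨q (trunc (j + 1) (node x (s :: s' :: l))) *
    (l.map fun t => sizedMass j q (trunc j t) t.size).prod,
    mul_ne_zero (hq _ h) ?_, 1 + (l.map size).sum, fun n n' => ?_⟩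
  · exact prod_sizedMass_ne_zero hq fun t ht => hc t (by simp [ht])
  have := sizedMass_step j q x ((trunc j s, n) :: (trunc j s', n') :: l.map e)
  have htr : node x (((trunc j s, n) :: (trunc j s', n') :: l.map e).map Prod.fst) =
      trunc (j + 1) (node x (s :: s' :: l)) := by
    simp [e, Function.comp_def]
  rw [htr, trunc_trunc (Nat.le_succ j)] at this
  refine le_trans (le_of_eq ?_) (this.trans (le_of_eq (congrArg _ ?_)))
  · simp only [List.map_cons, List.map_map, List.prod_cons, e, Function.comp_def]
    ring
  · simp only [List.map_cons, List.map_map, List.sum_cons, e, Function.comp_def]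
    ring

theorem reach_of_mem_subtrees (hq : ∀ t, Admissible 𝒬 t → q (trunc (j + 1) t) ≠ 0)
    {t s : PTree 𝒳} (ht : Admissible 𝒬 t) (hs : s ∈ t.subtrees) :
    Reach j q (trunc j t) (trunc j s) := by
  induction t using induction with | h x ts ih =>
  rcases mem_subtrees_node.1 hs with rfl | ⟨t, hmem, hs⟩
  · exact Reach.refl _
  · have h1 := ih t hmem ((admissible_node.1 ht).2 t hmem) hs
    obtain ⟨l₁, l₂, rfl⟩ := List.append_of_mem hmem
    exact (reach_child hq ht).trans h1

theorem sizedMass_zero (a : PTree 𝒳) : sizedMass j q a 0 = 0 := by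
  simp [sizedMass, fiberSum, (size_pos _).ne']

theorem typeMass_mul (s : ℝ≥0∞) (a : PTree 𝒳) :
    typeMass j (fun b => s * q b) a = ∑' n, s ^ n * sizedMass j q a n := by
  have h1 : ∀ t, treeWeight j (fun b => s * q b) t = s ^ t.size * treeWeight j q t := by
    intro t
    rw [treeWeight, List.prod_map_mul, treeWeight, size]
    simp
  simp_rw [typeMass, fiberSum, sizedMass, fiberSum, ← ENNReal.tsum_mul_left]
  rw [ENNReal.tsum_comm]
  refine tsum_congr fun t => ?_
  rw [tsum_eq_single t.size fun n hn => by simp [hn.symm]]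
  by_cases h : trunc j t = a <;> simp [h, h1]

theorem Reach.eq_top {a a' : PTree 𝒳} (h : Reach j q a a') {s : ℝ≥0∞} (hs : s ≠ 0)
    (htop : typeMass j (fun b => s * q b) a' = ∞) : typeMass j (fun b => s * q b) a = ∞ := by
  obtain ⟨w, hw, c, h⟩ := h
  rw [typeMass_mul] at *
  rw [eq_top_iff]
  calc ∞ = s ^ c * w * ∑' n, s ^ n * sizedMass j q a' n := by
        rw [htop, ENNReal.mul_top (mul_ne_zero (pow_ne_zero _ hs) hw)]
    _ = ∑' n, s ^ c * w * (s ^ n * sizedMass j q a' n) := ENNReal.tsum_mul_left.symm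
    _ ≤ ∑' n, s ^ (n + c) * sizedMass j q a (n + c) := by
        refine ENNReal.tsum_le_tsum fun n => ?_
        refine le_trans (le_of_eq ?_) (mul_le_mul_right (h n) _)
        ring
    _ ≤ ∑' n, s ^ n * sizedMass j q a n :=
        ENNReal.tsum_comp_le_tsum_of_injective (add_left_injective c) _

theorem exists_pow_le {f : ℕ → ℝ≥0∞} (hf : ∀ s : ℝ≥0∞, 1 < s → s ≠ ∞ → ∑' n, s ^ n * f n = ∞)
    {w r : ℝ≥0∞} (hw : w ≠ 0) (hr : r < 1) (c : ℕ) : ∃ n, r ^ (n + c) ≤ w * f n := by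
  by_contra! hlt
  obtain ⟨s, hs1, hs2, hs3⟩ : ∃ s : ℝ≥0∞, 1 < s ∧ s ≠ ∞ ∧ s * r < 1 := by
    obtain ⟨r', h1, h2⟩ := exists_between hr
    have hr0 : r' ≠ 0 := (zero_le.trans_lt h1).ne'
    refine ⟨r'⁻¹, ENNReal.one_lt_inv.2 h2, ENNReal.inv_ne_top.2 hr0, ?_⟩
    rw [mul_comm, ← div_eq_mul_inv]
    exact (ENNReal.div_lt_iff (Or.inl hr0) (Or.inl (h2.trans ENNReal.one_lt_top).ne)).2
      (by rwa [one_mul])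
  have : (∞ : ℝ≥0∞) ≤ (1 - s * r)⁻¹ := by
    calc (∞ : ℝ≥0∞) = w * ∑' n, s ^ n * f n := by rw [hf s hs1 hs2, ENNReal.mul_top hw]
      _ = ∑' n, w * (s ^ n * f n) := ENNReal.tsum_mul_left.symm
      _ ≤ ∑' n, (s * r) ^ n := by
          refine ENNReal.tsum_le_tsum fun n => ?_
          calc w * (s ^ n * f n) = s ^ n * (w * f n) := by ring
            _ ≤ s ^ n * r ^ n := by
                refine mul_le_mul_right ((hlt n).le.trans ?_) _
                rw [pow_add]
                exact mul_le_of_le_one_right' (pow_le_one₀ zero_le hr.le)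
            _ = _ := (mul_pow _ _ _).symm
      _ = _ := ENNReal.tsum_geometric _
  rw [top_le_iff, ENNReal.inv_eq_top, tsub_eq_zero_iff_le] at this
  exact absurd hs3 (not_lt.2 this)

end Growth

section Deep

variable {𝒳 : Type*} [Fintype 𝒳] [DecidableEq 𝒳] {𝒬 : 𝒳 → List 𝒳 → ℝ} {N₀ j : ℕ}
  {u : 𝒳 → ℝ≥0∞} {q : PTree 𝒳 → ℝ≥0∞}

theorem reach_of_deep (h : RegularKernel 𝒬 N₀ u)
    (hq : ∀ t, Admissible 𝒬 t → q (trunc (j + 1) t) ≠ 0) {t₀ s : PTree 𝒳}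
    (ht₀ : Admissible 𝒬 t₀) (hd : atDepth j t₀ ≠ []) (hs : Admissible 𝒬 s) :
    Reach j q (trunc j t₀) (trunc j s) := by
  obtain ⟨t, ht, htr, hst⟩ := h.exists_admissible_trunc ht₀ hd hs
  rw [← htr]
  exact reach_of_mem_subtrees hq ht hst

theorem exists_two_holes (h : RegularKernel 𝒬 N₀ u)
    (hq : ∀ t, Admissible 𝒬 t → q (trunc (j + 1) t) ≠ 0) {t₀ : PTree 𝒳}
    (ht₀ : Admissible 𝒬 t₀) (hd : atDepth j t₀ ≠ []) :
    ∃ w ≠ 0, ∃ c, ∀ n n', w * (sizedMass j q (trunc j t₀) n * sizedMass j q (trunc j t₀) n') ≤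
      sizedMass j q (trunc j t₀) (n + n' + c) := by
  obtain ⟨x, c, hc, hlen⟩ := h.exists_branching
  obtain ⟨y, y', c, rfl⟩ : ∃ y y' c', c = y :: y' :: c' := by
    match c, hlen with
    | y :: y' :: c', _ => exact ⟨y, y', c', rfl⟩
  choose d hd₁ hd₂ using h.exists_admissible
  obtain ⟨t₁, ht₁, hr₁, hs₁⟩ := h.exists_admissible_root y ht₀
  obtain ⟨t₂, ht₂, hr₂, hs₂⟩ := h.exists_admissible_root y' ht₀
  have hcomp : root ∘ d = id := funext hd₂
  have hadm : Admissible 𝒬 (node x (t₁ :: t₂ :: c.map d)) := by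
    refine admissible_node.2 ⟨by simpa [hr₁, hr₂, hcomp] using hc, ?_⟩
    simp only [List.mem_cons, List.mem_map]
    rintro s (rfl | rfl | ⟨z, -, rfl⟩)
    exacts [ht₁, ht₂, hd₁ z]
  obtain ⟨w, hw, e, hwe⟩ := two_children hq hadm
  obtain ⟨w₀, hw₀, e₀, h₀⟩ := reach_of_deep h hq ht₀ hd hadm
  obtain ⟨w₁, hw₁, e₁, h₁⟩ := reach_of_mem_subtrees hq ht₁ hs₁
  obtain ⟨w₂, hw₂, e₂, h₂⟩ := reach_of_mem_subtrees hq ht₂ hs₂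
  refine ⟨w₀ * w * (w₁ * w₂), by simp [*], e₁ + e₂ + e + e₀, fun n n' => ?_⟩
  calc _ = w₀ * (w * ((w₁ * sizedMass j q (trunc j t₀) n) *
        (w₂ * sizedMass j q (trunc j t₀) n'))) := by ring
    _ ≤ w₀ * (w * (sizedMass j q (trunc j t₁) (n + e₁) *
        sizedMass j q (trunc j t₂) (n' + e₂))) := by gcongr <;> simp only [h₁, h₂]
    _ ≤ _ := by
        refine (mul_le_mul_right (hwe _ _) _).trans ((h₀ _).trans (le_of_eq (congrArg _ ?_)))
        ring

/-- The mass of a deep type decays subexponentially along its support. -/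
theorem exists_mul_pow_le_sizedMass (h : RegularKernel 𝒬 N₀ u) {μ : PTree 𝒳 → ℝ}
    (hμ : ShiftMeasure N₀ j μ)
    (hsupp : ∀ b, μ b ≠ 0 ↔ b ∈ bounded 𝒳 N₀ (j + 1) ∧ AdmissibleUpTo 𝒬 (j + 1) b)
    {t₀ : PTree 𝒳} (ht₀ : Admissible 𝒬 t₀) (hd : atDepth j t₀ ≠ []) {r : ℝ≥0∞} (hr0 : r ≠ 0)
    (hr : r < 1) :
    ∃ κ ≠ 0, ∀ n, sizedMass j (fun b => ENNReal.ofReal (cond N₀ j μ b)) (trunc j t₀) n ≠ 0 →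
      κ * r ^ n ≤ sizedMass j (fun b => ENNReal.ofReal (cond N₀ j μ b)) (trunc j t₀) n := by
  set q : PTree 𝒳 → ℝ≥0∞ := fun b => ENNReal.ofReal (cond N₀ j μ b) with hqdef
  have hq : ∀ t, Admissible 𝒬 t → q (trunc (j + 1) t) ≠ 0 := by
    intro t ht
    have : cond N₀ j μ (trunc (j + 1) t) ≠ 0 := hμ.cond_ne_zero.2 ((hsupp _).2
      ⟨trunc_mem_bounded _ (ht.maxDeg_le h.bounded), (admissibleUpTo_trunc le_rfl).2 (ht.upTo _)⟩)
    exact (ENNReal.ofReal_pos.2 (lt_of_le_of_ne (cond_nonneg hμ.nonneg _) this.symm)).ne'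
  have hadm : ∀ b, μ b ≠ 0 → ∃ s, Admissible 𝒬 s ∧ trunc j b = trunc j s := by
    intro b hb
    obtain ⟨s, hs, hsb⟩ := h.exists_admissible_of_upTo ((hsupp b).1 hb).2
    refine ⟨s, hs, ?_⟩
    rw [← trunc_trunc (Nat.le_succ j) b, ← hsb, trunc_trunc (Nat.le_succ j)]
  have htop : ∀ s : ℝ≥0∞, 1 < s → s ≠ ∞ →
      ∑' n, s ^ n * sizedMass j q (trunc j t₀) n = ∞ := by
    intro s hs hs'
    have hs0 : s ≠ 0 := (zero_le.trans_lt hs).ne'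
    rw [← typeMass_mul]
    obtain ⟨b, hb, hbt⟩ := hμ.exists_eq_top hs hs' (typeMass_eq j fun b => s * q b) fun b hb => by
      obtain ⟨t, ht, htb⟩ := hadm b hb
      rw [htb]
      have := treeWeight_ne_zero (q := fun b => s * q b)
        (fun t ht => mul_ne_zero hs0 (hq t ht)) ht
      exact (lt_of_lt_of_le (pos_iff_ne_zero.2 this) (le_fiberSum _ _ t)).ne'
    obtain ⟨t, ht, htb⟩ := hadm b hb
    exact (reach_of_deep h hq ht₀ hd ht).eq_top hs0 (htb ▸ hbt)
  obtain ⟨w, hw, c, hwc⟩ := exists_two_holes h hq ht₀ hd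
  obtain ⟨n₁, hn₁⟩ := exists_pow_le htop hw hr c
  have hn0 : n₁ ≠ 0 := by
    rintro rfl
    rw [sizedMass_zero, mul_zero] at hn₁
    exact pow_ne_zero _ hr0 (le_antisymm hn₁ zero_le)
  refine exists_mul_pow_le hr.le (L := n₁ + c) (by omega) fun n => ?_
  calc _ ≤ w * sizedMass j q (trunc j t₀) n₁ * sizedMass j q (trunc j t₀) n :=
        mul_le_mul_left hn₁ _
    _ = w * (sizedMass j q (trunc j t₀) n * sizedMass j q (trunc j t₀) n₁) := by ring
    _ ≤ _ := by rw [← add_assoc]; exact hwc n n₁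

end Deep

section Law

variable {𝒳 : Type*} {𝒬 : 𝒳 → List 𝒳 → ℝ}

/-- The law of the first `i` generations, given the root type. -/
noncomputable def law (𝒬 : 𝒳 → List 𝒳 → ℝ) : ℕ → PTree 𝒳 → ℝ≥0∞
  | 0, t => if trunc 0 t = t then 1 else 0
  | i + 1, t => ENNReal.ofReal (offspringProb 𝒬 t) * (t.children.map (law 𝒬 i)).prod

/-- The conditional law of the first `j + 1` generations, given the first `j`. -/
noncomputable def lastLaw (𝒬 : 𝒳 → List 𝒳 → ℝ) : ℕ → PTree 𝒳 → ℝ≥0∞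
  | 0, t => if trunc 1 t = t then ENNReal.ofReal (offspringProb 𝒬 t) else 0
  | j + 1, t => (t.children.map (lastLaw 𝒬 j)).prod

theorem prod_ite_trunc (i : ℕ) (x : 𝒳) (ts : List (PTree 𝒳)) :
    (ts.map fun s => if trunc i s = s then (1 : ℝ≥0∞) else 0).prod =
      if trunc (i + 1) (node x ts) = node x ts then 1 else 0 := by
  rw [if_congr trunc_succ_node_eq_self rfl rfl]
  induction ts with
  | nil => simp
  | cons s ts ih =>
    rw [List.map_cons, List.prod_cons, ih]
    by_cases h : trunc i s = s <;> simp [h]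

theorem law_succ (j : ℕ) (t : PTree 𝒳) : law 𝒬 (j + 1) t = lastLaw 𝒬 j t * law 𝒬 j (trunc j t) := by
  induction j generalizing t with
  | zero =>
    cases t with | node x ts =>
    rw [law, lastLaw, law, if_pos (trunc_idem 0 _), mul_one]
    have := prod_ite_trunc 0 x ts
    rw [children_node]
    simp only [law]
    rw [this]
    split_ifs <;> simp
  | succ j ih =>
    cases t with | node x ts =>
    rw [law, lastLaw, law, offspringProb_trunc_succ]
    simp only [children_node, trunc_succ, List.map_map]
    rw [List.map_congr_left fun s _ => ih s, List.prod_map_mul]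
    simp only [Function.comp_def]
    ring

theorem ofReal_list_prod {α : Type*} (l : List α) (f : α → ℝ) (h : ∀ a, 0 ≤ f a) :
    ENNReal.ofReal (l.map f).prod = (l.map fun a => ENNReal.ofReal (f a)).prod := by
  induction l with
  | nil => simp
  | cons a l ih => rw [List.map_cons, List.prod_cons, ENNReal.ofReal_mul (h a), ih]; rfl

theorem lastLaw_eq (h0 : ∀ a c, 0 ≤ 𝒬 a c) (j : ℕ) (t : PTree 𝒳) :
    lastLaw 𝒬 j t =
      if trunc (j + 1) t = t then ENNReal.ofReal (levelProd (offspringProb 𝒬) j t) else 0 := by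
  induction j generalizing t with
  | zero => simp [lastLaw]
  | succ j ih =>
    cases t with | node x ts =>
    have h1 : ∀ s, lastLaw 𝒬 j s = (if trunc (j + 1) s = s then 1 else 0) *
        ENNReal.ofReal (levelProd (offspringProb 𝒬) j s) := fun s => by
      rw [ih]; split_ifs <;> simp
    rw [lastLaw, children_node, List.map_congr_left fun s _ => h1 s, List.prod_map_mul,
      prod_ite_trunc (j + 1) x, levelProd_succ, ofReal_list_prod _ _ (levelProd_nonneg h0 j)]
    split_ifs <;> simp

theorem law_ne_zero_iff (h0 : ∀ a c, 0 ≤ 𝒬 a c) {i : ℕ} {t : PTree 𝒳} :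
    law 𝒬 i t ≠ 0 ↔ trunc i t = t ∧ AdmissibleUpTo 𝒬 i t := by
  induction i generalizing t with
  | zero => simp [law, AdmissibleUpTo]
  | succ i ih =>
    cases t with | node x ts =>
    rw [law, mul_ne_zero_iff, admissibleUpTo_succ_node h0, trunc_succ_node_eq_self]
    simp only [ne_eq, ENNReal.ofReal_eq_zero, not_le, offspringProb_node, children_node,
      List.prod_eq_zero_iff, List.mem_map, not_exists, not_and]
    simp only [ih]
    exact ⟨fun h => ⟨fun s hs => (h.2 s hs).1, h.1, fun s hs => (h.2 s hs).2⟩,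
      fun h => ⟨h.2.1, fun s hs => ⟨h.1 s hs, h.2.2 s hs⟩⟩⟩

theorem tsum_map_root (G : PTree 𝒳 → ℝ≥0∞) (F : List 𝒳 → ℝ≥0∞) [DecidableEq 𝒳] :
    ∑' ts : List (PTree 𝒳), F (ts.map root) * (ts.map G).prod =
      ∑' c, F c * (c.map (fiberSum root G)).prod := by
  have := tsum_fiberSum_mul (List.map root) (fun ts : List (PTree 𝒳) => (ts.map G).prod) F
  simp_rw [mul_comm (F _)]
  rw [← this]
  exact tsum_congr fun c => by rw [fiberSum_map_list]

theorem fiberSum_root [DecidableEq 𝒳] (G : PTree 𝒳 → ℝ≥0∞) (x : 𝒳) :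
    fiberSum root G x = ∑' ts, G (node x ts) := by
  rw [fiberSum, tsum_node, tsum_eq_single x fun y hy => by simp [hy]]
  simp

theorem fiberSum_root_trunc_zero [DecidableEq 𝒳] (x : 𝒳) :
    fiberSum root (fun t : PTree 𝒳 => if trunc 0 t = t then (1 : ℝ≥0∞) else 0) x = 1 := by
  rw [fiberSum_root, tsum_eq_single [] fun ts hts => by simp [hts.symm]]
  simp

theorem fiberSum_law [DecidableEq 𝒳] (h1 : ∀ a, ∑' c, ENNReal.ofReal (𝒬 a c) = 1) (i : ℕ) (x : 𝒳) :
    fiberSum root (law 𝒬 i) x = 1 := by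
  induction i generalizing x with
  | zero => exact fiberSum_root_trunc_zero x
  | succ i ih =>
    rw [fiberSum_root, ← h1 x]
    simp only [law, children_node, offspringProb_node]
    rw [tsum_map_root (law 𝒬 i) fun c => ENNReal.ofReal (𝒬 x c)]
    simp [funext ih]

theorem fiberSum_lastLaw (h1 : ∀ a, ∑' c, ENNReal.ofReal (𝒬 a c) = 1) (j : ℕ) {a : PTree 𝒳}
    (ha : trunc j a = a) : fiberSum (trunc j) (lastLaw 𝒬 j) a = 1 := by
  classical
  induction j generalizing a with
  | zero =>
    cases a with | node x ts =>
    obtain rfl : ts = [] := by simpa using ha.symm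
    rw [fiberSum, tsum_node, tsum_eq_single x fun y hy => by simp [hy], ← h1 x]
    have : ∀ ts : List (PTree 𝒳), (if trunc 0 (node x ts) = node x [] then
        lastLaw 𝒬 0 (node x ts) else 0) = ENNReal.ofReal (𝒬 x (ts.map root)) *
          (ts.map fun s => if trunc 0 s = s then 1 else 0).prod := by
      intro ts
      rw [prod_ite_trunc 0 x ts, lastLaw]
      simp
    rw [tsum_congr this, tsum_map_root (fun s => if trunc 0 s = s then 1 else 0) fun c =>
      ENNReal.ofReal (𝒬 x c)]
    simp [funext fiberSum_root_trunc_zero]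
  | succ j ih =>
    cases a with | node x as =>
    rw [trunc_succ_node_eq_self] at ha
    rw [fiberSum, tsum_node, tsum_eq_single x fun y hy => by simp [hy]]
    simp only [lastLaw, children_node, trunc_succ, node.injEq, true_and]
    have := fiberSum_map_list (trunc j) (lastLaw 𝒬 j) as
    rw [fiberSum] at this
    rw [this, List.map_congr_left fun s hs => ih (ha s hs)]
    simp

theorem ofReal_prod_subtrees (h0 : ∀ a c, 0 ≤ 𝒬 a c) (j : ℕ) (t : PTree 𝒳) :
    ENNReal.ofReal (t.subtrees.map fun s => 𝒬 s.root s.childLabels).prod =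
      law 𝒬 j (trunc j t) * treeWeight j (lastLaw 𝒬 j) t := by
  induction j with
  | zero =>
    rw [law, if_pos (trunc_idem 0 t), one_mul, ofReal_list_prod _ _ fun s => h0 _ _, treeWeight]
    refine congrArg _ (List.map_congr_left fun s _ => ?_)
    rw [lastLaw, if_pos (trunc_idem 1 s), offspringProb_trunc_succ]
    rfl
  | succ j ih =>
    rw [ih, law_succ, trunc_trunc (Nat.le_succ j), treeWeight, prod_subtrees_children, treeWeight]
    simp only [lastLaw, children_trunc_succ, List.map_map, Function.comp_def]
    ring

end Law

section Stationary

variable {𝒳 : Type*} [Fintype 𝒳] [DecidableEq 𝒳] {𝒬 : 𝒳 → List 𝒳 → ℝ} {N₀ j : ℕ}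
  {u : 𝒳 → ℝ≥0∞}

theorem mem_bounded_of_admissibleUpTo (h : RegularKernel 𝒬 N₀ u) {k : ℕ} {b : PTree 𝒳}
    (hb : trunc k b = b) (ha : AdmissibleUpTo 𝒬 k b) : b ∈ bounded 𝒳 N₀ k := by
  obtain ⟨t, ht, htb⟩ := h.exists_admissible_of_upTo ha
  rw [← hb, ← htb]
  exact trunc_mem_bounded k (ht.maxDeg_le h.bounded)

theorem law_eq_zero (h : RegularKernel 𝒬 N₀ u) {k : ℕ} {b : PTree 𝒳}
    (hb : b ∉ bounded 𝒳 N₀ k) : law 𝒬 k b = 0 := by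
  by_contra hne
  obtain ⟨h1, h2⟩ := (law_ne_zero_iff h.nonneg).1 hne
  exact hb (mem_bounded_of_admissibleUpTo h h1 h2)

theorem tsum_law (h : RegularKernel 𝒬 N₀ u) (k : ℕ) : ∑' b, u b.root * law 𝒬 k b = 1 := by
  simp_rw [mul_comm (u _)]
  rw [← tsum_fiberSum_mul root (law 𝒬 k) u]
  simp_rw [fiberSum_law (tsum_ofReal_kernel h.nonneg h.hasSum), one_mul]
  rw [tsum_fintype, h.sum_u]

theorem law_mul_ne_top (h : RegularKernel 𝒬 N₀ u) (k : ℕ) (b : PTree 𝒳) :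
    u b.root * law 𝒬 k b ≠ ∞ :=
  ne_top_of_le_ne_top ENNReal.one_ne_top ((ENNReal.le_tsum b).trans (tsum_law h k).le)

theorem tsum_count_law (h : RegularKernel 𝒬 N₀ u) (a : PTree 𝒳) :
    ∑' b, (b.children.count a : ℝ≥0∞) * (u b.root * law 𝒬 (j + 1) b) =
      u a.root * law 𝒬 j a := by
  rw [tsum_node]
  have h1 := fiberSum_law (tsum_ofReal_kernel h.nonneg h.hasSum) j
  have key : ∀ x, ∑' ts : List (PTree 𝒳), ((node x ts).children.count a : ℝ≥0∞) *
      (u (node x ts).root * law 𝒬 (j + 1) (node x ts)) =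
      u x * (meanMat 𝒬 a.root x * law 𝒬 j a) := by
    intro x
    have := tsum_fiberSum_mul (List.map root)
      (fun ts : List (PTree 𝒳) => (ts.count a : ℝ≥0∞) * (ts.map (law 𝒬 j)).prod)
      fun c => ENNReal.ofReal (𝒬 x c)
    simp_rw [fiberSum_map_list_count h1] at this
    rw [meanMat, Matrix.of_apply, ← ENNReal.tsum_mul_right]
    simp only [law, children_node, offspringProb_node, root_node, mult]
    rw [tsum_congr fun ts : List (PTree 𝒳) => show (ts.count a : ℝ≥0∞) * (u x *
      (ENNReal.ofReal (𝒬 x (ts.map root)) * (ts.map (law 𝒬 j)).prod)) = u x *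
      ((ts.count a : ℝ≥0∞) * (ts.map (law 𝒬 j)).prod * ENNReal.ofReal (𝒬 x (ts.map root))) by ring,
      ENNReal.tsum_mul_left, ← this]
    exact congrArg _ (tsum_congr fun c => by ring)
  rw [tsum_congr key, tsum_fintype]
  simp_rw [← mul_assoc]
  rw [← Finset.sum_mul, ← h.eigen a.root]
  simp_rw [mul_comm]

theorem fiberSum_stationary (h : RegularKernel 𝒬 N₀ u) (a : PTree 𝒳) :
    fiberSum (trunc j) (fun b => u b.root * law 𝒬 (j + 1) b) a = u a.root * law 𝒬 j a := by
  rw [fiberSum_congr (g' := fun b => u a.root * law 𝒬 j a * lastLaw 𝒬 j b) fun b hb => by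
    rw [law_succ, hb, ← hb, root_trunc]; ring]
  by_cases ha : trunc j a = a
  · have := fiberSum_lastLaw (tsum_ofReal_kernel h.nonneg h.hasSum) j ha
    rw [fiberSum] at this ⊢
    simp_rw [← mul_ite_zero]
    rw [ENNReal.tsum_mul_left, this, mul_one]
  · have h0 : law 𝒬 j a = 0 := by
      by_contra hne
      exact ha ((law_ne_zero_iff h.nonneg).1 hne).1
    simp [h0, fiberSum]

/-- The stationary law of the first `j + 1` generations. -/
noncomputable def stationary (𝒬 : 𝒳 → List 𝒳 → ℝ) (u : 𝒳 → ℝ≥0∞) (j : ℕ) (b : PTree 𝒳) : ℝ :=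
  (u b.root * law 𝒬 (j + 1) b).toReal

theorem stationary_ne_zero_iff (h : RegularKernel 𝒬 N₀ u) {b : PTree 𝒳} :
    stationary 𝒬 u j b ≠ 0 ↔ b ∈ bounded 𝒳 N₀ (j + 1) ∧ AdmissibleUpTo 𝒬 (j + 1) b := by
  rw [stationary, ENNReal.toReal_ne_zero, and_iff_left (law_mul_ne_top h _ b), mul_ne_zero_iff,
    and_iff_right (h.u_ne_zero _), law_ne_zero_iff h.nonneg]
  exact ⟨fun hb => ⟨mem_bounded_of_admissibleUpTo h hb.1 hb.2, hb.2⟩,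
    fun hb => ⟨(mem_bounded.1 hb.1).1, hb.2⟩⟩

theorem push_stationary (h : RegularKernel 𝒬 N₀ u) (a : PTree 𝒳) :
    push N₀ j (stationary 𝒬 u j) a = (u a.root * law 𝒬 j a).toReal := by
  have h0 : ∀ b, 0 ≤ stationary 𝒬 u j b := fun b => ENNReal.toReal_nonneg
  rw [← ENNReal.toReal_ofReal (push_nonneg h0 a), ← fiberSum_trunc_ofReal h0 fun b hb => by
    simp [stationary, law_eq_zero h hb], ← fiberSum_stationary h]
  simp_rw [stationary, ENNReal.ofReal_toReal (law_mul_ne_top h _ _)]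

theorem stationary_eq (h : RegularKernel 𝒬 N₀ u) {b : PTree 𝒳} (hb : b ∈ bounded 𝒳 N₀ (j + 1)) :
    stationary 𝒬 u j b =
      push N₀ j (stationary 𝒬 u j) (trunc j b) * levelProd (offspringProb 𝒬) j b := by
  rw [push_stationary h, stationary, law_succ, lastLaw_eq h.nonneg, if_pos (mem_bounded.1 hb).1,
    root_trunc, mul_left_comm, mul_comm, ENNReal.toReal_mul,
    ENNReal.toReal_ofReal (levelProd_nonneg h.nonneg j b)]

theorem shiftMeasure_stationary (h : RegularKernel 𝒬 N₀ u) :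
    ShiftMeasure N₀ j (stationary 𝒬 u j) where
  nonneg b := ENNReal.toReal_nonneg
  supp b hb := by simp [stationary, law_eq_zero h hb]
  total := by
    rw [← ENNReal.toReal_one, ← tsum_law h (j + 1), tsum_eq_sum (s := bounded 𝒳 N₀ (j + 1))
      fun b hb => by simp [law_eq_zero h hb], ENNReal.toReal_sum fun b _ => law_mul_ne_top h _ b]
    rfl
  shift a := by
    rw [push_stationary h, ← tsum_count_law h, tsum_eq_sum (s := bounded 𝒳 N₀ (j + 1))
      fun b hb => by simp [law_eq_zero h hb], ENNReal.toReal_sum fun b _ =>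
        ENNReal.mul_ne_top (ENNReal.natCast_ne_top _) (law_mul_ne_top h _ b)]
    simp [stationary, ENNReal.toReal_mul]

end Stationary

section Empirical

variable {𝒳 : Type*} {N j : ℕ} {t : PTree 𝒳}

theorem empK_eq_count (k : ℕ) (t b : PTree 𝒳) :
    empK k t b = ((t.subtrees.map (trunc k)).count b : ℝ) / t.size := by
  rw [empK, List.count, List.countP_map, List.countP_eq_length_filter]
  simp only [Function.comp_def, beq_eq_decide]

theorem empK_nonneg (k : ℕ) (t b : PTree 𝒳) : 0 ≤ empK k t b := by
  rw [empK]; positivity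

theorem empK_trunc_ne_zero (k : ℕ) {s : PTree 𝒳} (hs : s ∈ t.subtrees) :
    empK k t (trunc k s) ≠ 0 := by
  rw [empK_eq_count]
  have h1 := size_pos t
  have h2 := List.count_pos_iff.2 (List.mem_map_of_mem (f := trunc k) hs)
  positivity

theorem maxDeg_le_of_mem_subtrees {s : PTree 𝒳} (hs : s ∈ t.subtrees) (ht : t.maxDeg ≤ N) :
    s.maxDeg ≤ N := by
  induction t using induction with | h a ts ih =>
  rcases mem_subtrees_node.1 hs with rfl | ⟨t, htm, hs⟩
  · exact ht
  · exact ih t htm hs ((maxDeg_node_le.1 ht).2 t htm)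

theorem mem_of_treeWeight_ne_zero {q : PTree 𝒳 → ℝ≥0∞} {t : PTree 𝒳} (h : treeWeight j q t ≠ 0)
    {s : PTree 𝒳} (hs : s ∈ t.subtrees) : q (trunc (j + 1) s) ≠ 0 := fun h0 =>
  h (List.prod_eq_zero (List.mem_map.2 ⟨s, hs, h0⟩))

variable [Finite 𝒳]

theorem trunc_mem_bounded_of_mem_subtrees (ht : t.maxDeg ≤ N) (k : ℕ) {s : PTree 𝒳}
    (hs : s ∈ t.subtrees) : trunc k s ∈ bounded 𝒳 N k :=
  trunc_mem_bounded k (maxDeg_le_of_mem_subtrees hs ht)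

theorem empK_eq_zero (ht : t.maxDeg ≤ N) {k : ℕ} {b : PTree 𝒳} (hb : b ∉ bounded 𝒳 N k) :
    empK k t b = 0 := by
  rw [empK_eq_count, List.count_eq_zero.2, Nat.cast_zero, zero_div]
  intro h
  obtain ⟨s, hs, rfl⟩ := List.mem_map.1 h
  exact hb (trunc_mem_bounded_of_mem_subtrees ht k hs)

theorem sum_empK_mul (ht : t.maxDeg ≤ N) (k : ℕ) (g : PTree 𝒳 → ℝ) :
    ∑ b ∈ bounded 𝒳 N k, empK k t b * g b =
      (t.subtrees.map fun s => g (trunc k s)).sum / t.size := by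
  have : (t.subtrees.map fun s => g (trunc k s)) = (t.subtrees.map (trunc k)).map g := by
    rw [List.map_map]; rfl
  rw [this, Finset.sum_list_map_count, Finset.sum_div]
  symm
  simp only [nsmul_eq_mul]
  refine (Finset.sum_subset (fun b hb => ?_) fun b _ hb => ?_).trans
    (Finset.sum_congr rfl fun b _ => ?_)
  · obtain ⟨s, hs, rfl⟩ := List.mem_map.1 (List.mem_toFinset.1 hb)
    exact trunc_mem_bounded_of_mem_subtrees ht k hs
  · rw [List.mem_toFinset] at hb
    simp [List.count_eq_zero.2 hb]
  · rw [empK_eq_count]; ring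

theorem sum_empK (ht : t.maxDeg ≤ N) (k : ℕ) : ∑ b ∈ bounded 𝒳 N k, empK k t b = 1 := by
  have := sum_empK_mul ht k 1
  simp only [Pi.one_apply, mul_one] at this
  rw [this]
  have := size_pos t
  simp only [List.map_const', List.sum_replicate, nsmul_eq_mul, mul_one]
  exact div_self (by rw [← size]; positivity)

theorem push_empK (ht : t.maxDeg ≤ N) (a : PTree 𝒳) :
    push N j (empK (j + 1) t) a =
      (t.subtrees.map fun s => if trunc j s = a then (1 : ℝ) else 0).sum / t.size := by
  have := sum_empK_mul ht (j + 1) fun b => if trunc j b = a then (1 : ℝ) else 0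
  simp only [trunc_trunc (Nat.le_succ j), mul_ite, mul_one, mul_zero] at this
  exact this

/-- Up to the contribution of the root, the empirical offspring measure is shift-invariant. -/
theorem push_empK_sub (ht : t.maxDeg ≤ N) (a : PTree 𝒳) :
    push N j (empK (j + 1) t) a -
        ∑ b ∈ bounded 𝒳 N (j + 1), (b.children.count a : ℝ) * empK (j + 1) t b =
      (if trunc j t = a then 1 else 0) / t.size := by
  have hcount : ∀ s : PTree 𝒳, ((trunc (j + 1) s).children.count a : ℝ) =
      (s.children.map fun c => if trunc j c = a then (1 : ℝ) else 0).sum := by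
    intro s
    rw [children_trunc_succ]
    induction s.children with
    | nil => simp
    | cons c l ih =>
      rw [List.map_cons, List.count_cons, Nat.cast_add, ih, List.map_cons, List.sum_cons, add_comm]
      simp
  have := sum_empK_mul ht (j + 1) fun b => (b.children.count a : ℝ)
  simp_rw [hcount] at this
  rw [push_empK ht, sum_subtrees_children]
  simp_rw [mul_comm _ (empK _ _ _)]
  rw [this]
  ring

end Empirical

section Divergence

variable {𝒳 : Type*} [Finite 𝒳] {N j : ℕ} {r ν : PTree 𝒳 → ℝ}

/-- The relative entropy of `ν` with respect to `π_j(ν) ⊗ r`, in a form which is continuous in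
`ν`. -/
noncomputable def divergence (N j : ℕ) (r ν : PTree 𝒳 → ℝ) : ℝ :=
  ∑ b ∈ bounded 𝒳 N (j + 1), ν b * Real.log (ν b) -
    ∑ a ∈ bounded 𝒳 N j, push N j ν a * Real.log (push N j ν a) -
      ∑ b ∈ bounded 𝒳 N (j + 1), ν b * Real.log (r b)

theorem continuous_push (a : PTree 𝒳) : Continuous fun ν : PTree 𝒳 → ℝ => push N j ν a := by
  unfold push
  refine continuous_finsetSum _ fun b _ => ?_
  split_ifs <;> fun_prop

theorem continuous_divergence : Continuous (divergence N j r) := by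
  unfold divergence
  have h := fun a => Real.continuous_mul_log.comp (continuous_push (𝒳 := 𝒳) (N := N) (j := j) a)
  have h' := fun b : PTree 𝒳 => Real.continuous_mul_log.comp (continuous_apply (A := fun _ => ℝ) b)
  refine ((continuous_finsetSum _ fun b _ => h' b).sub (continuous_finsetSum _ fun a _ => h a)).sub
    (by fun_prop)

theorem divergence_eq : divergence N j r ν = ∑ b ∈ bounded 𝒳 N (j + 1),
    ν b * (Real.log (ν b) - Real.log (push N j ν (trunc j b)) - Real.log (r b)) := by
  rw [divergence, sum_push_mul ν fun a => Real.log (push N j ν a)]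
  simp only [mul_sub, Finset.sum_sub_distrib]

theorem divergence_eq_cond (h0 : ∀ b, 0 ≤ ν b) :
    divergence N j r ν = ∑ b ∈ bounded 𝒳 N (j + 1),
      ν b * (Real.log (cond N j ν b) - Real.log (r b)) := by
  rw [divergence_eq]
  refine Finset.sum_congr rfl fun b hb => ?_
  rcases (h0 b).eq_or_lt with h | h
  · simp [← h]
  · rw [cond, Real.log_div h.ne' (h.trans_le (le_push h0 hb)).ne']

end Divergence

section Counting

variable {𝒳 : Type*} [Finite 𝒳] {N j n : ℕ} {r : PTree 𝒳 → ℝ}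

theorem treeWeight_eq_exp {t : PTree 𝒳} (ht : t.maxDeg ≤ N) (hr : ∀ b, 0 ≤ r b)
    (h : ∀ s ∈ t.subtrees, r (trunc (j + 1) s) ≠ 0) :
    treeWeight j (fun b => ENNReal.ofReal (r b)) t = ENNReal.ofReal (Real.exp
      (t.size * ∑ b ∈ bounded 𝒳 N (j + 1), empK (j + 1) t b * Real.log (r b))) := by
  rw [sum_empK_mul ht, mul_div_cancel₀ _ (by exact_mod_cast (size_pos t).ne'), treeWeight,
    ← ofReal_list_prod _ (fun s => r (trunc (j + 1) s)) fun s => hr _]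
  rw [← log_list_prod _ _ h, Real.exp_log]
  refine List.prod_pos fun x hx => ?_
  obtain ⟨s, hs, rfl⟩ := List.mem_map.1 hx
  exact lt_of_le_of_ne (hr _) (h s hs).symm

theorem maxDeg_le_of_treeWeight_ne_zero {q : PTree 𝒳 → ℝ≥0∞}
    (hq : ∀ b, b ∉ bounded 𝒳 N (j + 1) → q b = 0) {t : PTree 𝒳} (h : treeWeight j q t ≠ 0) :
    t.maxDeg ≤ N := by
  induction t using induction with | h x ts ih =>
  have hx : trunc (j + 1) (node x ts) ∈ bounded 𝒳 N (j + 1) := by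
    by_contra hcon
    exact mem_of_treeWeight_ne_zero h (self_mem_subtrees _) (hq _ hcon)
  rw [maxDeg_node_le]
  refine ⟨?_, fun s hs => ih s hs fun h0 => h ?_⟩
  · have := (mem_bounded.1 hx).2
    rw [trunc_succ, maxDeg_node_le] at this
    simpa using this.1
  · rw [treeWeight_eq, children_node, List.prod_eq_zero (List.mem_map.2 ⟨s, hs, h0⟩), mul_zero]

theorem treeWeight_le {t : PTree 𝒳} (hr : ∀ b, 0 ≤ r b)
    (hsupp : ∀ b, b ∉ bounded 𝒳 N (j + 1) → r b = 0) :
    treeWeight j (fun b => ENNReal.ofReal (r b)) t ≤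
      ENNReal.ofReal (Real.exp (-(t.size * divergence N j r (empK (j + 1) t)))) *
        treeWeight j (fun b => ENNReal.ofReal (cond N j (empK (j + 1) t) b)) t := by
  by_cases h : treeWeight j (fun b => ENNReal.ofReal (r b)) t = 0
  · simp [h]
  have ht : t.maxDeg ≤ N := maxDeg_le_of_treeWeight_ne_zero (fun b hb => by simp [hsupp b hb]) h
  have h0 := empK_nonneg (j + 1) t
  have hr' : ∀ s ∈ t.subtrees, r (trunc (j + 1) s) ≠ 0 := fun s hs h0 =>
    mem_of_treeWeight_ne_zero h hs (by simp [h0])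
  have hc : ∀ s ∈ t.subtrees, cond N j (empK (j + 1) t) (trunc (j + 1) s) ≠ 0 := fun s hs => by
    have h1 := lt_of_le_of_ne (h0 _) (empK_trunc_ne_zero (j + 1) hs).symm
    exact (div_pos h1 (h1.trans_le (le_push h0 (trunc_mem_bounded_of_mem_subtrees ht _ hs)))).ne'
  rw [treeWeight_eq_exp ht hr hr', treeWeight_eq_exp ht (cond_nonneg h0) hc, divergence_eq_cond h0,
    ← ENNReal.ofReal_mul (Real.exp_pos _).le, ← Real.exp_add]
  refine le_of_eq (congrArg _ (congrArg _ ?_))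
  simp only [mul_sub, Finset.sum_sub_distrib]
  ring

theorem tsum_treeWeight_le {q : PTree 𝒳 → ℝ≥0∞} (hq : ∀ b, b ∉ bounded 𝒳 N (j + 1) → q b = 0)
    (hq1 : ∀ a, fiberSum (trunc j) q a ≤ 1) :
    ∑' t, treeWeight j q t ≤ (bounded 𝒳 N j).card := by
  rw [← tsum_fiberSum (trunc j), tsum_eq_sum (s := bounded 𝒳 N j) fun a ha => ?_]
  · exact (Finset.sum_le_card_nsmul _ _ 1 fun a _ => typeMass_le_one hq1 a).trans (by simp)
  · rw [fiberSum, ENNReal.tsum_eq_zero]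
    intro t
    split_ifs with h
    · by_contra hne
      exact ha (h ▸ trunc_mem_bounded j (maxDeg_le_of_treeWeight_ne_zero hq hne))
    · rfl

/-- Upper bound for the weight of the trees with a given size whose empirical offspring measures
have a large divergence. -/
theorem tsum_treeWeight_le_exp {γ : ℝ} (hr : ∀ b, 0 ≤ r b)
    (hsupp : ∀ b, b ∉ bounded 𝒳 N (j + 1) → r b = 0) {P : PTree 𝒳 → Prop} [DecidablePred P]
    (hP : ∀ t, P t → treeWeight j (fun b => ENNReal.ofReal (r b)) t ≠ 0 →
      t.size = n ∧ γ ≤ divergence N j r (empK (j + 1) t)) :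
    ∑' t, (if P t then treeWeight j (fun b => ENNReal.ofReal (r b)) t else 0) ≤
      (n + 1) ^ (bounded 𝒳 N (j + 1)).card * (bounded 𝒳 N j).card *
        ENNReal.ofReal (Real.exp (-(n * γ))) := by
  set w := treeWeight j (fun b => ENNReal.ofReal (r b)) with hw
  let f : PTree 𝒳 → (bounded 𝒳 N (j + 1) → Fin (n + 1)) := fun t b =>
    Fin.ofNat (n + 1) ((t.subtrees.map (trunc (j + 1))).count b.1)
  have hf : ∀ t t' : PTree 𝒳, t.size = n → t'.size = n → t.maxDeg ≤ N → t'.maxDeg ≤ N →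
      f t = f t' → empK (j + 1) t = empK (j + 1) t' := by
    intro t t' hn hn' ht ht' h
    ext b
    by_cases hb : b ∈ bounded 𝒳 N (j + 1)
    · have h1 := congrArg Fin.val (congrFun h ⟨b, hb⟩)
      have hlt : ∀ s : PTree 𝒳, s.size = n →
          (s.subtrees.map (trunc (j + 1))).count b < n + 1 := fun s hs => by
        have := List.count_le_length (a := b) (l := s.subtrees.map (trunc (j + 1)))
        rw [List.length_map] at this
        exact Nat.lt_succ_of_le (this.trans hs.le)
      simp only [f, Fin.ofNat] at h1
      rw [Nat.mod_eq_of_lt (hlt t hn), Nat.mod_eq_of_lt (hlt t' hn')] at h1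
      rw [empK_eq_count, empK_eq_count, h1, hn, hn']
    · rw [empK_eq_zero ht hb, empK_eq_zero ht' hb]
  rw [← tsum_fiberSum f, tsum_fintype]
  refine (Finset.sum_le_card_nsmul _ _ ((bounded 𝒳 N j).card *
    ENNReal.ofReal (Real.exp (-(n * γ)))) fun c _ => ?_).trans (le_of_eq ?_)
  swap
  · simp only [Finset.card_univ, Fintype.card_fun, Fintype.card_fin, Fintype.card_coe,
      nsmul_eq_mul]
    push_cast
    ring
  have hmax : ∀ t, w t ≠ 0 → t.maxDeg ≤ N := fun t h =>
    maxDeg_le_of_treeWeight_ne_zero (fun b hb => by simp [hsupp b hb]) h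
  by_cases hex : ∃ t₀, P t₀ ∧ f t₀ = c ∧ w t₀ ≠ 0
  · obtain ⟨t₀, ht₀, hc, hw₀⟩ := hex
    have h0 := empK_nonneg (j + 1) t₀
    have hs : ∀ b, b ∉ bounded 𝒳 N (j + 1) → empK (j + 1) t₀ b = 0 := fun b hb =>
      empK_eq_zero (hmax t₀ hw₀) hb
    have hsum := tsum_treeWeight_le (N := N) (j := j)
      (q := fun b => ENNReal.ofReal (cond N j (empK (j + 1) t₀) b))
      (fun b hb => by simp [cond, hs b hb]) (fiberSum_cond_le_one h0 hs)
    rw [mul_comm]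
    refine le_trans ?_ (mul_le_mul_right hsum _)
    rw [← ENNReal.tsum_mul_left]
    refine ENNReal.tsum_le_tsum fun t => ?_
    dsimp only
    split_ifs with h1 h2
    · by_cases hwt : w t = 0
      · simp [hwt]
      have hemp := hf t t₀ (hP t h2 hwt).1 (hP t₀ ht₀ hw₀).1 (hmax t hwt) (hmax t₀ hw₀)
        (h1.trans hc.symm)
      refine (treeWeight_le hr hsupp).trans ?_
      rw [hemp, (hP t h2 hwt).1]
      refine mul_le_mul_left (ENNReal.ofReal_le_ofReal (Real.exp_le_exp.2 (neg_le_neg ?_))) _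
      exact mul_le_mul_of_nonneg_left (hP t₀ ht₀ hw₀).2 (Nat.cast_nonneg n)
    · exact zero_le
    · exact zero_le
  · push Not at hex
    refine le_of_eq_of_le ?_ zero_le
    rw [fiberSum, ENNReal.tsum_eq_zero]
    intro t
    split_ifs with h1 h2
    · exact hex t h2 h1
    · rfl
    · rfl

end Counting

section UpperBound

variable {𝒳 : Type*} [Finite 𝒳] {N j : ℕ} {r : PTree 𝒳 → ℝ}

/-- The total deviation from shift-invariance. -/
noncomputable def shiftDefect (N j : ℕ) (ν : PTree 𝒳 → ℝ) : ℝ :=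
  ∑ a ∈ bounded 𝒳 N j,
    |push N j ν a - ∑ b ∈ bounded 𝒳 N (j + 1), (b.children.count a : ℝ) * ν b|

theorem continuous_shiftDefect : Continuous (shiftDefect (𝒳 := 𝒳) N j) := by
  unfold shiftDefect
  refine continuous_finsetSum _ fun a _ => ((continuous_push a).sub ?_).abs
  fun_prop

theorem shiftDefect_nonneg (ν : PTree 𝒳 → ℝ) : 0 ≤ shiftDefect N j ν :=
  Finset.sum_nonneg fun _ _ => abs_nonneg _

theorem shiftDefect_empK_le {t : PTree 𝒳} (ht : t.maxDeg ≤ N) :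
    shiftDefect N j (empK (j + 1) t) ≤ (bounded 𝒳 N j).card / t.size := by
  rw [shiftDefect, div_eq_mul_one_div, ← nsmul_eq_mul]
  refine Finset.sum_le_card_nsmul _ _ _ fun a _ => ?_
  rw [push_empK_sub ht, abs_div, Nat.abs_cast]
  gcongr
  split_ifs <;> simp

variable (𝒳) in
/-- The probability vectors on the trees of height at most `k` and degree bounded by `N`. -/
def probVec (N k : ℕ) : Set (PTree 𝒳 → ℝ) :=
  {ν | (∀ b, 0 ≤ ν b) ∧ (∀ b, b ∉ bounded 𝒳 N k → ν b = 0) ∧ ∑ b ∈ bounded 𝒳 N k, ν b = 1}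

theorem isCompact_probVec (k : ℕ) : IsCompact (probVec 𝒳 N k) := by
  refine (isCompact_univ_pi fun _ : PTree 𝒳 =>
    isCompact_Icc (a := (0 : ℝ)) (b := 1)).of_isClosed_subset
    ?_ fun ν hν b _ => ⟨hν.1 b, ?_⟩
  · have h1 : IsClosed {ν : PTree 𝒳 → ℝ | ∀ b, 0 ≤ ν b} := by
      rw [Set.ofPred_forall]
      exact isClosed_iInter fun b => isClosed_le continuous_const (continuous_apply b)
    have h2 : IsClosed {ν : PTree 𝒳 → ℝ | ∀ b, b ∉ bounded 𝒳 N k → ν b = 0} := by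
      simp only [Set.ofPred_forall]
      exact isClosed_iInter fun b => isClosed_iInter fun _ =>
        isClosed_eq (continuous_apply b) continuous_const
    have h3 : IsClosed {ν : PTree 𝒳 → ℝ | ∑ b ∈ bounded 𝒳 N k, ν b = 1} :=
      isClosed_eq (by fun_prop) continuous_const
    exact h1.inter (h2.inter h3)
  · by_cases hb : b ∈ bounded 𝒳 N k
    · exact (Finset.single_le_sum (fun b _ => hν.1 b) hb).trans hν.2.2.le
    · rw [hν.2.1 b hb]; exact zero_le_one

theorem empK_mem_probVec {t : PTree 𝒳} (ht : t.maxDeg ≤ N) (k : ℕ) : empK k t ∈ probVec 𝒳 N k :=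
  ⟨empK_nonneg k t, fun _ => empK_eq_zero ht, sum_empK ht k⟩

theorem ShiftMeasure.mem_probVec {ν : PTree 𝒳 → ℝ} (h : ShiftMeasure N j ν) :
    ν ∈ probVec 𝒳 N (j + 1) := ⟨h.nonneg, h.supp, h.total⟩

theorem shiftMeasure_of_shiftDefect {ν : PTree 𝒳 → ℝ} (hν : ν ∈ probVec 𝒳 N (j + 1))
    (h : shiftDefect N j ν = 0) : ShiftMeasure N j ν where
  nonneg := hν.1
  supp := hν.2.1
  total := hν.2.2
  shift a := by
    by_cases ha : a ∈ bounded 𝒳 N j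
    · exact sub_eq_zero.1 (abs_eq_zero.1
        ((Finset.sum_eq_zero_iff_of_nonneg fun _ _ => abs_nonneg _).1 h a ha))
    · rw [push, Finset.sum_eq_zero, Finset.sum_eq_zero]
      · intro b hb
        rw [List.count_eq_zero.2 fun hab => ha (child_mem_bounded hb hab), Nat.cast_zero, zero_mul]
      · intro b hb
        rw [if_neg]
        rintro rfl
        exact ha (trunc_mem_bounded j (mem_bounded.1 hb).2)

theorem ShiftMeasure.shiftDefect_eq_zero {ν : PTree 𝒳 → ℝ} (h : ShiftMeasure N j ν) :
    shiftDefect N j ν = 0 :=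
  Finset.sum_eq_zero fun a _ => by rw [h.shift, sub_self, abs_zero]

theorem exists_lt_shiftDefect {F : Set (PTree 𝒳 → ℝ)} (hF : IsClosed F) {γ : ℝ}
    (hγ : ∀ ν ∈ F, ShiftMeasure N j ν → (∀ b, r b = 0 → ν b = 0) → γ < divergence N j r ν) :
    ∃ δ > 0, ∀ ν ∈ F, ν ∈ probVec 𝒳 N (j + 1) → (∀ b, r b = 0 → ν b = 0) →
      divergence N j r ν ≤ γ → δ ≤ shiftDefect N j ν := by
  set K := probVec 𝒳 N (j + 1) ∩
    (F ∩ ({ν | ∀ b, r b = 0 → ν b = 0} ∩ {ν | divergence N j r ν ≤ γ})) with hK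
  have hc : IsCompact K := by
    refine (isCompact_probVec _).inter_right (hF.inter (IsClosed.inter ?_
      (isClosed_le continuous_divergence continuous_const)))
    simp only [Set.ofPred_forall]
    exact isClosed_iInter fun b => isClosed_iInter fun _ =>
      isClosed_eq (continuous_apply b) continuous_const
  rcases K.eq_empty_or_nonempty with h | h
  · refine ⟨1, one_pos, fun ν h1 h2 h3 h4 => ?_⟩
    exact absurd (show ν ∈ K from ⟨h2, h1, h3, h4⟩) (by simp [h])
  · obtain ⟨ν₀, h₀, hmin⟩ := hc.exists_isMinOn h continuous_shiftDefect.continuousOn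
    refine ⟨shiftDefect N j ν₀, lt_of_le_of_ne (shiftDefect_nonneg _) fun h0 => ?_,
      fun ν h1 h2 h3 h4 => hmin ⟨h2, h1, h3, h4⟩⟩
    exact absurd h₀.2.2.2
      (not_le.2 (hγ ν₀ h₀.2.1 (shiftMeasure_of_shiftDefect h₀.1 h0.symm) h₀.2.2.1))

theorem eventually_poly_le_exp (d : ℕ) (c : ℝ) {γ γ' : ℝ} (h : γ' < γ) :
    ∀ᶠ n : ℕ in atTop, ((n : ℝ) + 1) ^ d * c * Real.exp (-(n * γ)) ≤ Real.exp (-(n * γ')) := by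
  have h1 := (Real.tendsto_pow_mul_exp_neg_atTop_nhds_zero d).const_mul
    (c * (γ - γ')⁻¹ ^ d * Real.exp (γ - γ'))
  rw [mul_zero] at h1
  have h2 : Tendsto (fun n : ℕ => (γ - γ') * ((n : ℝ) + 1)) atTop atTop :=
    (tendsto_atTop_add_const_right _ _ tendsto_natCast_atTop_atTop).const_mul_atTop (sub_pos.2 h)
  filter_upwards [(h1.comp h2).eventually_le_const one_pos] with n hn
  have h3 : γ - γ' ≠ 0 := (sub_pos.2 h).ne'
  have h4 : ((n : ℝ) + 1) ^ d * c * Real.exp (-(n * γ)) =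
      c * (γ - γ')⁻¹ ^ d * Real.exp (γ - γ') * (((γ - γ') * ((n : ℝ) + 1)) ^ d *
        Real.exp (-((γ - γ') * ((n : ℝ) + 1)))) * Real.exp (-(n * γ')) := by
    have e1 : Real.exp (-(n * γ)) = Real.exp (γ - γ') *
        Real.exp (-((γ - γ') * ((n : ℝ) + 1))) * Real.exp (-(n * γ')) := by
      rw [← Real.exp_add, ← Real.exp_add]; ring_nf
    have e2 : (γ - γ')⁻¹ ^ d * (γ - γ') ^ d = 1 := by rw [← mul_pow, inv_mul_cancel₀ h3, one_pow]
    rw [e1, mul_pow]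
    linear_combination (-(c * (n + 1 : ℝ) ^ d * Real.exp (γ - γ') *
      Real.exp (-((γ - γ') * ((n : ℝ) + 1))) * Real.exp (-(n * γ')))) * e2
  rw [h4]
  exact mul_le_of_le_one_left (Real.exp_pos _).le hn

open Classical in
/-- The exponential upper bound on the weight of the trees whose empirical offspring measure lies
in a closed set. -/
theorem eventually_tsum_treeWeight_le (hr : ∀ b, 0 ≤ r b)
    (hsupp : ∀ b, b ∉ bounded 𝒳 N (j + 1) → r b = 0) {F : Set (PTree 𝒳 → ℝ)} (hF : IsClosed F)
    {γ γ' : ℝ} (hγ' : γ' < γ)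
    (hγ : ∀ ν ∈ F, ShiftMeasure N j ν → (∀ b, r b = 0 → ν b = 0) → γ ≤ divergence N j r ν) :
    ∀ᶠ n : ℕ in atTop, ∑' t, (if t.size = n ∧ empK (j + 1) t ∈ F then
        treeWeight j (fun b => ENNReal.ofReal (r b)) t else 0) ≤
      ENNReal.ofReal (Real.exp (-(n * γ'))) := by
  obtain ⟨γ₁, h₁, h₁'⟩ := exists_between hγ'
  obtain ⟨δ, hδ, hδ'⟩ := exists_lt_shiftDefect (N := N) (j := j) (r := r) hF (γ := γ₁)
    fun ν h1 h2 h3 => h₁'.trans_le (hγ ν h1 h2 h3)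
  have hlim : Tendsto (fun n : ℕ => ((bounded 𝒳 N j).card : ℝ) / n) atTop (nhds 0) :=
    tendsto_const_div_atTop_nhds_zero_nat _
  filter_upwards [hlim.eventually_lt_const hδ,
    eventually_poly_le_exp (bounded 𝒳 N (j + 1)).card (bounded 𝒳 N j).card h₁] with n hn hpoly
  refine (tsum_treeWeight_le_exp (n := n) (γ := γ₁) hr hsupp fun t ht hw => ⟨ht.1, ?_⟩).trans ?_
  · have hmax : t.maxDeg ≤ N :=
      maxDeg_le_of_treeWeight_ne_zero (fun b hb => by simp [hsupp b hb]) hw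
    by_contra! hlt
    have := hδ' _ ht.2 (empK_mem_probVec hmax _) (fun b hb => ?_) hlt.le
    · exact absurd (this.trans (shiftDefect_empK_le hmax)) (by rw [ht.1]; exact not_le.2 hn)
    · by_contra hne
      rw [empK_eq_count, ← ne_eq, div_ne_zero_iff, Nat.cast_ne_zero, ← pos_iff_ne_zero,
        List.count_pos_iff] at hne
      obtain ⟨s, hs, rfl⟩ := List.mem_map.1 hne.1
      exact mem_of_treeWeight_ne_zero hw hs (by simp [hb])
  · refine le_trans (le_of_eq ?_) (ENNReal.ofReal_le_ofReal hpoly)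
    rw [ENNReal.ofReal_mul (by positivity), ENNReal.ofReal_mul (by positivity),
      ENNReal.ofReal_pow (by positivity), ENNReal.ofReal_natCast]
    congr 3
    rw [ENNReal.ofReal_add (by positivity) zero_le_one]
    simp

end UpperBound

end PTree

theorem sub_le_mul_log_sub_log {x y : ℝ} (hx : 0 ≤ x) (hy : 0 ≤ y) (h : y = 0 → x = 0) :
    x - y ≤ x * (Real.log x - Real.log y) ∧
      (x * (Real.log x - Real.log y) = x - y → x = y) := by
  rcases hy.eq_or_lt with rfl | hy
  · simp [h rfl]
  rcases hx.eq_or_lt with rfl | hx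
  · simpa using ⟨hy.le, fun h => h.symm⟩
  have key : y * InformationTheory.klFun (x / y) = x * (Real.log x - Real.log y) - (x - y) := by
    rw [InformationTheory.klFun, Real.log_div hx.ne' hy.ne']
    field_simp
    ring
  have hxy := div_nonneg hx.le hy.le
  refine ⟨sub_nonneg.1 (key ▸ mul_nonneg hy.le (InformationTheory.klFun_nonneg hxy)), fun heq => ?_⟩
  rw [heq, sub_self, mul_eq_zero, or_iff_right hy.ne',
    InformationTheory.klFun_eq_zero_iff hxy, div_eq_one_iff_eq hy.ne'] at key
  exact key

namespace PTree

theorem size_lt_of_mem_children {𝒳 : Type*} {b s : PTree 𝒳} (h : s ∈ b.children) :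
    s.size < b.size := by
  cases b with | node x ts =>
  rw [size_node]
  have := List.single_le_sum (l := ts.map size) (fun _ _ => Nat.zero_le _) _
    (List.mem_map_of_mem (f := size) h)
  omega

section Gibbs

variable {𝒳 : Type*} [Finite 𝒳] {N j : ℕ} {r ν : PTree 𝒳 → ℝ}

theorem sum_push_mul_le (h0 : ∀ b, 0 ≤ ν b) (hr : ∀ a, push N j r a ≤ 1) :
    ∑ b ∈ bounded 𝒳 N (j + 1), push N j ν (trunc j b) * r b ≤ ∑ b ∈ bounded 𝒳 N (j + 1), ν b := by
  simp_rw [mul_comm _ (r _)]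
  rw [← sum_push_mul, ← sum_push]
  exact Finset.sum_le_sum fun a _ => mul_le_of_le_one_left (push_nonneg h0 a) (hr a)

theorem divergence_eq_mul (h0 : ∀ b, 0 ≤ ν b) (hac : ∀ b, r b = 0 → ν b = 0) :
    divergence N j r ν = ∑ b ∈ bounded 𝒳 N (j + 1),
      ν b * (Real.log (ν b) - Real.log (push N j ν (trunc j b) * r b)) := by
  rw [divergence_eq]
  refine Finset.sum_congr rfl fun b hb => ?_
  rcases (h0 b).eq_or_lt with h | h
  · simp [← h]
  · rw [Real.log_mul (h.trans_le (le_push h0 hb)).ne' fun h' => h.ne' (hac b h'), sub_sub]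

theorem push_mul_eq_zero (h0 : ∀ b, 0 ≤ ν b) (hac : ∀ b, r b = 0 → ν b = 0) {b : PTree 𝒳}
    (hb : b ∈ bounded 𝒳 N (j + 1)) (h : push N j ν (trunc j b) * r b = 0) : ν b = 0 :=
  (mul_eq_zero.1 h).elim (fun h => le_antisymm ((le_push h0 hb).trans h.le) (h0 b)) (hac b)

theorem divergence_nonneg (h0 : ∀ b, 0 ≤ ν b) (hr0 : ∀ b, 0 ≤ r b)
    (hac : ∀ b, r b = 0 → ν b = 0) (hr : ∀ a, push N j r a ≤ 1) : 0 ≤ divergence N j r ν := by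
  rw [divergence_eq_mul h0 hac]
  refine le_trans (sub_nonneg.2 (sum_push_mul_le h0 hr)) ?_
  rw [← Finset.sum_sub_distrib]
  exact Finset.sum_le_sum fun b hb => (sub_le_mul_log_sub_log (h0 b)
    (mul_nonneg (push_nonneg h0 _) (hr0 b)) (push_mul_eq_zero h0 hac hb)).1

theorem eq_of_divergence_nonpos (h0 : ∀ b, 0 ≤ ν b) (hr0 : ∀ b, 0 ≤ r b)
    (hac : ∀ b, r b = 0 → ν b = 0) (hr : ∀ a, push N j r a ≤ 1) (h : divergence N j r ν ≤ 0)
    {b : PTree 𝒳} (hb : b ∈ bounded 𝒳 N (j + 1)) : ν b = push N j ν (trunc j b) * r b := by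
  rw [divergence_eq_mul h0 hac] at h
  have h1 := sum_push_mul_le h0 hr
  have h2 := fun b hb => sub_le_mul_log_sub_log (h0 b)
    (mul_nonneg (push_nonneg h0 _) (hr0 b)) (push_mul_eq_zero (N := N) (j := j) h0 hac hb)
  have h3 := Finset.sum_le_sum fun b hb => (h2 b hb).1
  have h4 := (Finset.sum_eq_sum_iff_of_le fun b hb => (h2 b hb).1).1
    (le_antisymm h3 (by rw [Finset.sum_sub_distrib]; linarith))
  exact (h2 b hb).2 (h4 b hb).symm

end Gibbs

section Uniqueness

variable {𝒳 : Type*} [Fintype 𝒳] [DecidableEq 𝒳] {𝒬 : 𝒳 → List 𝒳 → ℝ} {N₀ j : ℕ}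
  {u : 𝒳 → ℝ≥0∞} {μ ν : PTree 𝒳 → ℝ}

/-- A nonnegative eigenvector of the shift supported by the admissible types and vanishing at one
of them is zero. -/
theorem eq_zero_of_eigen (h : RegularKernel 𝒬 N₀ u) {q v : PTree 𝒳 → ℝ}
    (hq : ∀ b, q b ≠ 0 ↔ b ∈ bounded 𝒳 N₀ (j + 1) ∧ AdmissibleUpTo 𝒬 (j + 1) b)
    (hq0 : ∀ b, 0 ≤ q b) (hv : ∀ a ∈ bounded 𝒳 N₀ j, 0 ≤ v a)
    (hshift : ∀ a ∈ bounded 𝒳 N₀ j, v a = ∑ b ∈ bounded 𝒳 N₀ (j + 1),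
      (b.children.count a : ℝ) * (v (trunc j b) * q b))
    {s : PTree 𝒳} (hs : Admissible 𝒬 s) (hvs : v (trunc j s) = 0) :
    ∀ a ∈ bounded 𝒳 N₀ j, v a = 0 := by
  have hmem : ∀ {b}, b ∈ bounded 𝒳 N₀ (j + 1) → trunc j b ∈ bounded 𝒳 N₀ j := fun hb =>
    trunc_mem_bounded j (mem_bounded.1 hb).2
  have hterm : ∀ a ∈ bounded 𝒳 N₀ j, ∀ b ∈ bounded 𝒳 N₀ (j + 1),
      0 ≤ (b.children.count a : ℝ) * (v (trunc j b) * q b) := fun a _ b hb =>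
    mul_nonneg (Nat.cast_nonneg _) (mul_nonneg (hv _ (hmem hb)) (hq0 b))
  have hup : ∀ t, Admissible 𝒬 t → s ∈ t.subtrees → v (trunc j t) = 0 := by
    intro t ht hst
    induction t using induction with | h x ts ih =>
    rcases mem_subtrees_node.1 hst with rfl | ⟨c, hc, hsc⟩
    · exact hvs
    have hcv := ih c hc ((admissible_node.1 ht).2 c hc) hsc
    have hb : trunc (j + 1) (node x ts) ∈ bounded 𝒳 N₀ (j + 1) :=
      trunc_mem_bounded _ (ht.maxDeg_le h.bounded)
    have hcm : trunc j c ∈ bounded 𝒳 N₀ j := trunc_mem_bounded _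
      (((admissible_node.1 ht).2 c hc).maxDeg_le h.bounded)
    have := (Finset.sum_eq_zero_iff_of_nonneg (hterm _ hcm)).1 ((hshift _ hcm).symm.trans hcv) _ hb
    rw [trunc_trunc (Nat.le_succ j)] at this
    have hq' : q (trunc (j + 1) (node x ts)) ≠ 0 :=
      (hq _).2 ⟨hb, (admissibleUpTo_trunc le_rfl).2 (ht.upTo _)⟩
    have hcount : (List.count (trunc j c) (trunc (j + 1) (node x ts)).children : ℝ) ≠ 0 := by
      rw [Nat.cast_ne_zero, ← pos_iff_ne_zero, List.count_pos_iff, trunc_succ]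
      exact List.mem_map_of_mem hc
    exact (mul_eq_zero.1 ((mul_eq_zero.1 this).resolve_left hcount)).resolve_right hq'
  by_contra! hne
  obtain ⟨a, ha, hva⟩ := hne
  obtain ⟨a, ha, hmax⟩ := Finset.exists_max_image ((bounded 𝒳 N₀ j).filter fun a => v a ≠ 0) size
    ⟨a, Finset.mem_filter.2 ⟨ha, hva⟩⟩
  rw [Finset.mem_filter] at ha
  obtain ⟨b, hb, hbne⟩ := Finset.exists_ne_zero_of_sum_ne_zero
    ((hshift a ha.1).symm.trans_ne ha.2)
  simp only [mul_ne_zero_iff, Nat.cast_ne_zero] at hbne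
  obtain ⟨hab, hvb, hqb⟩ := hbne
  obtain ⟨t, ht, htb⟩ := h.exists_admissible_of_upTo ((hq b).1 hqb).2
  rw [(mem_bounded.1 hb).1] at htb
  have htb' : trunc j t = trunc j b := by rw [← htb, trunc_trunc (Nat.le_succ j)]
  by_cases hd : atDepth j b = []
  · have hbb := trunc_eq_self_of_atDepth hd
    rw [hbb] at hvb
    have h1 := hmax b (Finset.mem_filter.2 ⟨hbb ▸ hmem hb, hvb⟩)
    exact absurd (size_lt_of_mem_children (List.count_pos_iff.1 (pos_iff_ne_zero.2 hab)))
      (not_lt.2 h1)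
  · rw [← atDepth_trunc_eq_nil le_rfl, ← htb', atDepth_trunc_eq_nil le_rfl] at hd
    obtain ⟨t', ht', htr, hst⟩ := h.exists_admissible_trunc ht hd hs
    exact hvb (by rw [← htb', ← htr]; exact hup t' ht' hst)

theorem ShiftMeasure.eq_of_divergence_nonpos (h : RegularKernel 𝒬 N₀ u) (hμ : ShiftMeasure N₀ j μ)
    (hsupp : ∀ b, μ b ≠ 0 ↔ b ∈ bounded 𝒳 N₀ (j + 1) ∧ AdmissibleUpTo 𝒬 (j + 1) b)
    (hν : ShiftMeasure N₀ j ν) (hac : ∀ b, cond N₀ j μ b = 0 → ν b = 0)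
    (hdiv : divergence N₀ j (cond N₀ j μ) ν ≤ 0) : ν = μ := by
  set q := cond N₀ j μ with hqdef
  have hq0 : ∀ b, 0 ≤ q b := cond_nonneg hμ.nonneg
  have hνq : ∀ b ∈ bounded 𝒳 N₀ (j + 1), ν b = push N₀ j ν (trunc j b) * q b := fun b hb =>
    PTree.eq_of_divergence_nonpos hν.nonneg hq0 hac push_cond_le_one hdiv hb
  set m := push N₀ j μ with hm
  set p := push N₀ j ν with hp
  have hm0 : ∀ a, 0 ≤ m a := push_nonneg hμ.nonneg
  have hp0 : ∀ a, m a = 0 → p a = 0 := fun a ha => by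
    by_contra hne
    obtain ⟨b, hb, rfl, hbν⟩ := exists_of_push_ne_zero hne
    refine hbν (hac b ?_)
    rw [hqdef, cond, ← hm, ha, div_zero]
  have hmsum : ∑ a ∈ bounded 𝒳 N₀ j, m a = 1 := (sum_push μ).trans hμ.total
  have hpsum : ∑ a ∈ bounded 𝒳 N₀ j, p a = 1 := (sum_push ν).trans hν.total
  obtain ⟨a₀, ha₀, hne₀⟩ := Finset.exists_ne_zero_of_sum_ne_zero (hmsum.trans_ne one_ne_zero)
  obtain ⟨a, ha, hmin⟩ := Finset.exists_min_image ((bounded 𝒳 N₀ j).filter fun a => m a ≠ 0)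
    (fun a => p a / m a) ⟨a₀, Finset.mem_filter.2 ⟨ha₀, hne₀⟩⟩
  rw [Finset.mem_filter] at ha
  set c := p a / m a with hc
  obtain ⟨b, hb, hba, hbμ⟩ := exists_of_push_ne_zero ha.2
  obtain ⟨s, hs, hsb⟩ := h.exists_admissible_of_upTo ((hsupp b).1 hbμ).2
  have hsa : trunc j s = a := by
    rw [← hba, ← trunc_trunc (Nat.le_succ j) b, ← hsb, trunc_trunc (Nat.le_succ j)]
  have hv := eq_zero_of_eigen (q := q) (v := fun a => p a - c * m a) h
    (fun b => hμ.cond_ne_zero.trans (hsupp b)) hq0 (fun a' ha' => ?_) (fun a' ha' => ?_) hs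
    (by rw [hsa, hc, div_mul_cancel₀ _ ha.2, sub_self])
  · have hc1 : c = 1 := by
      have : ∑ a ∈ bounded 𝒳 N₀ j, (p a - c * m a) = 0 := Finset.sum_eq_zero hv
      rw [Finset.sum_sub_distrib, ← Finset.mul_sum, hmsum, hpsum] at this
      linarith
    ext b
    by_cases hb : b ∈ bounded 𝒳 N₀ (j + 1)
    · have := hv (trunc j b) (trunc_mem_bounded j (mem_bounded.1 hb).2)
      rw [hc1, one_mul, sub_eq_zero] at this
      rw [hνq b hb, this, mul_comm, hμ.cond_mul_push]
    · rw [hν.supp b hb, hμ.supp b hb]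
  · by_cases hma : m a' = 0
    · simp [hma, hp0 a' hma]
    · have := hmin a' (Finset.mem_filter.2 ⟨ha', hma⟩)
      rw [le_div_iff₀ (lt_of_le_of_ne (hm0 a') (Ne.symm hma))] at this
      exact sub_nonneg.2 this
  · rw [hp, hν.shift, hm, hμ.shift, Finset.mul_sum, ← Finset.sum_sub_distrib]
    refine Finset.sum_congr rfl fun b hb => ?_
    rw [← hm, ← hp, sub_mul, ← hνq b hb, mul_assoc, mul_comm (m _), hm, hqdef, hμ.cond_mul_push]
    ring

end Uniqueness

section LastProb

variable {𝒳 : Type*} {𝒬 : 𝒳 → List 𝒳 → ℝ} {N₀ j : ℕ}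

theorem law_le_one (h0 : ∀ a c, 0 ≤ 𝒬 a c) (h1 : ∀ a, HasSum (𝒬 a) 1) (i : ℕ) (t : PTree 𝒳) :
    law 𝒬 i t ≤ 1 := by
  classical
  exact (le_fiberSum root (law 𝒬 i) t).trans (fiberSum_law (tsum_ofReal_kernel h0 h1) i _).le

theorem ofReal_weight_ne_zero (h0 : ∀ a c, 0 ≤ 𝒬 a c) {μ0 : 𝒳 → ℝ} {t : PTree 𝒳}
    (h : ENNReal.ofReal (mgwWeight μ0 𝒬 t) ≠ 0) : 0 < μ0 t.root ∧ Admissible 𝒬 t := by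
  rw [mgwWeight, ENNReal.ofReal_ne_zero_iff] at h
  have hnn : ∀ x ∈ t.subtrees.map fun s => 𝒬 s.root s.childLabels, 0 ≤ x := fun x hx => by
    obtain ⟨s, -, rfl⟩ := List.mem_map.1 hx
    exact h0 _ _
  have h1 := pos_of_mul_pos_left h (List.prod_nonneg hnn)
  refine ⟨h1, fun s hs => ?_⟩
  exact (list_prod_pos_iff hnn).1 ((pos_iff_pos_of_mul_pos h).1 h1) _ (List.mem_map.2 ⟨s, hs, rfl⟩)

variable [Finite 𝒳]

/-- The conditional probability of a tree of height at most `j + 1` given its first `j`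
generations. -/
noncomputable def lastProb (𝒬 : 𝒳 → List 𝒳 → ℝ) (N₀ j : ℕ) (b : PTree 𝒳) : ℝ :=
  if b ∈ bounded 𝒳 N₀ (j + 1) then levelProd (offspringProb 𝒬) j b else 0

theorem lastProb_of_mem {b : PTree 𝒳} (hb : b ∈ bounded 𝒳 N₀ (j + 1)) :
    lastProb 𝒬 N₀ j b = levelProd (offspringProb 𝒬) j b := if_pos hb

theorem lastProb_of_notMem {b : PTree 𝒳} (hb : b ∉ bounded 𝒳 N₀ (j + 1)) :
    lastProb 𝒬 N₀ j b = 0 := if_neg hb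

theorem lastProb_nonneg (h0 : ∀ a c, 0 ≤ 𝒬 a c) (b : PTree 𝒳) : 0 ≤ lastProb 𝒬 N₀ j b := by
  rw [lastProb]
  split_ifs
  exacts [levelProd_nonneg h0 j b, le_rfl]

theorem ofReal_lastProb (h0 : ∀ a c, 0 ≤ 𝒬 a c) (hb : BoundedOffspring 𝒬 N₀) {b : PTree 𝒳}
    (h : trunc j b ∈ bounded 𝒳 N₀ j) :
    ENNReal.ofReal (lastProb 𝒬 N₀ j b) = lastLaw 𝒬 j b := by
  rw [lastLaw_eq h0, lastProb]
  by_cases ht : trunc (j + 1) b = b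
  · rw [if_pos ht]
    split_ifs with hmem
    · rfl
    · rw [ENNReal.ofReal_zero, eq_comm, ENNReal.ofReal_eq_zero]
      by_contra! hpos
      refine hmem (mem_bounded.2 ⟨ht, maxDeg_le_of_atDepth ht (mem_bounded.1 h).2 fun w hw => ?_⟩)
      have := hb w.root w.childLabels fun hw0 =>
        hpos.ne' (List.prod_eq_zero (List.mem_map.2 ⟨w, hw, hw0⟩))
      simpa [childLabels] using this
  · rw [if_neg ht, if_neg fun hmem => ht (mem_bounded.1 hmem).1, ENNReal.ofReal_zero]

theorem push_lastProb (h0 : ∀ a c, 0 ≤ 𝒬 a c) (h1 : ∀ a, HasSum (𝒬 a) 1)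
    (hb : BoundedOffspring 𝒬 N₀) {a : PTree 𝒳} (ha : a ∈ bounded 𝒳 N₀ j) :
    push N₀ j (lastProb 𝒬 N₀ j) a = 1 := by
  rw [← ENNReal.ofReal_eq_one, ← fiberSum_trunc_ofReal (lastProb_nonneg h0)
    fun b hb => lastProb_of_notMem hb, fiberSum_congr (g' := lastLaw 𝒬 j) fun b hba =>
      ofReal_lastProb h0 hb (by rwa [hba]),
    fiberSum_lastLaw (tsum_ofReal_kernel h0 h1) j (mem_bounded.1 ha).1]

theorem push_of_notMem (r : PTree 𝒳 → ℝ) {a : PTree 𝒳} (ha : a ∉ bounded 𝒳 N₀ j) :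
    push N₀ j r a = 0 :=
  Finset.sum_eq_zero fun b hb => if_neg fun hba : trunc j b = a =>
    ha (hba ▸ trunc_mem_bounded j (mem_bounded.1 hb).2)

theorem push_lastProb_le_one (h0 : ∀ a c, 0 ≤ 𝒬 a c) (h1 : ∀ a, HasSum (𝒬 a) 1)
    (hb : BoundedOffspring 𝒬 N₀) (a : PTree 𝒳) : push N₀ j (lastProb 𝒬 N₀ j) a ≤ 1 := by
  by_cases ha : a ∈ bounded 𝒳 N₀ j
  · exact (push_lastProb h0 h1 hb ha).le
  · exact (push_of_notMem _ ha).le.trans zero_le_one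

theorem ofReal_mgwWeight (h0 : ∀ a c, 0 ≤ 𝒬 a c) (hb : BoundedOffspring 𝒬 N₀) {μ0 : 𝒳 → ℝ}
    (hμ0 : ∀ a, 0 ≤ μ0 a) {t : PTree 𝒳} (ht : t.maxDeg ≤ N₀) :
    ENNReal.ofReal (mgwWeight μ0 𝒬 t) = ENNReal.ofReal (μ0 t.root) * law 𝒬 j (trunc j t) *
      treeWeight j (fun b => ENNReal.ofReal (lastProb 𝒬 N₀ j b)) t := by
  rw [mgwWeight, ENNReal.ofReal_mul (hμ0 _), ofReal_prod_subtrees h0 j, mul_assoc, treeWeight,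
    treeWeight, List.map_congr_left fun s hs => ?_]
  rw [ofReal_lastProb h0 hb]
  rw [trunc_trunc (Nat.le_succ j)]
  exact trunc_mem_bounded_of_mem_subtrees ht j hs

theorem ofReal_mgwWeight_le (h0 : ∀ a c, 0 ≤ 𝒬 a c) (h1 : ∀ a, HasSum (𝒬 a) 1)
    (hb : BoundedOffspring 𝒬 N₀) {μ0 : 𝒳 → ℝ} (hμ0 : ∀ a, 0 ≤ μ0 a) (hμ1 : ∀ a, μ0 a ≤ 1)
    (t : PTree 𝒳) : ENNReal.ofReal (mgwWeight μ0 𝒬 t) ≤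
      treeWeight j (fun b => ENNReal.ofReal (lastProb 𝒬 N₀ j b)) t := by
  by_cases h : ENNReal.ofReal (mgwWeight μ0 𝒬 t) = 0
  · simp [h]
  rw [ofReal_mgwWeight (j := j) h0 hb hμ0 ((ofReal_weight_ne_zero h0 h).2.maxDeg_le hb)]
  exact mul_le_of_le_one_left'
    (mul_le_one' (ENNReal.ofReal_le_one.2 (hμ1 _)) (law_le_one h0 h1 _ _))

end LastProb

theorem ShiftMeasure.admissibleUpTo {𝒳 : Type*} [Finite 𝒳] {𝒬 : 𝒳 → List 𝒳 → ℝ} {N₀ j : ℕ}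
    {ν : PTree 𝒳 → ℝ} (h0 : ∀ a c, 0 ≤ 𝒬 a c) (hν : ShiftMeasure N₀ j ν)
    (hac : ∀ b, lastProb 𝒬 N₀ j b = 0 → ν b = 0) {b : PTree 𝒳} (hb : ν b ≠ 0) :
    AdmissibleUpTo 𝒬 (j + 1) b := by
  suffices H : ∀ d i, i + d = j → ∀ b, ν b ≠ 0 → 0 < levelProd (offspringProb 𝒬) i b from
    fun i hi => H (j - i) i (Nat.add_sub_cancel' (Nat.le_of_lt_succ hi)) b hb
  intro d
  induction d with
  | zero =>
    intro i hi b hb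
    obtain rfl : i = j := hi
    refine lt_of_le_of_ne (levelProd_nonneg h0 _ _) fun heq => hb (hac b ?_)
    rw [lastProb_of_mem (hν.mem hb)]
    exact heq.symm
  | succ d ih =>
    intro i hi b hb
    obtain ⟨b', hb', hne⟩ := Finset.exists_ne_zero_of_sum_ne_zero
      ((hν.shift (trunc j b)).symm.trans_ne (hν.push_pos hb).ne')
    have hmem : trunc j b ∈ b'.children :=
      List.count_pos_iff.1 (Nat.pos_of_ne_zero (by exact_mod_cast left_ne_zero_of_mul hne))
    have hpos := ih (i + 1) (by omega) b' (right_ne_zero_of_mul hne)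
    rw [← levelProd_trunc _ (show i < j by omega) fun m t => offspringProb_trunc_succ m t]
    rw [← node_root_children b', levelProd_succ, list_prod_pos_iff fun x hx => ?_] at hpos
    · exact hpos _ (List.mem_map_of_mem hmem)
    · obtain ⟨s, -, rfl⟩ := List.mem_map.1 hx
      exact levelProd_nonneg h0 _ _

theorem mul_log_sub_log_add_le {x₁ x₂ y₁ y₂ θ₁ θ₂ : ℝ} (hx₁ : 0 ≤ x₁) (hx₂ : 0 ≤ x₂) (hy₁ : 0 ≤ y₁)
    (hy₂ : 0 ≤ y₂) (h₁ : y₁ = 0 → x₁ = 0) (h₂ : y₂ = 0 → x₂ = 0) (hθ₁ : 0 ≤ θ₁) (hθ₂ : 0 ≤ θ₂) :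
    (θ₁ * x₁ + θ₂ * x₂) * (Real.log (θ₁ * x₁ + θ₂ * x₂) - Real.log (θ₁ * y₁ + θ₂ * y₂)) ≤
      θ₁ * (x₁ * (Real.log x₁ - Real.log y₁)) + θ₂ * (x₂ * (Real.log x₂ - Real.log y₂)) := by
  have n₁ := mul_nonneg hθ₁ hx₁
  have n₂ := mul_nonneg hθ₂ hx₂
  have m₁ := mul_nonneg hθ₁ hy₁
  have m₂ := mul_nonneg hθ₂ hy₂
  rcases (add_nonneg n₁ n₂).eq_or_lt with hX | hX
  · obtain ⟨e₁, e₂⟩ := (add_eq_zero_iff_of_nonneg n₁ n₂).1 hX.symm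
    rw [← mul_assoc, ← mul_assoc, e₁, e₂]
    simp
  have hY : 0 < θ₁ * y₁ + θ₂ * y₂ := by
    refine lt_of_le_of_ne (add_nonneg m₁ m₂) fun hY => hX.ne' ?_
    obtain ⟨e₁, e₂⟩ := (add_eq_zero_iff_of_nonneg m₁ m₂).1 hY.symm
    have f₁ : θ₁ * x₁ = 0 := (mul_eq_zero.1 e₁).elim (by simp +contextual)
      (by simp +contextual [h₁])
    have f₂ : θ₂ * x₂ = 0 := (mul_eq_zero.1 e₂).elim (by simp +contextual)
      (by simp +contextual [h₂])
    rw [f₁, f₂, add_zero]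
  set X := θ₁ * x₁ + θ₂ * x₂ with hXdef
  set Y := θ₁ * y₁ + θ₂ * y₂ with hYdef
  have key : ∀ {x y : ℝ}, 0 ≤ x → 0 ≤ y → (y = 0 → x = 0) →
      x * (Real.log X - Real.log Y) + (x - y * (X / Y)) ≤ x * (Real.log x - Real.log y) := by
    intro x y hx hy h
    have hXY := div_pos hX hY
    rcases hx.eq_or_lt with rfl | hx
    · simpa using mul_nonneg hy hXY.le
    have hy : y ≠ 0 := fun h0 => hx.ne' (h h0)
    have := (sub_le_mul_log_sub_log hx.le (mul_nonneg ‹0 ≤ y› hXY.le)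
      fun h0 => absurd h0 (mul_ne_zero hy hXY.ne')).1
    rw [Real.log_mul hy hXY.ne', Real.log_div hX.ne' hY.ne'] at this
    linarith
  have k₁ := mul_le_mul_of_nonneg_left (key hx₁ hy₁ h₁) hθ₁
  have k₂ := mul_le_mul_of_nonneg_left (key hx₂ hy₂ h₂) hθ₂
  have hc : θ₁ * (x₁ - y₁ * (X / Y)) + θ₂ * (x₂ - y₂ * (X / Y)) = 0 := by
    have : Y * (X / Y) = X := mul_div_cancel₀ _ hY.ne'
    linear_combination -this
  rw [hXdef, add_mul]
  linarith

section Mix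

variable {𝒳 : Type*} [Finite 𝒳] {N j : ℕ} {r μ ν : PTree 𝒳 → ℝ} {θ₁ θ₂ : ℝ}

theorem push_mix (a : PTree 𝒳) : push N j (fun b => θ₁ * μ b + θ₂ * ν b) a =
    θ₁ * push N j μ a + θ₂ * push N j ν a := by
  rw [push, push, push, Finset.mul_sum, Finset.mul_sum, ← Finset.sum_add_distrib]
  exact Finset.sum_congr rfl fun b _ => by split_ifs <;> simp

theorem ShiftMeasure.mix (hμ : ShiftMeasure N j μ) (hν : ShiftMeasure N j ν) (h₁ : 0 ≤ θ₁)
    (h₂ : 0 ≤ θ₂) (h : θ₁ + θ₂ = 1) : ShiftMeasure N j (fun b => θ₁ * μ b + θ₂ * ν b) where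
  nonneg b := add_nonneg (mul_nonneg h₁ (hμ.nonneg b)) (mul_nonneg h₂ (hν.nonneg b))
  supp b hb := by simp [hμ.supp b hb, hν.supp b hb]
  total := by
    rw [Finset.sum_add_distrib, ← Finset.mul_sum, ← Finset.mul_sum, hμ.total, hν.total, mul_one,
      mul_one, h]
  shift a := by
    rw [push_mix, hμ.shift, hν.shift, Finset.mul_sum, Finset.mul_sum, ← Finset.sum_add_distrib]
    exact Finset.sum_congr rfl fun b _ => by ring

theorem divergence_mix_le (hr : ∀ b, 0 ≤ r b) (hμ : ∀ b, 0 ≤ μ b) (hν : ∀ b, 0 ≤ ν b)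
    (hμr : ∀ b, r b = 0 → μ b = 0) (hνr : ∀ b, r b = 0 → ν b = 0) (h₁ : 0 ≤ θ₁) (h₂ : 0 ≤ θ₂) :
    divergence N j r (fun b => θ₁ * μ b + θ₂ * ν b) ≤
      θ₁ * divergence N j r μ + θ₂ * divergence N j r ν := by
  rw [divergence_eq_mul hμ hμr, divergence_eq_mul hν hνr, divergence_eq_mul
    (fun b => add_nonneg (mul_nonneg h₁ (hμ b)) (mul_nonneg h₂ (hν b)))
    fun b hb => by simp [hμr b hb, hνr b hb], Finset.mul_sum, Finset.mul_sum,
    ← Finset.sum_add_distrib]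
  refine Finset.sum_le_sum fun b hb => ?_
  have := mul_log_sub_log_add_le (hμ b) (hν b)
    (mul_nonneg (push_nonneg (N := N) (j := j) hμ _) (hr b))
    (mul_nonneg (push_nonneg (N := N) (j := j) hν _) (hr b)) (push_mul_eq_zero hμ hμr hb)
    (push_mul_eq_zero hν hνr hb) h₁ h₂
  rwa [push_mix, add_mul _ _ (r b), mul_assoc θ₁, mul_assoc θ₂]

end Mix

section Tilt

variable {𝒳 : Type*} [Finite 𝒳] {N j : ℕ} {r : PTree 𝒳 → ℝ}

theorem exists_pos_le_divergence (hr0 : ∀ b, 0 ≤ r b) (hr : ∀ a, push N j r a ≤ 1)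
    {F : Set (PTree 𝒳 → ℝ)} (hF : IsClosed F)
    (h : ∀ ν ∈ F, ShiftMeasure N j ν → (∀ b, r b = 0 → ν b = 0) → divergence N j r ν ≠ 0) :
    ∃ η > 0, ∀ ν ∈ F, ShiftMeasure N j ν → (∀ b, r b = 0 → ν b = 0) →
      η ≤ divergence N j r ν := by
  set K := probVec 𝒳 N (j + 1) ∩
    (F ∩ ({ν | ∀ b, r b = 0 → ν b = 0} ∩ {ν | shiftDefect N j ν = 0})) with hK
  have hKmem : ∀ ν, ν ∈ K ↔ ν ∈ F ∧ ShiftMeasure N j ν ∧ ∀ b, r b = 0 → ν b = 0 := fun ν =>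
    ⟨fun hν => ⟨hν.2.1, shiftMeasure_of_shiftDefect hν.1 hν.2.2.2, hν.2.2.1⟩,
      fun hν => ⟨hν.2.1.mem_probVec, hν.1, hν.2.2, hν.2.1.shiftDefect_eq_zero⟩⟩
  have hc : IsCompact K := by
    refine (isCompact_probVec _).inter_right (hF.inter (IsClosed.inter ?_
      (isClosed_eq continuous_shiftDefect continuous_const)))
    rw [Set.ofPred_forall]
    refine isClosed_iInter fun b => ?_
    by_cases hb : r b = 0
    · simpa [hb] using isClosed_eq (continuous_apply b) continuous_const
    · simp [hb]
  rcases K.eq_empty_or_nonempty with he | hne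
  · exact ⟨1, one_pos, fun ν h1 h2 h3 => absurd ((hKmem ν).2 ⟨h1, h2, h3⟩) (by simp [he])⟩
  · obtain ⟨ν₀, hν₀, hmin⟩ := hc.exists_isMinOn hne (continuous_divergence (r := r)).continuousOn
    obtain ⟨h1, h2, h3⟩ := (hKmem ν₀).1 hν₀
    exact ⟨divergence N j r ν₀,
      lt_of_le_of_ne (divergence_nonneg h2.nonneg hr0 h3 hr) (h ν₀ h1 h2 h3).symm,
      fun ν g1 g2 g3 => hmin ((hKmem ν).2 ⟨g1, g2, g3⟩)⟩

theorem treeWeight_le_exp_mul {q : PTree 𝒳 → ℝ} {t : PTree 𝒳} {c : ℝ} (ht : t.maxDeg ≤ N)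
    (hq0 : ∀ b, 0 ≤ q b) (hr0 : ∀ b, 0 ≤ r b) (hq : ∀ s ∈ t.subtrees, q (trunc (j + 1) s) ≠ 0)
    (hr : ∀ s ∈ t.subtrees, r (trunc (j + 1) s) ≠ 0)
    (hc : ∑ b ∈ bounded 𝒳 N (j + 1), empK (j + 1) t b * (Real.log (q b) - Real.log (r b)) ≤ c) :
    treeWeight j (fun b => ENNReal.ofReal (q b)) t ≤
      ENNReal.ofReal (Real.exp (t.size * c)) * treeWeight j (fun b => ENNReal.ofReal (r b)) t := by
  rw [treeWeight_eq_exp ht hq0 hq, treeWeight_eq_exp ht hr0 hr,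
    ← ENNReal.ofReal_mul (Real.exp_pos _).le, ← Real.exp_add, ← mul_add]
  gcongr
  simp only [mul_sub, Finset.sum_sub_distrib] at hc
  linarith

theorem eventually_exp_le {a b c : ℝ} (h : a < b) (hc : 0 < c) :
    ∀ᶠ n : ℕ in atTop, Real.exp (-(n * b)) ≤ c * Real.exp (-(n * a)) := by
  filter_upwards [eventually_poly_le_exp 0 c⁻¹ h] with n hn
  rw [pow_zero, one_mul, inv_mul_le_iff₀ hc] at hn
  exact hn

theorem exists_ofReal_le {κ : ℝ≥0∞} (h : κ ≠ 0) : ∃ c : ℝ, 0 < c ∧ ENNReal.ofReal c ≤ κ := by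
  obtain ⟨c, hc, hcκ⟩ := ENNReal.lt_iff_exists_nnreal_btwn.1 (pos_iff_ne_zero.2 h)
  exact ⟨c, by exact_mod_cast hc, by simpa using hcκ.le⟩

end Tilt

theorem lastProb_ne_zero {𝒳 : Type*} [Finite 𝒳] {𝒬 : 𝒳 → List 𝒳 → ℝ} {N₀ j : ℕ} {b : PTree 𝒳}
    (hb : b ∈ bounded 𝒳 N₀ (j + 1))
    (ha : AdmissibleUpTo 𝒬 (j + 1) b) : lastProb 𝒬 N₀ j b ≠ 0 := by
  rw [lastProb_of_mem hb]
  exact (ha j j.lt_succ_self).ne'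

section LowerBound

variable {𝒳 : Type*} [Fintype 𝒳] [DecidableEq 𝒳] {𝒬 : 𝒳 → List 𝒳 → ℝ} {N₀ j : ℕ}
  {u : 𝒳 → ℝ≥0∞} {μ : PTree 𝒳 → ℝ} {μ0 : 𝒳 → ℝ}

open Classical in
/-- The weight of the trees of size `n` whose empirical offspring measure lies in `U`. -/
noncomputable def eventMass (w : PTree 𝒳 → ℝ) (k n : ℕ) (U : Set (PTree 𝒳 → ℝ)) : ℝ≥0∞ :=
  ∑' t : PTree 𝒳, if t.size = n ∧ empK k t ∈ U then ENNReal.ofReal (w t) else 0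

open Classical in
theorem sizedMass_le_add (h : RegularKernel 𝒬 N₀ u) (hμ : ShiftMeasure N₀ j μ)
    (hsupp : ∀ b, μ b ≠ 0 ↔ b ∈ bounded 𝒳 N₀ (j + 1) ∧ AdmissibleUpTo 𝒬 (j + 1) b)
    (hμ0 : ∀ a, 0 ≤ μ0 a) {U F : Set (PTree 𝒳 → ℝ)} {c : ℝ} (hUF : ∀ ν ∉ F, ν ∈ U ∧
      ∑ b ∈ bounded 𝒳 N₀ (j + 1),
        ν b * (Real.log (cond N₀ j μ b) - Real.log (lastProb 𝒬 N₀ j b)) ≤ c)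
    (a : PTree 𝒳) (n : ℕ) :
    ENNReal.ofReal (μ0 a.root) * law 𝒬 j a *
        sizedMass j (fun b => ENNReal.ofReal (cond N₀ j μ b)) a n ≤
      ENNReal.ofReal (Real.exp (n * c)) * eventMass (mgwWeight μ0 𝒬) (j + 1) n U +
        ENNReal.ofReal (μ0 a.root) * law 𝒬 j a * ∑' t, if t.size = n ∧ empK (j + 1) t ∈ F then
            treeWeight j (fun b => ENNReal.ofReal (cond N₀ j μ b)) t else 0 := by
  rw [sizedMass, fiberSum, eventMass, ← ENNReal.tsum_mul_left, ← ENNReal.tsum_mul_left,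
    ← ENNReal.tsum_mul_left, ← ENNReal.tsum_add]
  refine ENNReal.tsum_le_tsum fun t => ?_
  by_cases ht : (trunc j t, t.size) = (a, n)
  swap
  · simp [ht]
  obtain ⟨rfl, rfl⟩ := Prod.mk.inj ht
  rw [if_pos rfl]
  by_cases hmem : empK (j + 1) t ∈ F
  · rw [if_pos (show t.size = t.size ∧ empK (j + 1) t ∈ F from ⟨rfl, hmem⟩)]
    exact le_add_self
  · obtain ⟨hmU, hmc⟩ := hUF _ hmem
    refine le_add_right ?_
    rw [if_pos ⟨rfl, hmU⟩]
    by_cases h0 : treeWeight j (fun b => ENNReal.ofReal (cond N₀ j μ b)) t = 0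
    · simp [h0]
    have hs : ∀ s ∈ t.subtrees, μ (trunc (j + 1) s) ≠ 0 := fun s hs => by
      have := mem_of_treeWeight_ne_zero h0 hs
      rw [ENNReal.ofReal_ne_zero_iff] at this
      exact hμ.cond_ne_zero.1 this.ne'
    have hmax : t.maxDeg ≤ N₀ := maxDeg_le_of_treeWeight_ne_zero
      (fun b hb => by simp [PTree.cond, hμ.supp b hb]) h0
    rw [ofReal_mgwWeight (j := j) h.nonneg h.bounded hμ0 hmax, root_trunc, mul_left_comm]
    refine mul_le_mul_right (treeWeight_le_exp_mul hmax (cond_nonneg hμ.nonneg)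
      (lastProb_nonneg h.nonneg) (fun s hs' => hμ.cond_ne_zero.2 (hs s hs')) (fun s hs' => ?_)
      hmc) _
    exact lastProb_ne_zero ((hsupp _).1 (hs s hs')).1 ((hsupp _).1 (hs s hs')).2

theorem eventually_le_eventMass_of_type (h : RegularKernel 𝒬 N₀ u) (hμ : ShiftMeasure N₀ j μ)
    (hsupp : ∀ b, μ b ≠ 0 ↔ b ∈ bounded 𝒳 N₀ (j + 1) ∧ AdmissibleUpTo 𝒬 (j + 1) b)
    (hμ0 : ∀ a, 0 ≤ μ0 a) {U : Set (PTree 𝒳 → ℝ)} (hU : IsOpen U) (hμU : μ ∈ U) {ε : ℝ} (hε : 0 < ε)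
    {t₀ : PTree 𝒳} (ht₀ : Admissible 𝒬 t₀) (hd : atDepth j t₀ ≠ []) (hroot : 0 < μ0 t₀.root) :
    ∀ᶠ n : ℕ in atTop,
      sizedMass j (fun b => ENNReal.ofReal (cond N₀ j μ b)) (trunc j t₀) n ≠ 0 →
        ENNReal.ofReal (Real.exp (-(n * (divergence N₀ j (lastProb 𝒬 N₀ j) μ + ε)))) ≤
          eventMass (mgwWeight μ0 𝒬) (j + 1) n U := by
  set J := divergence N₀ j (lastProb 𝒬 N₀ j) μ with hJ
  set V : Set (PTree 𝒳 → ℝ) := U ∩ {ν | ∑ b ∈ bounded 𝒳 N₀ (j + 1),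
    ν b * (Real.log (cond N₀ j μ b) - Real.log (lastProb 𝒬 N₀ j b)) < J + ε / 2} with hV
  have hVo : IsOpen V := hU.inter (isOpen_lt (by fun_prop) continuous_const)
  have hμV : μ ∈ V := ⟨hμU, by
    rw [Set.mem_ofPred_eq, ← divergence_eq_cond hμ.nonneg]
    linarith⟩
  have hq0 : ∀ b, 0 ≤ cond N₀ j μ b := cond_nonneg hμ.nonneg
  obtain ⟨η, hη, hηle⟩ := exists_pos_le_divergence (F := Vᶜ) hq0 push_cond_le_one hVo.isClosed_compl
    fun ν hν h1 h2 h3 => hν (hμ.eq_of_divergence_nonpos h hsupp h1 h2 h3.le ▸ hμV)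
  have hF := eventually_tsum_treeWeight_le hq0 (fun b hb => by simp [PTree.cond, hμ.supp b hb])
    hVo.isClosed_compl (half_lt_self hη) hηle
  set ε' := min (ε / 4) (η / 4) with hε'
  have hε'pos : 0 < ε' := lt_min (by positivity) (by positivity)
  have hε'1 : ε' < ε / 2 := (min_le_left _ _).trans_lt (by linarith)
  have hε'2 : ε' < η / 2 := (min_le_right _ _).trans_lt (by linarith)
  obtain ⟨κ, hκ, hκle⟩ := exists_mul_pow_le_sizedMass h hμ hsupp ht₀ hd
    (r := ENNReal.ofReal (Real.exp (-ε'))) (ENNReal.ofReal_pos.2 (Real.exp_pos _)).ne'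
    (ENNReal.ofReal_lt_one.2 (Real.exp_lt_one_iff.2 (by linarith)))
  obtain ⟨κ', hκ', hκκ⟩ := exists_ofReal_le hκ
  set w := ENNReal.ofReal (μ0 (trunc j t₀).root) * law 𝒬 j (trunc j t₀) with hw
  have hw0 : w ≠ 0 := mul_ne_zero (by rwa [root_trunc, ENNReal.ofReal_ne_zero_iff])
    ((law_ne_zero_iff h.nonneg).2 ⟨trunc_idem _ _, (admissibleUpTo_trunc le_rfl).2 (ht₀.upTo j)⟩)
  have hwt : w ≠ ∞ := ENNReal.mul_ne_top ENNReal.ofReal_ne_top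
    (ne_top_of_le_ne_top ENNReal.one_ne_top (law_le_one h.nonneg h.hasSum _ _))
  obtain ⟨w', hw', hww⟩ := exists_ofReal_le hw0
  filter_upwards [hF, eventually_exp_le hε'2 (half_pos hκ'),
    eventually_exp_le hε'1 (mul_pos hw' (half_pos hκ'))] with n h1 h2 h3 hne
  have h4 := sizedMass_le_add h hμ hsupp hμ0 (F := Vᶜ) (fun ν hν =>
    ⟨(Set.notMem_compl_iff.1 hν).1, (Set.notMem_compl_iff.1 hν).2.le⟩) (trunc j t₀) n
  set e := ENNReal.ofReal (κ' / 2 * Real.exp (-(n * ε'))) with he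
  have h5 : e + e ≤ sizedMass j (fun b => ENNReal.ofReal (cond N₀ j μ b)) (trunc j t₀) n := by
    refine le_trans (le_trans (le_of_eq ?_) (mul_le_mul_left hκκ _)) (hκle n hne)
    rw [he, ← ENNReal.ofReal_add (by positivity) (by positivity),
      ← ENNReal.ofReal_pow (Real.exp_pos _).le, ← ENNReal.ofReal_mul hκ'.le, ← Real.exp_nat_mul]
    congr 1
    rw [mul_neg]
    ring
  have h6 : w * e + w * e ≤
      ENNReal.ofReal (Real.exp (n * (J + ε / 2))) * eventMass (mgwWeight μ0 𝒬) (j + 1) n U +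
        w * e := by
    rw [← mul_add]
    exact (mul_le_mul_right h5 w).trans (h4.trans (add_le_add_right (mul_le_mul_right
      (h1.trans (ENNReal.ofReal_le_ofReal h2)) w) _))
  have h7 := ENNReal.le_of_add_le_add_right (ENNReal.mul_ne_top hwt ENNReal.ofReal_ne_top) h6
  have hexp : ENNReal.ofReal (Real.exp (n * (J + ε / 2))) ≠ 0 :=
    (ENNReal.ofReal_pos.2 (Real.exp_pos _)).ne'
  rw [← ENNReal.mul_le_mul_iff_right hexp ENNReal.ofReal_ne_top]
  refine le_trans ?_ h7
  refine le_trans ?_ (mul_le_mul_left hww e)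
  rw [he, ← ENNReal.ofReal_mul hw'.le, ← ENNReal.ofReal_mul (Real.exp_pos _).le, ← mul_assoc,
    ← Real.exp_add]
  refine ENNReal.ofReal_le_ofReal (le_trans (le_of_eq ?_) h3)
  congr 1
  ring

end LowerBound

theorem exists_of_mem_sizeSupport {𝒳 : Type*} {w : PTree 𝒳 → ℝ} {n : ℕ} (hn : n ∈ sizeSupport w) :
    ∃ t : PTree 𝒳, t.size = n ∧ ENNReal.ofReal (w t) ≠ 0 := by
  by_contra! hcon
  refine (show 0 < treeMass w n from hn).ne' (ENNReal.tsum_eq_zero.2 fun t => ?_)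
  split_ifs with hs
  exacts [hcon t hs, rfl]

theorem eventMass_univ {𝒳 : Type*} (w : PTree 𝒳 → ℝ) (k n : ℕ) :
    eventMass w k n Set.univ = treeMass w n := by
  simp [eventMass, treeMass]

section LowerBound

variable {𝒳 : Type*} [Fintype 𝒳] [DecidableEq 𝒳] {𝒬 : 𝒳 → List 𝒳 → ℝ} {N₀ j : ℕ}
  {u : 𝒳 → ℝ≥0∞} {μ : PTree 𝒳 → ℝ} {μ0 : 𝒳 → ℝ}

theorem stationary_eq_zero (h : RegularKernel 𝒬 N₀ u) {b : PTree 𝒳}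
    (hb : lastProb 𝒬 N₀ j b = 0) : stationary 𝒬 u j b = 0 := by
  by_contra hne
  obtain ⟨h1, h2⟩ := (stationary_ne_zero_iff h).1 hne
  exact lastProb_ne_zero h1 h2 hb

theorem eventually_le_eventMass_of_supp (h : RegularKernel 𝒬 N₀ u) (hμ : ShiftMeasure N₀ j μ)
    (hsupp : ∀ b, μ b ≠ 0 ↔ b ∈ bounded 𝒳 N₀ (j + 1) ∧ AdmissibleUpTo 𝒬 (j + 1) b)
    (hμ0 : ∀ a, 0 ≤ μ0 a) {U : Set (PTree 𝒳 → ℝ)} (hU : IsOpen U) (hμU : μ ∈ U) {ε : ℝ}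
    (hε : 0 < ε) :
    ∀ᶠ n : ℕ in atTop ⊓ 𝓟 (sizeSupport (mgwWeight μ0 𝒬)),
      ENNReal.ofReal (Real.exp (-(n * (divergence N₀ j (lastProb 𝒬 N₀ j) μ + ε)))) ≤
        eventMass (mgwWeight μ0 𝒬) (j + 1) n U := by
  rw [eventually_inf_principal]
  have key : ∀ a ∈ bounded 𝒳 N₀ j, ∀ᶠ n : ℕ in atTop, ∀ t : PTree 𝒳, Admissible 𝒬 t →
      atDepth j t ≠ [] → 0 < μ0 t.root → trunc j t = a →
      sizedMass j (fun b => ENNReal.ofReal (cond N₀ j μ b)) a n ≠ 0 →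
        ENNReal.ofReal (Real.exp (-(n * (divergence N₀ j (lastProb 𝒬 N₀ j) μ + ε)))) ≤
          eventMass (mgwWeight μ0 𝒬) (j + 1) n U := by
    intro a _
    by_cases hex : ∃ t : PTree 𝒳, Admissible 𝒬 t ∧ atDepth j t ≠ [] ∧ 0 < μ0 t.root ∧ trunc j t = a
    · obtain ⟨t, h1, h2, h3, rfl⟩ := hex
      filter_upwards [eventually_le_eventMass_of_type h hμ hsupp hμ0 hU hμU hε h1 h2 h3]
        with n hn _ _ _ _ _ using hn
    · exact Eventually.of_forall fun n t h1 h2 h3 h4 => absurd ⟨t, h1, h2, h3, h4⟩ hex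
  filter_upwards [(eventually_all_finset _).2 key,
    eventually_gt_atTop ((bounded 𝒳 N₀ j).sup size)] with n hn hsize hS
  obtain ⟨t, hsz, ht⟩ := exists_of_mem_sizeSupport hS
  obtain ⟨hroot, hadm⟩ := ofReal_weight_ne_zero h.nonneg ht
  have hmem := trunc_mem_bounded j (hadm.maxDeg_le h.bounded)
  refine hn (trunc j t) hmem t hadm (fun hd => ?_) hroot rfl ?_
  · rw [trunc_eq_self_of_atDepth hd] at hmem
    exact (Finset.le_sup (f := size) hmem).not_gt (hsz ▸ hsize)
  · rw [← hsz]
    refine sizedMass_ne_zero (fun s hs => ?_) hadm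
    refine ((cond_nonneg hμ.nonneg _).lt_of_ne' (hμ.cond_ne_zero.2 ((hsupp _).2 ⟨?_, ?_⟩))).ne' ∘
      fun h0 => le_antisymm (ENNReal.ofReal_eq_zero.1 h0) (cond_nonneg hμ.nonneg _)
    · exact trunc_mem_bounded _ (hs.maxDeg_le h.bounded)
    · exact (admissibleUpTo_trunc le_rfl).2 (hs.upTo _)

theorem divergence_stationary (h : RegularKernel 𝒬 N₀ u) :
    divergence N₀ j (lastProb 𝒬 N₀ j) (stationary 𝒬 u j) = 0 := by
  rw [divergence_eq_mul (shiftMeasure_stationary h).nonneg fun b => stationary_eq_zero h]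
  refine Finset.sum_eq_zero fun b hb => ?_
  rw [lastProb_of_mem hb, ← stationary_eq h hb, sub_self, mul_zero]

/-- The exponential lower bound on the weight of the trees whose empirical offspring measure lies
in a neighborhood of a given vector. -/
theorem eventually_le_eventMass (h : RegularKernel 𝒬 N₀ u) (hμ : ShiftMeasure N₀ j μ)
    (hac : ∀ b, lastProb 𝒬 N₀ j b = 0 → μ b = 0)
    (hμ0 : ∀ a, 0 ≤ μ0 a) {U : Set (PTree 𝒳 → ℝ)} (hU : IsOpen U) (hμU : μ ∈ U) {ε : ℝ}
    (hε : 0 < ε) :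
    ∀ᶠ n : ℕ in atTop ⊓ 𝓟 (sizeSupport (mgwWeight μ0 𝒬)),
      ENNReal.ofReal (Real.exp (-(n * (divergence N₀ j (lastProb 𝒬 N₀ j) μ + ε)))) ≤
        eventMass (mgwWeight μ0 𝒬) (j + 1) n U := by
  have hσ := shiftMeasure_stationary (j := j) h
  have hcont : Continuous fun δ : ℝ => fun b => (1 - δ) * μ b + δ * stationary 𝒬 u j b := by
    fun_prop
  have hmem := hcont.continuousAt.eventually_mem (x := 0) (hU.mem_nhds (by simpa using hμU))
  obtain ⟨δ, hδ, hδ0, hδ1⟩ := ((hmem.filter_mono nhdsWithin_le_nhds).and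
    (Ioo_mem_nhdsGT (zero_lt_one' ℝ))).exists
  have hsupp : ∀ b, (1 - δ) * μ b + δ * stationary 𝒬 u j b ≠ 0 ↔
      b ∈ bounded 𝒳 N₀ (j + 1) ∧ AdmissibleUpTo 𝒬 (j + 1) b := by
    intro b
    rw [← stationary_ne_zero_iff h, ne_eq, add_eq_zero_iff_of_nonneg
      (mul_nonneg (sub_nonneg.2 hδ1.le) (hμ.nonneg b)) (mul_nonneg hδ0.le (hσ.nonneg b)),
      mul_eq_zero, mul_eq_zero, or_iff_right (sub_pos.2 hδ1).ne', or_iff_right hδ0.ne', not_and_or,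
      or_iff_right_iff_imp]
    exact fun hb => (stationary_ne_zero_iff h).2 ⟨hμ.mem hb, hμ.admissibleUpTo h.nonneg hac hb⟩
  filter_upwards [eventually_le_eventMass_of_supp h (hμ.mix hσ (sub_nonneg.2 hδ1.le) hδ0.le
    (sub_add_cancel 1 δ)) hsupp hμ0 hU hδ hε] with n hn
  refine le_trans (ENNReal.ofReal_le_ofReal (Real.exp_le_exp.2 (neg_le_neg ?_))) hn
  have h1 := divergence_mix_le (N := N₀) (j := j) (lastProb_nonneg (N₀ := N₀) (j := j) h.nonneg)
    hμ.nonneg hσ.nonneg hac (fun b => stationary_eq_zero h) (sub_nonneg.2 hδ1.le) hδ0.le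
  have h2 := divergence_nonneg (N := N₀) (j := j) hμ.nonneg (lastProb_nonneg h.nonneg) hac
    (push_lastProb_le_one h.nonneg h.hasSum h.bounded)
  rw [divergence_stationary h] at h1
  gcongr
  nlinarith

theorem eventually_le_treeMass (h : RegularKernel 𝒬 N₀ u) (hμ0 : ∀ a, 0 ≤ μ0 a) {ε : ℝ}
    (hε : 0 < ε) :
    ∀ᶠ n : ℕ in atTop ⊓ 𝓟 (sizeSupport (mgwWeight μ0 𝒬)),
      ENNReal.ofReal (Real.exp (-(n * ε))) ≤ treeMass (mgwWeight μ0 𝒬) n := by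
  filter_upwards [eventually_le_eventMass (j := 0) h (shiftMeasure_stationary h)
    (fun b => stationary_eq_zero h) hμ0 isOpen_univ (Set.mem_univ _) hε] with n hn
  rwa [divergence_stationary h, zero_add, eventMass_univ] at hn

end LowerBound

theorem extXK_coe {𝒳 : Type*} {N₀ k : ℕ} (μ : XK 𝒳 N₀ k → ℝ) (b : XK 𝒳 N₀ k) :
    extXK μ b.1 = μ b := dif_pos b.2

section Extension

variable {𝒳 : Type*} [Finite 𝒳] {N₀ k j : ℕ}

theorem mem_bounded_iff_height {b : PTree 𝒳} :
    b ∈ bounded 𝒳 N₀ k ↔ b.height ≤ k ∧ b.maxDeg ≤ N₀ := by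
  rw [mem_bounded, height_le_iff]

theorem hasSum_XK {M : Type*} [AddCommMonoid M] [TopologicalSpace M] (f : PTree 𝒳 → M) :
    HasSum (fun b : XK 𝒳 N₀ k => f b.1) (∑ b ∈ bounded 𝒳 N₀ k, f b) :=
  (Equiv.subtypeEquivRight fun _ => mem_bounded_iff_height.symm :
    XK 𝒳 N₀ k ≃ {b // b ∈ bounded 𝒳 N₀ k}).hasSum_iff.2 (Finset.hasSum (bounded 𝒳 N₀ k) f)

theorem extXK_of_notMem (μ : XK 𝒳 N₀ k → ℝ) {b : PTree 𝒳} (hb : b ∉ bounded 𝒳 N₀ k) :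
    extXK μ b = 0 := dif_neg fun h => hb (mem_bounded_iff_height.2 h)

theorem extXK_restrict {ν : PTree 𝒳 → ℝ} (h : ∀ b, b ∉ bounded 𝒳 N₀ k → ν b = 0) :
    extXK (fun b : XK 𝒳 N₀ k => ν b.1) = ν := by
  funext b
  by_cases hb : b ∈ bounded 𝒳 N₀ k
  · exact extXK_coe _ (⟨b, mem_bounded_iff_height.1 hb⟩ : XK 𝒳 N₀ k)
  · rw [extXK_of_notMem _ hb, h b hb]

theorem mem_probVec_extXK {μ : XK 𝒳 N₀ k → ℝ} :
    extXK μ ∈ probVec 𝒳 N₀ k ↔ (∀ b, 0 ≤ μ b) ∧ HasSum μ 1 := by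
  have h : HasSum μ (∑ b ∈ bounded 𝒳 N₀ k, extXK μ b) := by
    simpa only [extXK_coe] using hasSum_XK (extXK μ) (N₀ := N₀) (k := k)
  refine ⟨fun hμ => ⟨fun b => (hμ.1 b.1).trans_eq (extXK_coe μ b), hμ.2.2 ▸ h⟩, fun hμ =>
    ⟨fun b => ?_, fun b => extXK_of_notMem μ, h.unique hμ.2⟩⟩
  unfold extXK
  split_ifs
  exacts [hμ.1 _, le_rfl]

theorem pushTrunc_eq_push {ν : PTree 𝒳 → ℝ} (h : ∀ b, b ∉ bounded 𝒳 N₀ (j + 1) → ν b = 0)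
    (a : PTree 𝒳) : pushTrunc j ν a = push N₀ j ν a := by
  rw [pushTrunc, push, tsum_eq_sum fun b hb => by rw [h b hb, ite_self]]

theorem shiftInvK_iff {ν : PTree 𝒳 → ℝ} (h : ν ∈ probVec 𝒳 N₀ (j + 1)) :
    ShiftInvK (j + 1) ν ↔ ShiftMeasure N₀ j ν := by
  have H : ∀ a, (pushTrunc j ν a = ∑' b, (mchild a b : ℝ) * ν b ↔
      push N₀ j ν a = ∑ b ∈ bounded 𝒳 N₀ (j + 1), (b.children.count a : ℝ) * ν b) := fun a => by
    rw [pushTrunc_eq_push h.2.1, tsum_eq_sum fun b hb => by rw [h.2.1 b hb, mul_zero]]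
    rfl
  exact ⟨fun hs => ⟨h.1, h.2.1, h.2.2, fun a => (H a).1 (hs a)⟩, fun hs a => (H a).2 (hs.shift a)⟩

theorem isClosedEmbedding_extXK :
    Topology.IsClosedEmbedding fun μ : MK 𝒳 N₀ k => extXK μ.1 := by
  have hcont : Continuous fun μ : MK 𝒳 N₀ k => extXK μ.1 := by
    refine continuous_pi fun b => ?_
    by_cases hb : b ∈ bounded 𝒳 N₀ k
    · classical
      let c : XK 𝒳 N₀ k := ⟨b, mem_bounded_iff_height.1 hb⟩
      let f : {f : XK 𝒳 N₀ k → ℝ // ∃ M : ℝ, ∀ b, |f b| ≤ M} :=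
        ⟨Pi.single c 1, 1, fun x => by by_cases h : x = c <;> simp [h]⟩
      have hf : Continuous fun μ : MK 𝒳 N₀ k => ∑' b, μ.1 b * f.1 b := by
        have hF : Continuous fun (μ : MK 𝒳 N₀ k)
            (f : {f : XK 𝒳 N₀ k → ℝ // ∃ M : ℝ, ∀ b, |f b| ≤ M}) => ∑' b, μ.1 b * f.1 b :=
          continuous_induced_dom
        exact (continuous_apply f).comp hF
      refine hf.congr fun μ => ?_
      refine (tsum_eq_single c fun x hx => by simp [f, hx]).trans ?_
      simpa [f] using (extXK_coe μ.1 c).symm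
    · simp only [extXK_of_notMem _ hb]
      exact continuous_const
  refine ⟨⟨⟨le_antisymm (continuous_iff_le_induced.1 hcont) ?_⟩, fun μ ν h => ?_⟩, ?_⟩
  · refine continuous_iff_le_induced.1 ?_
    let G : (PTree 𝒳 → ℝ) → {f : XK 𝒳 N₀ k → ℝ // ∃ M : ℝ, ∀ b, |f b| ≤ M} → ℝ :=
      fun ν f => ∑ b ∈ bounded 𝒳 N₀ k, ν b * extXK f.1 b
    have hG : Continuous G := by
      unfold G
      fun_prop
    let := TopologicalSpace.induced (fun μ : MK 𝒳 N₀ k => extXK μ.1) inferInstance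
    refine (hG.comp (continuous_induced_dom (f := fun μ : MK 𝒳 N₀ k => extXK μ.1))).congr
      fun μ => ?_
    funext f
    refine (hasSum_XK fun b => extXK μ.1 b * extXK f.1 b).tsum_eq.symm.trans ?_
    simp only [extXK_coe]
  · refine Subtype.ext (funext fun b => ?_)
    simpa only [extXK_coe] using congr_fun h b.1
  · convert (isCompact_probVec (𝒳 := 𝒳) (N := N₀) k).isClosed
    ext ν
    refine ⟨?_, fun h => ⟨⟨fun b => ν b.1, mem_probVec_extXK.1 ?_⟩, extXK_restrict h.2.1⟩⟩
    · rintro ⟨μ, rfl⟩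
      exact mem_probVec_extXK.2 μ.2
    · rwa [extXK_restrict h.2.1]

end Extension

section RateFunction

variable {𝒳 : Type*} [Finite 𝒳] {𝒬 : 𝒳 → List 𝒳 → ℝ} {N₀ j : ℕ}

theorem tsum_relEnt_eq (h0 : ∀ a c, 0 ≤ 𝒬 a c) (h1 : ∀ a, HasSum (𝒬 a) 1)
    (hb : BoundedOffspring 𝒬 N₀) {ν : PTree 𝒳 → ℝ} (hν : ν ∈ probVec 𝒳 N₀ (j + 1))
    (hac : ∀ b, lastProb 𝒬 N₀ j b = 0 → ν b = 0) :
    ∑ b ∈ bounded 𝒳 N₀ (j + 1), ENNReal.ofReal (ν b * Real.log (ν b /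
        (push N₀ j ν (trunc j b) * lastProb 𝒬 N₀ j b)) +
          push N₀ j ν (trunc j b) * lastProb 𝒬 N₀ j b - ν b) =
      ENNReal.ofReal (divergence N₀ j (lastProb 𝒬 N₀ j) ν) := by
  have hlog : ∀ b ∈ bounded 𝒳 N₀ (j + 1), ν b * Real.log (ν b /
      (push N₀ j ν (trunc j b) * lastProb 𝒬 N₀ j b)) =
        ν b * (Real.log (ν b) - Real.log (push N₀ j ν (trunc j b) * lastProb 𝒬 N₀ j b)) := by
    intro b hb
    by_cases hb0 : ν b = 0
    · simp [hb0]
    · rw [Real.log_div hb0 fun h => hb0 (push_mul_eq_zero hν.1 hac hb h)]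
  have hsum : ∑ b ∈ bounded 𝒳 N₀ (j + 1), push N₀ j ν (trunc j b) * lastProb 𝒬 N₀ j b = 1 := by
    simp_rw [mul_comm (push N₀ j ν _)]
    rw [← sum_push_mul (lastProb 𝒬 N₀ j) (push N₀ j ν), ← hν.2.2, ← sum_push]
    exact Finset.sum_congr rfl fun a ha => by rw [push_lastProb h0 h1 hb ha, one_mul]
  rw [← ENNReal.ofReal_sum_of_nonneg fun b hb => ?_, Finset.sum_sub_distrib,
    Finset.sum_add_distrib, hsum, hν.2.2, add_sub_cancel_right, divergence_eq_mul hν.1 hac,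
    Finset.sum_congr rfl hlog]
  rw [hlog b hb]
  linarith [(sub_le_mul_log_sub_log (hν.1 b) (mul_nonneg (push_nonneg hν.1 _)
    (lastProb_nonneg (N₀ := N₀) (j := j) h0 b)) (push_mul_eq_zero hν.1 hac hb)).1]

open Classical in
theorem rateK_eq (h0 : ∀ a c, 0 ≤ 𝒬 a c) (h1 : ∀ a, HasSum (𝒬 a) 1)
    (hb : BoundedOffspring 𝒬 N₀) (μ : MK 𝒳 N₀ (j + 1)) :
    rateK 𝒬 N₀ (j + 1) μ.1 =
      if ShiftMeasure N₀ j (extXK μ.1) ∧ (∀ b, lastProb 𝒬 N₀ j b = 0 → extXK μ.1 b = 0) then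
        ENNReal.ofReal (divergence N₀ j (lastProb 𝒬 N₀ j) (extXK μ.1)) else ∞ := by
  have hν := mem_probVec_extXK.2 μ.2
  rw [rateK, ite_and, shiftInvK_iff hν]
  refine if_congr Iff.rfl ?_ rfl
  have hρ : ∀ b : XK 𝒳 N₀ (j + 1), attachLast 𝒬 (j + 1) (pushTrunc (j + 1 - 1) (extXK μ.1)) b.1 =
      push N₀ j (extXK μ.1) (trunc j b.1) * lastProb 𝒬 N₀ j b.1 := fun b => by
    rw [lastProb_of_mem (mem_bounded_iff_height.2 b.2), ← pushTrunc_eq_push hν.2.1]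
    rfl
  have hiff : (∀ b : XK 𝒳 N₀ (j + 1),
      push N₀ j (extXK μ.1) (trunc j b.1) * lastProb 𝒬 N₀ j b.1 = 0 → μ.1 b = 0) ↔
        ∀ b, lastProb 𝒬 N₀ j b = 0 → extXK μ.1 b = 0 := by
    refine ⟨fun h b hb0 => ?_, fun h b hb0 => ?_⟩
    · by_cases hmem : b ∈ bounded 𝒳 N₀ (j + 1)
      · exact (extXK_coe μ.1 ⟨b, mem_bounded_iff_height.1 hmem⟩).trans (h _ (by rw [hb0, mul_zero]))
      · exact hν.2.1 b hmem
    · rw [← extXK_coe μ.1 b]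
      exact push_mul_eq_zero hν.1 h (mem_bounded_iff_height.2 b.2) hb0
  rw [relEnt]
  simp only [hρ]
  refine ite_congr (propext hiff) (fun hac => ?_) fun _ => rfl
  rw [← tsum_relEnt_eq h0 h1 hb hν hac]
  refine Eq.trans ?_ (hasSum_XK _).tsum_eq
  simp only [extXK_coe]

end RateFunction

theorem extXK_mix {𝒳 : Type*} {N₀ k : ℕ} (μ ν : XK 𝒳 N₀ k → ℝ) (θ₁ θ₂ : ℝ) :
    extXK (fun b => θ₁ * μ b + θ₂ * ν b) = fun b => θ₁ * extXK μ b + θ₂ * extXK ν b := by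
  funext b
  unfold extXK
  split_ifs <;> simp

section GoodRate

variable {𝒳 : Type*} [Finite 𝒳] {𝒬 : 𝒳 → List 𝒳 → ℝ} {N₀ j : ℕ}

theorem rateK_mix_le (h0 : ∀ a c, 0 ≤ 𝒬 a c) (h1 : ∀ a, HasSum (𝒬 a) 1)
    (hb : BoundedOffspring 𝒬 N₀) (μ ν : MK 𝒳 N₀ (j + 1)) {θ₁ θ₂ : ℝ} (hθ₁ : 0 ≤ θ₁) (hθ₂ : 0 ≤ θ₂)
    (hθ : θ₁ + θ₂ = 1)
    (h : (∀ b, 0 ≤ θ₁ * μ.1 b + θ₂ * ν.1 b) ∧ HasSum (fun b => θ₁ * μ.1 b + θ₂ * ν.1 b) 1) :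
    rateK 𝒬 N₀ (j + 1) (fun b => θ₁ * μ.1 b + θ₂ * ν.1 b) ≤
      ENNReal.ofReal θ₁ * rateK 𝒬 N₀ (j + 1) μ.1 + ENNReal.ofReal θ₂ * rateK 𝒬 N₀ (j + 1) ν.1 := by
  rcases hθ₁.eq_or_lt with rfl | hθ₁
  · rw [zero_add] at hθ
    simp [hθ]
  rcases hθ₂.eq_or_lt with rfl | hθ₂
  · rw [add_zero] at hθ
    simp [hθ]
  rw [rateK_eq h0 h1 hb μ, rateK_eq h0 h1 hb ν]
  split_ifs with hμ hν
  · rw [rateK_eq h0 h1 hb (⟨_, h⟩ : MK 𝒳 N₀ (j + 1)), extXK_mix,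
      if_pos ⟨hμ.1.mix hν.1 hθ₁.le hθ₂.le hθ, fun b hb => by simp [hμ.2 b hb, hν.2 b hb]⟩,
      ← ENNReal.ofReal_mul hθ₁.le, ← ENNReal.ofReal_mul hθ₂.le, ← ENNReal.ofReal_add]
    · exact ENNReal.ofReal_le_ofReal (divergence_mix_le (lastProb_nonneg h0) hμ.1.nonneg
        hν.1.nonneg hμ.2 hν.2 hθ₁.le hθ₂.le)
    · exact mul_nonneg hθ₁.le (divergence_nonneg hμ.1.nonneg (lastProb_nonneg h0) hμ.2
        (push_lastProb_le_one h0 h1 hb))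
    · exact mul_nonneg hθ₂.le (divergence_nonneg hν.1.nonneg (lastProb_nonneg h0) hν.2
        (push_lastProb_le_one h0 h1 hb))
  all_goals simp [ENNReal.mul_top, hθ₁, hθ₂]

theorem isClosed_rateK_le (h0 : ∀ a c, 0 ≤ 𝒬 a c) (h1 : ∀ a, HasSum (𝒬 a) 1)
    (hb : BoundedOffspring 𝒬 N₀) {c : ℝ≥0∞} (hc : c ≠ ∞) :
    IsClosed {μ : MK 𝒳 N₀ (j + 1) | rateK 𝒬 N₀ (j + 1) μ.1 ≤ c} := by
  have hcl : IsClosed {ν : PTree 𝒳 → ℝ | shiftDefect N₀ j ν = 0 ∧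
      (∀ b, lastProb 𝒬 N₀ j b = 0 → ν b = 0) ∧
        divergence N₀ j (lastProb 𝒬 N₀ j) ν ≤ c.toReal} := by
    refine (isClosed_eq continuous_shiftDefect continuous_const).inter (IsClosed.inter ?_
      (isClosed_le continuous_divergence continuous_const))
    change IsClosed {ν : PTree 𝒳 → ℝ | ∀ b, lastProb 𝒬 N₀ j b = 0 → ν b = 0}
    rw [Set.ofPred_forall]
    refine isClosed_iInter fun b => ?_
    rw [Set.ofPred_forall]
    exact isClosed_iInter fun _ => isClosed_eq (continuous_apply b) continuous_const
  convert hcl.preimage (isClosedEmbedding_extXK (𝒳 := 𝒳) (N₀ := N₀) (k := j + 1)).continuous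
  ext μ
  have hμ := mem_probVec_extXK.2 μ.2
  simp only [Set.mem_ofPred_eq, Set.mem_preimage]
  rw [rateK_eq h0 h1 hb]
  split_ifs with h
  · rw [ENNReal.ofReal_le_iff_le_toReal hc]
    exact ⟨fun hle => ⟨h.1.shiftDefect_eq_zero, h.2, hle⟩, fun hh => hh.2.2⟩
  · exact ⟨fun hle => (hc (top_le_iff.1 hle)).elim,
      fun hh => (h ⟨shiftMeasure_of_shiftDefect hμ hh.1, hh.2.1⟩).elim⟩

theorem isCompact_rateK_le (h0 : ∀ a c, 0 ≤ 𝒬 a c) (h1 : ∀ a, HasSum (𝒬 a) 1)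
    (hb : BoundedOffspring 𝒬 N₀) {c : ℝ≥0∞} (hc : c ≠ ∞) :
    IsCompact {μ : MK 𝒳 N₀ (j + 1) | rateK 𝒬 N₀ (j + 1) μ.1 ≤ c} :=
  ((isClosedEmbedding_extXK (𝒳 := 𝒳)).isCompact_preimage
    (isCompact_probVec (𝒳 := 𝒳) (N := N₀) (j + 1))).of_isClosed_subset
      (isClosed_rateK_le h0 h1 hb hc) fun μ _ => mem_probVec_extXK.2 μ.2

theorem lowerSemicontinuous_rateK (h0 : ∀ a c, 0 ≤ 𝒬 a c) (h1 : ∀ a, HasSum (𝒬 a) 1)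
    (hb : BoundedOffspring 𝒬 N₀) :
    LowerSemicontinuous fun μ : MK 𝒳 N₀ (j + 1) => rateK 𝒬 N₀ (j + 1) μ.1 := by
  rw [lowerSemicontinuous_iff_isClosed_preimage]
  intro c
  by_cases hc : c = ∞
  · simp [hc]
  · exact isClosed_rateK_le h0 h1 hb hc

end GoodRate

section Conditioning

theorem inv_mul_elog_le {n : ℕ} (hn : 0 < n) {x : ℝ≥0∞} {y : ℝ}
    (h : x ≤ ENNReal.ofReal (Real.exp (n * y))) : (((n : ℝ)⁻¹ : ℝ) : EReal) * elog x ≤ y := by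
  have hn' : (0 : ℝ) < n := Nat.cast_pos.2 hn
  have hx : x ≠ ∞ := ne_top_of_le_ne_top ENNReal.ofReal_ne_top h
  rw [elog, if_neg hx]
  split_ifs with h0
  · rw [EReal.coe_mul_bot_of_pos (inv_pos.2 hn')]
    exact bot_le
  · rw [← EReal.coe_mul, EReal.coe_le_coe_iff, inv_mul_le_iff₀ hn',
      Real.log_le_iff_le_exp (ENNReal.toReal_pos h0 hx)]
    exact ENNReal.toReal_le_of_le_ofReal (Real.exp_pos _).le h

theorem le_inv_mul_elog {n : ℕ} (hn : 0 < n) {x : ℝ≥0∞} {y : ℝ}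
    (h : ENNReal.ofReal (Real.exp (n * y)) ≤ x) :
    (y : EReal) ≤ (((n : ℝ)⁻¹ : ℝ) : EReal) * elog x := by
  have hn' : (0 : ℝ) < n := Nat.cast_pos.2 hn
  have hx : x ≠ 0 := ((ENNReal.ofReal_pos.2 (Real.exp_pos _)).trans_le h).ne'
  rw [elog, if_neg hx]
  split_ifs with h0
  · rw [EReal.coe_mul_top_of_pos (inv_pos.2 hn')]
    exact le_top
  · rw [← EReal.coe_mul, EReal.coe_le_coe_iff, le_inv_mul_iff₀ hn',
      Real.le_log_iff_exp_le (ENNReal.toReal_pos hx h0)]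
    exact (ENNReal.ofReal_le_iff_le_toReal h0).1 h

theorem condP_eq {𝒳 : Type*} {w : PTree 𝒳 → ℝ} {n : ℕ} {E : Set (PTree 𝒳)} {k : ℕ}
    {U : Set (PTree 𝒳 → ℝ)} (h : ∀ t, ENNReal.ofReal (w t) ≠ 0 → (t ∈ E ↔ empK k t ∈ U)) :
    condP w n E = eventMass w k n U / treeMass w n := by
  rw [condP, eventMass]
  congr 1
  refine tsum_congr fun t => ?_
  by_cases hw : ENNReal.ofReal (w t) = 0
  · rw [hw, ite_self, ite_self]
  · have := h t hw
    split_ifs <;> tauto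


theorem exists_mem_iff_empK_mem {𝒳 : Type*} [Finite 𝒳] {N₀ k : ℕ} {U : Set (PTree 𝒳 → ℝ)}
    {t : PTree 𝒳} (ht : t.maxDeg ≤ N₀) :
    (∃ h, (⟨fun b : XK 𝒳 N₀ k => empK k t b.1, h⟩ : MK 𝒳 N₀ k) ∈
      (fun μ : MK 𝒳 N₀ k => extXK μ.1) ⁻¹' U) ↔ empK k t ∈ U := by
  have hmem := empK_mem_probVec ht k
  have hext := extXK_restrict hmem.2.1
  refine ⟨fun ⟨_, hU⟩ => ?_, fun hU => ⟨mem_probVec_extXK.1 (by rwa [hext]), ?_⟩⟩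
  · change extXK (fun b : XK 𝒳 N₀ k => empK k t b.1) ∈ U at hU
    rwa [hext] at hU
  · change extXK (fun b : XK 𝒳 N₀ k => empK k t b.1) ∈ U
    rwa [hext]

theorem condP_preimage {𝒳 : Type*} [Finite 𝒳] {𝒬 : 𝒳 → List 𝒳 → ℝ} {N₀ k : ℕ}
    {μ0 : 𝒳 → ℝ} (h0 : ∀ a c, 0 ≤ 𝒬 a c) (hb : BoundedOffspring 𝒬 N₀)
    (U : Set (PTree 𝒳 → ℝ)) (n : ℕ) :
    condP (mgwWeight μ0 𝒬) n {t | ∃ h, (⟨fun b : XK 𝒳 N₀ k => empK k t b.1, h⟩ : MK 𝒳 N₀ k) ∈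
      (fun μ : MK 𝒳 N₀ k => extXK μ.1) ⁻¹' U} =
        eventMass (mgwWeight μ0 𝒬) k n U / treeMass (mgwWeight μ0 𝒬) n :=
  condP_eq fun _ ht => exists_mem_iff_empK_mem ((ofReal_weight_ne_zero h0 ht).2.maxDeg_le hb)

end Conditioning

section Event

variable {𝒳 : Type*} [Fintype 𝒳] [DecidableEq 𝒳] {𝒬 : 𝒳 → List 𝒳 → ℝ} {N₀ j : ℕ}
  {u : 𝒳 → ℝ≥0∞} {μ0 : 𝒳 → ℝ}

theorem eventMass_le_exp (h : RegularKernel 𝒬 N₀ u) (hμ0 : ∀ a, 0 ≤ μ0 a) (hμ1 : ∀ a, μ0 a ≤ 1)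
    {F : Set (PTree 𝒳 → ℝ)} (hF : IsClosed F) {γ γ' : ℝ} (hγ' : γ' < γ)
    (hγ : ∀ ν ∈ F, ShiftMeasure N₀ j ν → (∀ b, lastProb 𝒬 N₀ j b = 0 → ν b = 0) →
      γ ≤ divergence N₀ j (lastProb 𝒬 N₀ j) ν) :
    ∀ᶠ n : ℕ in atTop, eventMass (mgwWeight μ0 𝒬) (j + 1) n F ≤
      ENNReal.ofReal (Real.exp (-(n * γ'))) := by
  filter_upwards [eventually_tsum_treeWeight_le (lastProb_nonneg h.nonneg)
    (fun b => lastProb_of_notMem) hF hγ' hγ] with n hn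
  refine le_trans (ENNReal.tsum_le_tsum fun t => ?_) hn
  split_ifs
  exacts [ofReal_mgwWeight_le h.nonneg h.hasSum h.bounded hμ0 hμ1 t, le_rfl]

theorem treeMass_le_exp (h : RegularKernel 𝒬 N₀ u) (hμ0 : ∀ a, 0 ≤ μ0 a) (hμ1 : ∀ a, μ0 a ≤ 1)
    {ε : ℝ} (hε : 0 < ε) :
    ∀ᶠ n : ℕ in atTop, treeMass (mgwWeight μ0 𝒬) n ≤ ENNReal.ofReal (Real.exp (n * ε)) := by
  filter_upwards [eventMass_le_exp (j := 0) h hμ0 hμ1 isClosed_univ (neg_lt_zero.2 hε)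
    fun ν _ hν hac => divergence_nonneg hν.nonneg (lastProb_nonneg h.nonneg) hac
      (push_lastProb_le_one h.nonneg h.hasSum h.bounded)] with n hn
  rwa [mul_neg, neg_neg, eventMass_univ] at hn

theorem limsup_condP_le (h : RegularKernel 𝒬 N₀ u) (hμ0 : ∀ a, 0 ≤ μ0 a) (hμ1 : ∀ a, μ0 a ≤ 1)
    {F : Set (MK 𝒳 N₀ (j + 1))} (hF : IsClosed F) :
    limsup (fun n : ℕ => (((n : ℝ)⁻¹ : ℝ) : EReal) * elog (condP (mgwWeight μ0 𝒬) n
        {t | ∃ h, (⟨fun b : XK 𝒳 N₀ (j + 1) => empK (j + 1) t b.1, h⟩ : MK 𝒳 N₀ (j + 1)) ∈ F}))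
      (atTop ⊓ 𝓟 (sizeSupport (mgwWeight μ0 𝒬))) ≤
        - ⨅ μ ∈ F, (rateK 𝒬 N₀ (j + 1) μ.1 : EReal) := by
  have hemb := isClosedEmbedding_extXK (𝒳 := 𝒳) (N₀ := N₀) (k := j + 1)
  obtain ⟨U, hU, rfl⟩ := hemb.isClosed_iff.1 hF
  refine EReal.le_of_forall_lt_iff_le.1 fun z hz => ?_
  obtain ⟨x, hx, hxz⟩ := EReal.lt_iff_exists_real_btwn.1 hz
  rw [EReal.coe_lt_coe_iff] at hxz
  have hγ : ∀ ν ∈ U, ShiftMeasure N₀ j ν → (∀ b, lastProb 𝒬 N₀ j b = 0 → ν b = 0) →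
      -x ≤ divergence N₀ j (lastProb 𝒬 N₀ j) ν := by
    intro ν hν hs hac
    have hext := extXK_restrict hs.supp
    let μ : MK 𝒳 N₀ (j + 1) :=
      ⟨fun b => ν b.1, mem_probVec_extXK.1 (by rw [hext]; exact hs.mem_probVec)⟩
    have hle := (EReal.neg_lt_comm.1 hx).le.trans
      (iInf₂_le μ (show extXK μ.1 ∈ U from hext.symm ▸ hν))
    rw [rateK_eq h.nonneg h.hasSum h.bounded, if_pos (by rw [hext]; exact ⟨hs, hac⟩), hext,
      EReal.coe_ennreal_ofReal, max_eq_left (divergence_nonneg hs.nonneg (lastProb_nonneg h.nonneg)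
        hac (push_lastProb_le_one h.nonneg h.hasSum h.bounded))] at hle
    exact_mod_cast hle
  have hε : 0 < (z - x) / 2 := half_pos (sub_pos.2 hxz)
  refine limsup_le_of_le ?_ ?_
  · isBoundedDefault
  filter_upwards [(eventMass_le_exp h hμ0 hμ1 hU (sub_lt_self _ hε) hγ).filter_mono inf_le_left,
    eventually_le_treeMass h hμ0 hε,
    (eventually_gt_atTop 0).filter_mono inf_le_left] with n h1 h2 h3
  refine inv_mul_elog_le h3 ?_
  rw [condP_preimage h.nonneg h.bounded]
  refine (ENNReal.div_le_div h1 h2).trans_eq ?_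
  rw [← ENNReal.ofReal_div_of_pos (Real.exp_pos _), ← Real.exp_sub]
  congr 2
  ring

theorem le_liminf_condP (h : RegularKernel 𝒬 N₀ u) (hμ0 : ∀ a, 0 ≤ μ0 a) (hμ1 : ∀ a, μ0 a ≤ 1)
    {O : Set (MK 𝒳 N₀ (j + 1))} (hO : IsOpen O) :
    - ⨅ μ ∈ O, (rateK 𝒬 N₀ (j + 1) μ.1 : EReal) ≤
      liminf (fun n : ℕ => (((n : ℝ)⁻¹ : ℝ) : EReal) * elog (condP (mgwWeight μ0 𝒬) n
          {t | ∃ h, (⟨fun b : XK 𝒳 N₀ (j + 1) => empK (j + 1) t b.1, h⟩ : MK 𝒳 N₀ (j + 1)) ∈ O}))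
        (atTop ⊓ 𝓟 (sizeSupport (mgwWeight μ0 𝒬))) := by
  obtain ⟨U, hU, rfl⟩ :=
    (isClosedEmbedding_extXK (𝒳 := 𝒳) (N₀ := N₀) (k := j + 1)).isInducing.isOpen_iff.1 hO
  refine EReal.ge_of_forall_gt_iff_ge.1 fun z hz => ?_
  have hlt := EReal.lt_neg_comm.1 hz
  simp only [iInf_lt_iff, exists_prop] at hlt
  obtain ⟨μ, hμU, hμz⟩ := hlt
  rw [rateK_eq h.nonneg h.hasSum h.bounded] at hμz
  split_ifs at hμz with hμ
  swap
  · exact absurd hμz not_top_lt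
  rw [EReal.coe_ennreal_ofReal, max_eq_left (divergence_nonneg hμ.1.nonneg
    (lastProb_nonneg h.nonneg) hμ.2 (push_lastProb_le_one h.nonneg h.hasSum h.bounded)),
    ← EReal.coe_neg, EReal.coe_lt_coe_iff] at hμz
  have hε := half_pos (sub_pos.2 hμz)
  refine le_liminf_of_le ?_ ?_
  · isBoundedDefault
  filter_upwards [eventually_le_eventMass h hμ.1 hμ.2 hμ0 hU hμU hε,
    (treeMass_le_exp h hμ0 hμ1 hε).filter_mono inf_le_left,
    (eventually_gt_atTop 0).filter_mono inf_le_left] with n h1 h2 h3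
  refine le_inv_mul_elog h3 ?_
  rw [condP_preimage h.nonneg h.bounded]
  refine le_trans (le_of_eq ?_) (ENNReal.div_le_div h1 h2)
  rw [← ENNReal.ofReal_div_of_pos (Real.exp_pos _), ← Real.exp_sub]
  congr 2
  ring

end Event

theorem Admissible.exists_leaf {𝒳 : Type*} {𝒬 : 𝒳 → List 𝒳 → ℝ} {t : PTree 𝒳}
    (h : Admissible 𝒬 t) : ∃ z, 0 < 𝒬 z [] := by
  induction t using PTree.induction with
  | h a ts ih =>
    rw [admissible_node] at h
    rcases ts with - | ⟨s, ts⟩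
    · exact ⟨a, h.1⟩
    · exact ih s List.mem_cons_self (h.2 s List.mem_cons_self)

theorem exists_regularKernel {𝒳 : Type*} [Fintype 𝒳] [DecidableEq 𝒳] {𝒬 : 𝒳 → List 𝒳 → ℝ} {N₀ : ℕ}
    (h0 : ∀ a c, 0 ≤ 𝒬 a c) (h1 : ∀ a, HasSum (𝒬 a) 1) (hb : BoundedOffspring 𝒬 N₀)
    (hirr : IrredKernel 𝒬) (hcrit : CriticalKernel 𝒬) {μ0 : 𝒳 → ℝ}
    (hS : (sizeSupport (mgwWeight μ0 𝒬)).Nonempty) : ∃ u, RegularKernel 𝒬 N₀ u := by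
  obtain ⟨n, hn⟩ := hS
  obtain ⟨t, -, ht⟩ := exists_of_mem_sizeSupport hn
  have : Nonempty 𝒳 := ⟨t.root⟩
  obtain ⟨u, hu, hsum, he⟩ := exists_eigenvector h0 h1 hb hcrit
  refine ⟨u, h0, h1, hb, fun x y => ?_, hu, hsum, he,
    Admissible.exists_leaf (ofReal_weight_ne_zero h0 ht).2⟩
  have hpos := (hirr y x).ne'
  simp only [matStar, Matrix.of_apply, ne_eq, ENNReal.tsum_eq_zero, not_forall] at hpos
  obtain ⟨k, hk⟩ := hpos
  exact transGen_of_pow k y x hk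

end PTree

section Statement16

variable {𝒳 : Type*} [Fintype 𝒳] [DecidableEq 𝒳]

theorem ldp_k_generation_empirical_offspring_measure
    (𝒬 : 𝒳 → List 𝒳 → ℝ) (h𝒬_nonneg : ∀ a c, 0 ≤ 𝒬 a c) (h𝒬_sum : ∀ a, HasSum (𝒬 a) 1)
    (N₀ : ℕ) (hbdd : BoundedOffspring 𝒬 N₀)
    (hirr : IrredKernel 𝒬) (hcrit : CriticalKernel 𝒬)
    (μ0 : 𝒳 → ℝ) (hμ0_nonneg : ∀ a, 0 ≤ μ0 a) (hμ0_sum : ∑ a, μ0 a = 1)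
    (k : ℕ) (hk : 1 ≤ k)
    (Jk : MK 𝒳 N₀ k → ℝ≥0∞) (hJk : ∀ μ, Jk μ = rateK 𝒬 N₀ k μ.1)
    (S : Set ℕ) (hS : S = sizeSupport (mgwWeight μ0 𝒬)) :
    -- `J_k` is convex
    (∀ (μ ν : MK 𝒳 N₀ k) (θ : ℝ), 0 ≤ θ → θ ≤ 1 →
      ∀ h : (∀ b, 0 ≤ θ * μ.1 b + (1 - θ) * ν.1 b) ∧
          HasSum (fun b => θ * μ.1 b + (1 - θ) * ν.1 b) 1,
        Jk ⟨fun b => θ * μ.1 b + (1 - θ) * ν.1 b, h⟩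
          ≤ ENNReal.ofReal θ * Jk μ + ENNReal.ofReal (1 - θ) * Jk ν) ∧
    -- `J_k` is a good rate function
    LowerSemicontinuous Jk ∧
    (∀ c : ℝ≥0∞, c ≠ ∞ → IsCompact {μ : MK 𝒳 N₀ k | Jk μ ≤ c}) ∧
    -- large deviation upper bound, conditionally on `{|T| = n}`, along `n ∈ S`
    (∀ F : Set (MK 𝒳 N₀ k), IsClosed F →
      Filter.limsup
        (fun n : ℕ => (((n : ℝ)⁻¹ : ℝ) : EReal) *
          elog (condP (mgwWeight μ0 𝒬) n
            {t | ∃ h, (⟨fun b : XK 𝒳 N₀ k => empK k t b.1, h⟩ : MK 𝒳 N₀ k) ∈ F}))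
        (Filter.atTop ⊓ Filter.principal S)
        ≤ - ⨅ μ ∈ F, (Jk μ : EReal)) ∧
    -- large deviation lower bound
    (∀ O : Set (MK 𝒳 N₀ k), IsOpen O →
      - ⨅ μ ∈ O, (Jk μ : EReal) ≤
      Filter.liminf
        (fun n : ℕ => (((n : ℝ)⁻¹ : ℝ) : EReal) *
          elog (condP (mgwWeight μ0 𝒬) n
            {t | ∃ h, (⟨fun b : XK 𝒳 N₀ k => empK k t b.1, h⟩ : MK 𝒳 N₀ k) ∈ O}))
        (Filter.atTop ⊓ Filter.principal S)) := by
  obtain ⟨j, rfl⟩ : ∃ j, k = j + 1 := ⟨k - 1, by omega⟩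
  obtain rfl : Jk = fun μ => rateK 𝒬 N₀ (j + 1) μ.1 := funext hJk
  subst hS
  have hμ1 : ∀ a, μ0 a ≤ 1 := fun a =>
    hμ0_sum ▸ Finset.single_le_sum (fun b _ => hμ0_nonneg b) (Finset.mem_univ a)
  refine ⟨fun μ ν θ hθ₀ hθ₁ h => PTree.rateK_mix_le h𝒬_nonneg h𝒬_sum hbdd μ ν hθ₀
      (sub_nonneg.2 hθ₁) (add_sub_cancel _ _) h,
    PTree.lowerSemicontinuous_rateK h𝒬_nonneg h𝒬_sum hbdd,
    fun c hc => PTree.isCompact_rateK_le h𝒬_nonneg h𝒬_sum hbdd hc, ?_⟩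
  rcases (sizeSupport (mgwWeight μ0 𝒬)).eq_empty_or_nonempty with hempty | hne
  · simp [hempty, principal_empty]
  · obtain ⟨u, hreg⟩ := PTree.exists_regularKernel h𝒬_nonneg h𝒬_sum hbdd hirr hcrit hne
    exact ⟨fun F hF => PTree.limsup_condP_le hreg hμ0_nonneg hμ1 hF,
      fun O hO => PTree.le_liminf_condP hreg hμ0_nonneg hμ1 hO⟩

end Statement16
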